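/- Assume a = a(ε) > 0 is bounded and lim_{ε→0} ε^{1−3γ/2} ln a = 0 for some γ ∈ [0,2/3). Then for every sufficiently small ε the global minimizer v_{ε,a} has at least one zero x̄_ε with |x̄_ε| ≤ ρ + o(ε^γ); moreover any sequence of zeros of v_{ε,a} either satisfies |x̄_ε| ≤ ρ + o(ε^γ) or diverges to ∞. -/

import Mathlib

open MeasureTheory Filter Real Set
open scoped Topology ENNReal

noncomputable section

/-- We identify the plane with the Euclidean space `ℝ²`. -/
abbrev E2 : Type := EuclideanSpace ℝ (Fin 2)

/-- The standard basis vectors of `ℝ²`. -/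
def e2basis (i : Fin 2) : E2 := EuclideanSpace.single i 1

/-- Rotation of a vector by `π/2` (multiplication by `i` in complex notation). -/
def perp (e : E2) : E2 := EuclideanSpace.single 0 (-(e 1)) + EuclideanSpace.single 1 (e 0)

/-- The unit vector `e^{iθ}`. -/
def uvec (θ : ℝ) : E2 := EuclideanSpace.single 0 (Real.cos θ) + EuclideanSpace.single 1 (Real.sin θ)

/-- The Laplacian of a map `u : ℝ² → ℝ²`. -/
def lap (u : E2 → E2) (x : E2) : E2 :=
  ∑ i : Fin 2, fderiv ℝ (fun y => fderiv ℝ u y (e2basis i)) x (e2basis i)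

/-- `|∇u|²`, the squared Hilbert-Schmidt norm of the full gradient of `u : ℝ² → ℝ²`. -/
def gradSq (u : E2 → E2) (x : E2) : ℝ := ∑ i : Fin 2, ‖fderiv ℝ u x (e2basis i)‖ ^ 2

/-- `∑_j ∇u_j · ∇ψ_j`, the Hilbert-Schmidt inner product of the gradients. -/
def gradInner (u ψ : E2 → E2) (x : E2) : ℝ :=
  ∑ i : Fin 2, (inner ℝ (fderiv ℝ u x (e2basis i)) (fderiv ℝ ψ x (e2basis i)) : ℝ)

/-- Membership in `H¹(ℝ²,ℝ²)`: `u ∈ L²` together with its gradient. -/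
def MemH1 (u : E2 → E2) : Prop :=
  Differentiable ℝ u ∧ MemLp u 2 (volume : Measure E2) ∧
    MemLp (fun x => fderiv ℝ u x) 2 (volume : Measure E2)

/-- The Ginzburg–Landau energy
`E(u) = ∫ (1/2)|∇u|² − (1/(2ε²))μ|u|² + (1/(4ε²))|u|⁴ − (a/ε) f·u`. -/
def energy (ε a : ℝ) (μ : E2 → ℝ) (f : E2 → E2) (u : E2 → E2) : ℝ :=
  ∫ x : E2, ((1/2) * gradSq u x - (1/(2*ε^2)) * μ x * ‖u x‖^2
    + (1/(4*ε^2)) * ‖u x‖^4 - (a/ε) * (inner ℝ (f x) (u x) : ℝ))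

/-- `v` is a global minimizer of `E` over `H¹(ℝ²,ℝ²)`. -/
def IsMinimizer (ε a : ℝ) (μ : E2 → ℝ) (f : E2 → E2) (v : E2 → E2) : Prop :=
  MemH1 v ∧ ∀ u : E2 → E2, MemH1 u → energy ε a μ f v ≤ energy ε a μ f u

/-- `u` is a smooth classical solution of the Euler–Lagrange equation
`ε²Δu + μu − |u|²u + εa f = 0` on `ℝ²`. -/
def IsSolution (ε a : ℝ) (μ : E2 → ℝ) (f : E2 → E2) (u : E2 → E2) : Prop :=
  ContDiff ℝ (⊤ : ℕ∞) u ∧ ∀ x : E2, ε^2 • lap u x + μ x • u x - ‖u x‖^2 • u x + (ε*a) • f x = 0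

/-- Hypotheses on the radial coefficient `μ`. -/
structure MuHyp (μ : E2 → ℝ) (μrad : ℝ → ℝ) (ρ : ℝ) : Prop where
  smooth : ContDiff ℝ (⊤ : ℕ∞) μ
  smooth_rad : ContDiff ℝ (⊤ : ℕ∞) μrad
  even_rad : ∀ r : ℝ, μrad (-r) = μrad r
  radial : ∀ x : E2, μ x = μrad ‖x‖
  bdd : ∃ C : ℝ, ∀ x : E2, |μ x| ≤ C
  deriv_neg : ∀ r : ℝ, 0 < r → deriv μrad r < 0
  rho_pos : 0 < ρ
  rho_root : μrad ρ = 0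
  rho_unique : ∀ r : ℝ, 0 < r → μrad r = 0 → r = ρ

/-- Hypotheses on the radial vector field `f`. -/
structure FHyp (f : E2 → E2) (frad : ℝ → ℝ) : Prop where
  smooth : ContDiff ℝ (⊤ : ℕ∞) f
  smooth_rad : ContDiff ℝ (⊤ : ℕ∞) frad
  odd_rad : ∀ r : ℝ, frad (-r) = -frad r
  radial : ∀ x : E2, x ≠ 0 → f x = (frad ‖x‖ / ‖x‖) • x
  integrable : Integrable f (volume : Measure E2)
  bdd : ∃ C : ℝ, ∀ x : E2, ‖f x‖ ≤ C
  pos_rad : ∀ r : ℝ, 0 < r → 0 < frad r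

/-- Convergence in `C²_loc(ℝ²,ℝ²)` of a sequence of maps. -/
def TendstoC2LocSeq (F : ℕ → E2 → E2) (g : E2 → E2) : Prop :=
  TendstoLocallyUniformly F g atTop ∧
  TendstoLocallyUniformly (fun n x => fderiv ℝ (F n) x) (fun x => fderiv ℝ g x) atTop ∧
  TendstoLocallyUniformly (fun n x => fderiv ℝ (fderiv ℝ (F n)) x)
    (fun x => fderiv ℝ (fderiv ℝ g) x) atTop

/-- `l` is a limit point (as `ε → 0`) of the set of zeros of the family `v ε`. -/
def IsZeroLimitPoint (v : ℝ → E2 → E2) (l : E2) : Prop :=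
  ∃ (εs : ℕ → ℝ) (xs : ℕ → E2), (∀ n, 0 < εs n) ∧ Tendsto εs atTop (𝓝 (0:ℝ)) ∧
    (∀ n, v (εs n) (xs n) = 0) ∧ Tendsto xs atTop (𝓝 l)

open scoped BoundedContinuousFunction in
/-- Global existence for linear ODEs on `[0,∞)` with bounded continuous coefficients. -/
theorem linODE_exists {F : Type*} [NormedAddCommGroup F] [NormedSpace ℝ F] [CompleteSpace F]
    (A : ℝ → F →L[ℝ] F) (hA : Continuous A) (C : ℝ) (hC : ∀ t, ‖A t‖ ≤ C) (y0 : F) :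
    ∃ y : ℝ → F, y 0 = y0 ∧ Continuous y ∧ ∀ t, 0 < t → HasDerivAt y (A t (y t)) t := by
  have hC0 : 0 ≤ C := (norm_nonneg _).trans (hC 0)
  set Λ : ℝ := 2 * C + 1 with hΛ
  have hΛ0 : 0 < Λ := by positivity
  -- the integral
  let I : (ℝ →ᵇ F) → ℝ → F := fun u τ => ∫ s in (0:ℝ)..τ, Real.exp (Λ * s) • A s (u s)
  have hcont : ∀ u : ℝ →ᵇ F, Continuous fun s => Real.exp (Λ * s) • A s (u s) := by
    intro u
    exact (by fun_prop : Continuous fun s : ℝ => Real.exp (Λ * s)).smul (hA.clm_apply u.continuous)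
  have hIcont : ∀ u, Continuous (I u) := fun u =>
    intervalIntegral.continuous_primitive (fun a b => (hcont u).intervalIntegrable a b) 0
  -- key bound
  have hbound : ∀ (u : ℝ →ᵇ F) (K : ℝ), 0 ≤ K → (∀ s, ‖u s‖ ≤ K) → ∀ τ, 0 ≤ τ →
      ‖I u τ‖ ≤ C * K / Λ * Real.exp (Λ * τ) := by
    intro u K hK hu τ hτ
    have h1 : ‖I u τ‖ ≤ ∫ s in (0:ℝ)..τ, C * K * Real.exp (Λ * s) := by
      apply intervalIntegral.norm_integral_le_of_norm_le hτ
      · refine Eventually.of_forall fun s _ => ?_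
        rw [norm_smul, Real.norm_eq_abs, abs_of_pos (Real.exp_pos _)]
        have : ‖A s (u s)‖ ≤ C * K := (A s).le_of_opNorm_le_of_le (hC s) (hu s)
        nlinarith [Real.exp_pos (Λ * s)]
      · exact (by fun_prop : Continuous fun s : ℝ => C * K * Real.exp (Λ * s)).intervalIntegrable _ _
    have h2 : ∫ s in (0:ℝ)..τ, C * K * Real.exp (Λ * s)
        = C * K / Λ * Real.exp (Λ * τ) - C * K / Λ * Real.exp (Λ * 0) := by
      apply intervalIntegral.integral_eq_sub_of_hasDerivAt (f := fun s => C * K / Λ * Real.exp (Λ * s))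
      · intro s _
        have := (((hasDerivAt_id s).const_mul Λ).exp).const_mul (C * K / Λ)
        refine HasDerivAt.congr_deriv this ?_
        simp only [id]; field_simp
      · exact (by fun_prop : Continuous fun s : ℝ => C * K * Real.exp (Λ * s)).intervalIntegrable _ _
    rw [h2] at h1
    have : 0 ≤ C * K / Λ * Real.exp (Λ * 0) := by positivity
    linarith
  have hIsub : ∀ u w : ℝ →ᵇ F, ∀ τ, I u τ - I w τ = I (u - w) τ := by
    intro u w τ
    simp only [I]
    rw [← intervalIntegral.integral_sub ((hcont u).intervalIntegrable _ _)
      ((hcont w).intervalIntegrable _ _)]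
    congr 1; ext s; simp [smul_sub]
  let T : (ℝ →ᵇ F) → (ℝ →ᵇ F) := fun u =>
    BoundedContinuousFunction.ofNormedAddCommGroup
      (fun t => Real.exp (-(Λ * max t 0)) • (y0 + I u (max t 0)))
      (by
        have := (hIcont u).comp (by fun_prop : Continuous fun t : ℝ => max t 0)
        exact (by fun_prop : Continuous fun t : ℝ => Real.exp (-(Λ * max t 0))).smul
          (continuous_const.add this))
      (‖y0‖ + C * ‖u‖ / Λ) (by
        intro t
        have h0 : 0 ≤ max t 0 := le_max_right _ _
        rw [norm_smul, Real.norm_eq_abs, abs_of_pos (Real.exp_pos _)]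
        have h1 := hbound u ‖u‖ (norm_nonneg _) u.norm_coe_le_norm (max t 0) h0
        have h2 : ‖y0 + I u (max t 0)‖ ≤ ‖y0‖ + C * ‖u‖ / Λ * Real.exp (Λ * max t 0) :=
          (norm_add_le _ _).trans (by linarith)
        have h3 : Real.exp (-(Λ * max t 0)) ≤ 1 := Real.exp_le_one_iff.2 (by nlinarith)
        calc _ ≤ Real.exp (-(Λ * max t 0)) * (‖y0‖ + C * ‖u‖ / Λ * Real.exp (Λ * max t 0)) := by gcongr
          _ = Real.exp (-(Λ * max t 0)) * ‖y0‖ + C * ‖u‖ / Λ *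
              (Real.exp (-(Λ * max t 0)) * Real.exp (Λ * max t 0)) := by ring
          _ ≤ _ := by
            rw [← Real.exp_add]; simp
            nlinarith [norm_nonneg y0])
  have hT : ContractingWith (1/2 : NNReal) T := by
    refine ⟨by rw [← NNReal.coe_lt_coe]; norm_num, LipschitzWith.of_dist_le_mul fun u w => ?_⟩
    rw [BoundedContinuousFunction.dist_le (by positivity)]
    intro t
    have h0 : 0 ≤ max t 0 := le_max_right _ _
    have : T u t - T w t = Real.exp (-(Λ * max t 0)) • I (u - w) (max t 0) := by
      rw [← hIsub]
      simp only [T, BoundedContinuousFunction.coe_ofNormedAddCommGroup, ← smul_sub]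
      congr 1; abel
    rw [dist_eq_norm, this, norm_smul, Real.norm_eq_abs, abs_of_pos (Real.exp_pos _)]
    have h1 := hbound (u - w) ‖u - w‖ (norm_nonneg _) (u - w).norm_coe_le_norm (max t 0) h0
    calc _ ≤ Real.exp (-(Λ * max t 0)) * (C * ‖u - w‖ / Λ * Real.exp (Λ * max t 0)) := by gcongr
      _ = C / Λ * ‖u - w‖ * (Real.exp (-(Λ * max t 0)) * Real.exp (Λ * max t 0)) := by ring
      _ = C / Λ * ‖u - w‖ := by rw [← Real.exp_add]; simp
      _ ≤ _ := by
        rw [dist_eq_norm]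
        have : C / Λ ≤ 1 / 2 := by rw [div_le_div_iff₀ hΛ0 (by norm_num)]; linarith
        push_cast
        gcongr
  set u := ContractingWith.fixedPoint T hT
  have hu : T u = u := hT.fixedPoint_isFixedPt
  refine ⟨fun t => y0 + I u t, by simp [I], continuous_const.add (hIcont u), ?_⟩
  intro t ht
  have hd : HasDerivAt (I u) (Real.exp (Λ * t) • A t (u t)) t :=
    intervalIntegral.integral_hasDerivAt_right ((hcont u).intervalIntegrable _ _)
      ((hcont u).stronglyMeasurableAtFilter _ _) (hcont u).continuousAt
  have hut : u t = Real.exp (-(Λ * t)) • (y0 + I u t) := by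
    conv_lhs => rw [← hu]
    simp [T, max_eq_left ht.le]
  have : Real.exp (Λ * t) • A t (u t) = A t (y0 + I u t) := by
    rw [hut, map_smul, smul_smul, ← Real.exp_add]; simp
  rw [this] at hd
  exact hd.const_add y0

/-- `y(|x|²)` solves `Δ y = P y` for `|x|² > s₁`. -/
structure RadSol (P : ℝ → ℝ) (s1 : ℝ) (y : ℝ → ℝ) : Prop where
  cont : ContinuousOn y (Ici s1)
  c2 : ContDiffOn ℝ 2 y (Ioi s1)
  ode : ∀ s, s1 < s → 4 * s * deriv (deriv y) s + 4 * deriv y s = P s * y s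

theorem RadSol.mk' {P : ℝ → ℝ} {s1 : ℝ} {y p : ℝ → ℝ} (hs1 : 0 < s1)
    (hP : ContinuousOn P (Ici s1)) (hy : ContinuousOn y (Ici s1))
    (h1 : ∀ s, s1 < s → HasDerivAt y (p s / s) s)
    (h2 : ∀ s, s1 < s → HasDerivAt p (P s * y s / 4) s) :
    RadSol P s1 y ∧ ∀ s, s1 < s → deriv y s = p s / s := by
  have hd : ∀ s, s1 < s → deriv y s = p s / s := fun s hs => (h1 s hs).deriv
  have hdd : ∀ s, s1 < s → HasDerivAt (deriv y) ((P s * y s / 4 * s - p s) / s ^ 2) s := by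
    intro s hs
    have hs0 : s ≠ 0 := (hs1.trans hs).ne'
    have := (h2 s hs).div (hasDerivAt_id s) hs0
    refine (this.congr_of_eventuallyEq ?_).congr_deriv (by simp)
    filter_upwards [lt_mem_nhds hs] with u hu
    simp [hd u hu]
  refine ⟨⟨hy, ?_, ?_⟩, hd⟩
  · have e2 : (2 : WithTop ℕ∞) = 1 + 1 := by norm_num
    have e1 : (1 : WithTop ℕ∞) = 0 + 1 := by norm_num
    rw [e2, contDiffOn_succ_iff_deriv_of_isOpen isOpen_Ioi]
    refine ⟨fun s hs => (h1 s hs).differentiableAt.differentiableWithinAt, by simp, ?_⟩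
    rw [e1, contDiffOn_succ_iff_deriv_of_isOpen isOpen_Ioi]
    refine ⟨fun s hs => (hdd s hs).differentiableAt.differentiableWithinAt, by simp, ?_⟩
    rw [contDiffOn_zero]
    have : ContinuousOn (fun s => (P s * y s / 4 * s - p s) / s ^ 2) (Ioi s1) := by
      have hp : ContinuousOn p (Ioi s1) := fun s hs => (h2 s hs).continuousAt.continuousWithinAt
      have hP' := hP.mono Ioi_subset_Ici_self
      have hy' := hy.mono Ioi_subset_Ici_self
      refine ContinuousOn.div ?_ (by fun_prop) (fun s hs => by
        have : 0 < s := hs1.trans hs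
        positivity)
      exact (((hP'.mul hy').div_const 4).mul continuousOn_id).sub hp
    exact this.congr fun s hs => (hdd s hs).deriv
  · intro s hs
    have hs0 : s ≠ 0 := (hs1.trans hs).ne'
    rw [(hdd s hs).deriv, hd s hs]
    field_simp; ring

theorem growing_exists (s1 : ℝ) (hs1 : 0 < s1) (P : ℝ → ℝ) (hP : ContinuousOn P (Ici s1))
    (c : ℝ) (hc : 0 < c) (C : ℝ) (hcP : ∀ s, s1 ≤ s → 4 * c ≤ P s) (hPC : ∀ s, s1 ≤ s → P s ≤ C) :
    ∃ G p : ℝ → ℝ, Continuous G ∧ Continuous p ∧ (∀ s, s1 < s → HasDerivAt G (p s / s) s) ∧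
      (∀ s, s1 < s → HasDerivAt p (P s * G s / 4) s) ∧
      (∀ s, s1 ≤ s → 1 + c * (s - s1) ≤ G s) ∧ (∀ s, s1 ≤ s → c * s ≤ p s) ∧ MonotoneOn p (Ici s1) := by
  let M1 : (ℝ × ℝ) →L[ℝ] (ℝ × ℝ) := (ContinuousLinearMap.snd ℝ ℝ ℝ).prod 0
  let M2 : (ℝ × ℝ) →L[ℝ] (ℝ × ℝ) := (0 : (ℝ × ℝ) →L[ℝ] ℝ).prod (ContinuousLinearMap.fst ℝ ℝ ℝ)
  let A : ℝ → (ℝ × ℝ) →L[ℝ] (ℝ × ℝ) := fun t =>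
    (1 / (s1 + max t 0)) • M1 + (P (s1 + max t 0) / 4) • M2
  have hpos : ∀ t : ℝ, s1 ≤ s1 + max t 0 := fun t => by linarith [le_max_right t 0]
  have hA : Continuous A := by
    have h1 : Continuous fun t : ℝ => 1 / (s1 + max t 0) :=
      Continuous.div continuous_const (by fun_prop) (fun t => by linarith [hpos t])
    have h2 : Continuous fun t : ℝ => P (s1 + max t 0) :=
      hP.comp_continuous (by fun_prop) (fun t => hpos t)
    exact (h1.smul continuous_const).add ((h2.div_const 4).smul continuous_const)
  have hAb : ∀ t, ‖A t‖ ≤ 1 / s1 * ‖M1‖ + C / 4 * ‖M2‖ := by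
    intro t
    have h0 := hpos t
    have hP1 := hcP _ h0
    have hP2 := hPC _ h0
    refine (norm_add_le _ _).trans ?_
    rw [norm_smul, norm_smul]
    have e1 : ‖1 / (s1 + max t 0)‖ ≤ 1 / s1 := by
      rw [Real.norm_eq_abs, abs_of_pos (by positivity)]
      gcongr
    have e2 : ‖P (s1 + max t 0) / 4‖ ≤ C / 4 := by
      rw [Real.norm_eq_abs, abs_of_pos (by linarith)]
      linarith
    gcongr
  obtain ⟨y, y0, yc, yd⟩ := linODE_exists A hA _ hAb (1, c * s1)
  set G : ℝ → ℝ := fun s => (y (s - s1)).1 with hG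
  set p : ℝ → ℝ := fun s => (y (s - s1)).2 with hp
  have hGc : Continuous G := by fun_prop
  have hpc : Continuous p := by fun_prop
  have hyd : ∀ s, s1 < s → HasDerivAt (fun s => y (s - s1)) (A (s - s1) (y (s - s1))) s := by
    intro s hs
    have := (yd (s - s1) (by linarith)).scomp s ((hasDerivAt_id s).sub_const s1)
    simpa [Function.comp_def] using this
  have hGd : ∀ s, s1 < s → HasDerivAt G (p s / s) s := by
    intro s hs
    have := (HasFDerivAt.fst (hyd s hs).hasFDerivAt).hasDerivAt
    refine this.congr_deriv ?_
    have hm : max (s - s1) 0 = s - s1 := max_eq_left (by linarith)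
    simp [A, M1, M2, hm, hp]
    ring
  have hpd : ∀ s, s1 < s → HasDerivAt p (P s * G s / 4) s := by
    intro s hs
    have := (HasFDerivAt.snd (hyd s hs).hasFDerivAt).hasDerivAt
    refine this.congr_deriv ?_
    have hm : max (s - s1) 0 = s - s1 := max_eq_left (by linarith)
    simp [A, M1, M2, hm, hG]
    ring
  have hG1 : G s1 = 1 := by simp [hG, y0]
  have hp1 : p s1 = c * s1 := by simp [hp, y0]
  have mono : ∀ (q q' : ℝ → ℝ), ContinuousOn q (Ici s1) → (∀ s, s1 < s → HasDerivAt q (q' s) s) →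
      (∀ s, s1 < s → 0 ≤ q' s) → MonotoneOn q (Ici s1) := by
    intro q q' hq hd h0
    apply monotoneOn_of_deriv_nonneg (convex_Ici s1) hq
    · rw [interior_Ici]; exact fun s hs => (hd s hs).differentiableAt.differentiableWithinAt
    · rw [interior_Ici]; intro s hs; rw [(hd s hs).deriv]; exact h0 s hs
  have hprod : ∀ s, s1 ≤ s → c * s1 ≤ G s * p s := by
    intro s hs
    have := mono (fun s => G s * p s) _ (by fun_prop) (fun s hs => (hGd s hs).mul (hpd s hs)) (by
      intro s hs
      have h0 : 0 < s := hs1.trans hs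
      have := hcP s hs.le
      have e : p s / s * p s + G s * (P s * G s / 4) = p s ^ 2 / s + P s / 4 * G s ^ 2 := by ring
      rw [e]
      have : 0 ≤ P s := by linarith
      positivity) self_mem_Ici hs hs
    simpa [hG1, hp1] using this
  have hGpos : ∀ s, s1 ≤ s → 0 < G s := by
    intro s hs
    by_contra hn
    have : (0:ℝ) ∈ Icc (G s) (G s1) := ⟨not_lt.1 hn, by rw [hG1]; norm_num⟩
    obtain ⟨u, hu, hu0⟩ := intermediate_value_Icc' hs hGc.continuousOn this
    have := hprod u hu.1
    rw [hu0] at this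
    nlinarith
  have hppos : ∀ s, s1 ≤ s → 0 < p s := by
    intro s hs
    have h1 := hprod s hs
    have : 0 < G s * p s := by nlinarith
    exact pos_of_mul_pos_right this (hGpos s hs).le
  have hGge1 : ∀ s, s1 ≤ s → 1 ≤ G s := by
    intro s hs
    have := mono G _ hGc.continuousOn hGd (fun s hs =>
      div_nonneg (hppos s hs.le).le (hs1.trans hs).le) self_mem_Ici hs hs
    rwa [hG1] at this
  have hpge : ∀ s, s1 ≤ s → c * s ≤ p s := by
    intro s hs
    have := mono (fun s => p s - c * s) _ (by fun_prop)
      (fun s hs => (hpd s hs).sub ((hasDerivAt_id s).const_mul c)) (fun s hs => by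
        have h1 := hGge1 s hs.le
        have h2 := hcP s hs.le
        simp only [mul_one]
        nlinarith) self_mem_Ici hs hs
    simp only [hp1] at this
    linarith
  refine ⟨G, p, hGc, hpc, hGd, hpd, ?_, hpge, ?_⟩
  · intro s hs
    have := mono (fun s => G s - c * s) _ (by fun_prop)
      (fun s hs => (hGd s hs).sub ((hasDerivAt_id s).const_mul c)) (fun s hs => by
        have h0 : 0 < s := hs1.trans hs
        have h1 := hpge s hs.le
        have : c ≤ p s / s := by rwa [le_div_iff₀ h0]
        simp only [mul_one]
        linarith) self_mem_Ici hs hs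
    simp only [hG1] at this
    linarith
  · exact mono p _ hpc.continuousOn hpd (fun s hs => by
      have h1 := hGge1 s hs.le
      have h2 := hcP s hs.le
      have : 0 ≤ P s := by linarith
      positivity)

theorem decaying_exists (s1 : ℝ) (hs1 : 0 < s1) (P : ℝ → ℝ) (hP : ContinuousOn P (Ici s1))
    (k : ℝ) (hk : 0 < k) (C : ℝ) (hkP : ∀ s, s1 ≤ s → k ^ 2 ≤ P s) (hPC : ∀ s, s1 ≤ s → P s ≤ C) :
    ∃ G h : ℝ → ℝ, RadSol P s1 G ∧ RadSol P s1 h ∧ (∀ s, s1 ≤ s → 1 ≤ G s) ∧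
      Tendsto G atTop atTop ∧ h s1 = 1 ∧ (∀ s, s1 ≤ s → 0 < h s) ∧
      (∀ s, s1 < s → 2 * √s * deriv h s ≤ - (k * h s)) ∧
      (∀ s, s1 ≤ s → h s ≤ Real.exp (-(k * (√s - √s1)))) ∧
      (∀ s t, s1 < s → s ≤ t → s * deriv h s ≤ t * deriv h t) := by
  have hc : 0 < k ^ 2 / 4 := by positivity
  obtain ⟨G, p, hGc, hpc, hGd, hpd, hG1, hp1, hpm⟩ := growing_exists s1 hs1 P hP (k ^ 2 / 4) hc C
    (fun s hs => by linarith [hkP s hs]) hPC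
  have hGge : ∀ s, s1 ≤ s → 1 ≤ G s := fun s hs => by nlinarith [hG1 s hs]
  have hGpos : ∀ s, s1 ≤ s → 0 < G s := fun s hs => by linarith [hGge s hs]
  have hppos : ∀ s, s1 ≤ s → 0 < p s := fun s hs => by
    have := hp1 s hs
    have : 0 < k ^ 2 / 4 * s := mul_pos hc (by linarith)
    linarith
  have hGtop : Tendsto G atTop atTop := by
    refine tendsto_atTop_mono' atTop (f₁ := fun s => 1 + k ^ 2 / 4 * (s - s1)) ?_ ?_
    · filter_upwards [eventually_ge_atTop s1] with s hs using hG1 s hs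
    · exact tendsto_atTop_add_const_left _ _
        ((tendsto_atTop_add_const_right _ (-s1) tendsto_id).const_mul_atTop hc)
  -- the integrand
  set w : ℝ → ℝ := fun u => 1 / (u * G u ^ 2) with hw
  have hwpos : ∀ u, s1 ≤ u → 0 < w u := fun u hu => by
    have := hGpos u hu
    have : 0 < u := by linarith
    simp only [hw]; positivity
  have hwc : ContinuousOn w (Ici s1) := by
    refine ContinuousOn.div continuousOn_const (by fun_prop) fun u hu => ?_
    have := hGpos u hu
    have : 0 < u := lt_of_lt_of_le hs1 hu
    positivity
  have hderinv : ∀ u, s1 < u → HasDerivAt (fun u => -(1 / G u)) (p u / u / G u ^ 2) u := by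
    intro u hu
    have := (hGd u hu).inv (hGpos u hu.le).ne'
    refine (this.neg.congr_deriv (by ring)).congr_of_eventuallyEq ?_
    exact Eventually.of_forall fun x => by simp
  have hlim : Tendsto (fun u => -(1 / G u)) atTop (𝓝 0) := by
    have := (tendsto_inv_atTop_zero.comp hGtop).neg
    simpa [Function.comp_def] using this
  have hcontinv : ContinuousOn (fun u => -(1 / G u)) (Ici s1) :=
    (ContinuousOn.div continuousOn_const hGc.continuousOn fun u hu => (hGpos u hu).ne').neg
  have hint1 : ∀ s, s1 ≤ s → IntegrableOn (fun u => p u / u / G u ^ 2) (Ioi s) := by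
    intro s hs
    refine integrableOn_Ioi_deriv_of_nonneg
      ((hcontinv s hs).mono (Ici_subset_Ici.2 hs))
      (fun u hu => hderinv u (lt_of_le_of_lt hs hu)) (fun u hu => ?_) hlim
    have h1 := hppos u (hs.trans (le_of_lt hu))
    have : 0 < u := hs1.trans (lt_of_le_of_lt hs hu)
    positivity
  have hint1v : ∀ s, s1 ≤ s → ∫ u in Ioi s, p u / u / G u ^ 2 = 1 / G s := by
    intro s hs
    have := integral_Ioi_of_hasDerivAt_of_nonneg
      ((hcontinv s hs).mono (Ici_subset_Ici.2 hs))
      (fun u hu => hderinv u (lt_of_le_of_lt hs hu)) (fun u hu => by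
        have h1 := hppos u (hs.trans (le_of_lt hu))
        have : 0 < u := hs1.trans (lt_of_le_of_lt hs hu)
        positivity) hlim
    rw [this]; ring
  have hwle : ∀ s u, s1 ≤ s → s ≤ u → p s * w u ≤ p u / u / G u ^ 2 := by
    intro s u hs hu
    have h1 := hpm hs (hs.trans hu) hu
    have h2 := hwpos u (hs.trans hu)
    have : p u / u / G u ^ 2 = p u * w u := by simp only [hw]; field_simp
    rw [this]; gcongr
  have hwint : ∀ s, s1 ≤ s → IntegrableOn w (Ioi s) := by
    intro s hs
    have hm : AEStronglyMeasurable w (volume.restrict (Ioi s)) :=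
      (hwc.mono fun u hu => hs.trans (le_of_lt hu)).aestronglyMeasurable measurableSet_Ioi
    refine Integrable.mono' ((hint1 s hs).const_mul (1 / p s)) hm ?_
    refine (ae_restrict_iff' measurableSet_Ioi).2 (Eventually.of_forall fun u hu => ?_)
    have hsu : s ≤ u := le_of_lt hu
    rw [Real.norm_eq_abs, abs_of_pos (hwpos u (hs.trans hsu))]
    have := hwle s u hs hsu
    have h3 := hppos s hs
    rw [div_mul_eq_mul_div, le_div_iff₀ h3]; linarith
  set J : ℝ → ℝ := fun s => (∫ u in Ioi s1, w u) - ∫ u in s1..s, w u with hJ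
  have hJeq : ∀ s, s1 ≤ s → J s = ∫ u in Ioi s, w u := by
    intro s hs
    have := intervalIntegral.integral_Ioi_sub_Ioi (hwint s1 le_rfl) hs
    simp only [hJ]; linarith
  have hii : ∀ s, s1 ≤ s → IntervalIntegrable w volume s1 s := fun s hs =>
    (hwc.mono (by rw [uIcc_of_le hs]; exact Icc_subset_Ici_self)).intervalIntegrable
  have hJd : ∀ s, s1 < s → HasDerivAt J (-w s) s := by
    intro s hs
    have hca : ContinuousAt w s := hwc.continuousAt (Ici_mem_nhds hs)
    have := intervalIntegral.integral_hasDerivAt_right (hii s hs.le)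
      ((hwc.mono Ioi_subset_Ici_self).stronglyMeasurableAtFilter isOpen_Ioi s hs) hca
    simpa using this.const_sub (∫ u in Ioi s1, w u)
  have hJpos : ∀ s, s1 ≤ s → 0 < J s := by
    intro s hs
    rw [hJeq s hs, setIntegral_pos_iff_support_of_nonneg_ae]
    · have : Ioi s ⊆ Function.support w ∩ Ioi s := fun u hu =>
        ⟨(hwpos u (hs.trans (le_of_lt hu))).ne', hu⟩
      refine lt_of_lt_of_le ?_ (measure_mono this)
      simp
    · refine (ae_restrict_iff' measurableSet_Ioi).2 (Eventually.of_forall fun u hu => ?_)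
      exact (hwpos u (hs.trans (le_of_lt hu))).le
    · exact hwint s hs
  have hJc : ContinuousOn J (Ici s1) := by
    intro s hs
    rcases eq_or_lt_of_le (show s1 ≤ s from hs) with rfl | hlt
    · refine ContinuousWithinAt.sub continuousWithinAt_const ?_
      have h1 : ContinuousOn (fun b => ∫ u in s1..b, w u) (Icc s1 (s1 + 1)) := by
        have := intervalIntegral.continuousOn_primitive_interval' (μ := volume) (f := w)
          (hii (s1 + 1) (by linarith)) (left_mem_uIcc)
        rwa [uIcc_of_le (by linarith)] at this
      refine (h1 s1 ⟨le_rfl, by linarith⟩).mono_of_mem_nhdsWithin ?_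
      exact Icc_mem_nhdsGE (by linarith)
    · exact (hJd s hlt).continuousAt.continuousWithinAt
  have hpJ : ∀ s, s1 ≤ s → p s * J s ≤ 1 / G s := by
    intro s hs
    rw [hJeq s hs, ← hint1v s hs, ← integral_const_mul]
    refine setIntegral_mono_on ((hwint s hs).const_mul _) (hint1 s hs) measurableSet_Ioi ?_
    exact fun u hu => hwle s u hs (le_of_lt hu)
  -- the decaying solution
  set J1 := J s1 with hJ1
  have hJ1pos : 0 < J1 := hJpos s1 le_rfl
  have hGs1 : G s1 * J1 ≠ 0 := (mul_pos (hGpos s1 le_rfl) hJ1pos).ne'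
  set h : ℝ → ℝ := fun s => G s * J s / (G s1 * J1) with hh
  set ph : ℝ → ℝ := fun s => (p s * J s - 1 / G s) / (G s1 * J1) with hph
  have hhc : ContinuousOn h (Ici s1) := (hGc.continuousOn.mul hJc).div_const _
  have hhd : ∀ s, s1 < s → HasDerivAt h (ph s / s) s := by
    intro s hs
    have := ((hGd s hs).mul (hJd s hs)).div_const (G s1 * J1)
    refine this.congr_deriv ?_
    have := (hGpos s hs.le).ne'
    have : s ≠ 0 := (hs1.trans hs).ne'
    simp only [hph, hw]; field_simp; ring
  have hphd : ∀ s, s1 < s → HasDerivAt ph (P s * h s / 4) s := by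
    intro s hs
    have := (((hpd s hs).mul (hJd s hs)).add (hderinv s hs)).div_const (G s1 * J1)
    refine (this.congr_deriv ?_).congr_of_eventuallyEq ?_
    · have := (hGpos s hs.le).ne'
      have : s ≠ 0 := (hs1.trans hs).ne'
      simp only [hh, hw]; field_simp; ring
    · exact Eventually.of_forall fun u => by simp [hph, sub_eq_add_neg]
  obtain ⟨hR, hRd⟩ := RadSol.mk' hs1 hP hhc hhd hphd
  obtain ⟨hRG, -⟩ := RadSol.mk' hs1 hP hGc.continuousOn hGd hpd
  have hhpos : ∀ s, s1 ≤ s → 0 < h s := fun s hs =>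
    div_pos (mul_pos (hGpos s hs) (hJpos s hs)) (mul_pos (hGpos s1 le_rfl) hJ1pos)
  have hph0 : ∀ s, s1 ≤ s → ph s ≤ 0 := fun s hs =>
    div_nonpos_of_nonpos_of_nonneg (by linarith [hpJ s hs])
      (mul_pos (hGpos s1 le_rfl) hJ1pos).le
  have hh1 : h s1 = 1 := by simp only [hh]; exact div_self hGs1
  have hhle : ∀ s, s1 ≤ s → h s ≤ 1 := by
    intro s hs
    have := antitoneOn_of_deriv_nonpos (convex_Ici s1) hhc (by
      rw [interior_Ici]; exact fun s hs => (hhd s hs).differentiableAt.differentiableWithinAt) (by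
      rw [interior_Ici]; intro s hs; rw [(hhd s hs).deriv]
      exact div_nonpos_of_nonpos_of_nonneg (hph0 s (le_of_lt hs)) (hs1.trans hs).le)
      self_mem_Ici hs hs
    rwa [hh1] at this
  -- the decay rate; q = 2 √s h' + k h
  have hsq : ∀ s, s1 < s → HasDerivAt (fun s => √s) (1 / (2 * √s)) s := fun s hs =>
    Real.hasDerivAt_sqrt (hs1.trans hs).ne'
  set q : ℝ → ℝ := fun s => 2 * ph s / √s + k * h s with hq
  have hqd : ∀ s, s1 < s → HasDerivAt q
      ((2 * (P s * h s / 4) * √s - 2 * ph s * (1 / (2 * √s))) / √s ^ 2 + k * (ph s / s)) s := by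
    intro s hs
    have h0 : √s ≠ 0 := (Real.sqrt_pos.2 (hs1.trans hs)).ne'
    exact (((hphd s hs).const_mul 2).div (hsq s hs) h0).add ((hhd s hs).const_mul k)
  have hq0 : ∀ s, s1 < s → q s ≤ 0 := by
    intro s0 hs0
    by_contra hn
    push Not at hn
    have hmono : MonotoneOn (fun s => q s * Real.exp (-(k * √s))) (Ici s0) := by
      have hd : ∀ s, s0 ≤ s → HasDerivAt (fun s => q s * Real.exp (-(k * √s)))
          (((2 * (P s * h s / 4) * √s - 2 * ph s * (1 / (2 * √s))) / √s ^ 2 + k * (ph s / s)) *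
            Real.exp (-(k * √s)) + q s * (Real.exp (-(k * √s)) * (-(k * (1 / (2 * √s)))))) s := by
        intro s hs
        have hs' := lt_of_lt_of_le hs0 hs
        exact (hqd s hs').mul (((hsq s hs').const_mul k).neg.exp)
      apply monotoneOn_of_deriv_nonneg (convex_Ici s0)
      · exact fun s hs => (hd s hs).continuousAt.continuousWithinAt
      · rw [interior_Ici]; exact fun s hs => (hd s (le_of_lt hs)).differentiableAt.differentiableWithinAt
      · rw [interior_Ici]; intro s hs
        rw [(hd s (le_of_lt hs)).deriv]
        have hs' : s1 < s := hs0.trans hs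
        have h0 : 0 < √s := Real.sqrt_pos.2 (hs1.trans hs')
        have hss : √s ^ 2 = s := Real.sq_sqrt (hs1.trans hs').le
        have e : ((2 * (P s * h s / 4) * √s - 2 * ph s * (1 / (2 * √s))) / √s ^ 2 + k * (ph s / s)) *
            Real.exp (-(k * √s)) + q s * (Real.exp (-(k * √s)) * (-(k * (1 / (2 * √s)))))
            = Real.exp (-(k * √s)) * ((P s - k ^ 2) * h s / (2 * √s) + (- ph s) / √s ^ 3) := by
          simp only [hq]
          nth_rewrite 8 [← hss]
          generalize √s = r at *
          field_simp
          ring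
        rw [e]
        have h1 := hkP s hs'.le
        have h2 := hhpos s hs'.le
        have h3 := hph0 s hs'.le
        have h4 : 0 ≤ P s - k ^ 2 := by linarith
        have h5 : 0 ≤ - ph s := by linarith
        positivity
    -- q ≤ k
    have hqk : ∀ s, s1 < s → q s ≤ k := by
      intro s hs
      have h0 : 0 < √s := Real.sqrt_pos.2 (hs1.trans hs)
      have h1 : 2 * ph s / √s ≤ 0 :=
        div_nonpos_of_nonpos_of_nonneg (by linarith [hph0 s hs.le]) h0.le
      have := hhle s hs.le
      simp only [hq]; nlinarith
    have hlim2 : Tendsto (fun s : ℝ => k * Real.exp (-(k * √s))) atTop (𝓝 (k * 0)) := by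
      refine Tendsto.const_mul k ?_
      exact Real.tendsto_exp_neg_atTop_nhds_zero.comp (Real.tendsto_sqrt_atTop.const_mul_atTop hk)
    rw [mul_zero] at hlim2
    have hpos : 0 < q s0 * Real.exp (-(k * √s0)) := mul_pos hn (Real.exp_pos _)
    obtain ⟨s, hs, hs2⟩ := ((hlim2.eventually (gt_mem_nhds hpos)).and (eventually_ge_atTop s0)).exists
    have h1 := hmono self_mem_Ici hs2 hs2
    have h2 := hqk s (lt_of_lt_of_le hs0 hs2)
    have h3 := Real.exp_pos (-(k * √s))
    simp only at h1
    nlinarith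
  refine ⟨G, h, hRG, hR, hGge, hGtop, hh1, hhpos, ?_, ?_, ?_⟩
  · intro s hs
    have h0 : 0 < √s := Real.sqrt_pos.2 (hs1.trans hs)
    have hss : √s ^ 2 = s := Real.sq_sqrt (hs1.trans hs).le
    have := hq0 s hs
    simp only [hq] at this
    rw [hRd s hs]
    have e : 2 * √s * (ph s / s) = 2 * ph s / √s := by
      have e0 : ph s / s = ph s / √s ^ 2 := by rw [hss]
      rw [e0]; field_simp
    rw [e]; linarith
  · intro s hs
    have hanti : AntitoneOn (fun s => h s * Real.exp (k * √s)) (Ici s1) := by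
      have hd : ∀ s, s1 < s → HasDerivAt (fun s => h s * Real.exp (k * √s))
          (ph s / s * Real.exp (k * √s) + h s * (Real.exp (k * √s) * (k * (1 / (2 * √s))))) s :=
        fun s hs => (hhd s hs).mul (((hsq s hs).const_mul k).exp)
      apply antitoneOn_of_deriv_nonpos (convex_Ici s1)
      · exact hhc.mul (by fun_prop)
      · rw [interior_Ici]; exact fun s hs => (hd s hs).differentiableAt.differentiableWithinAt
      · rw [interior_Ici]; intro s hs
        rw [(hd s hs).deriv]
        have h0 : 0 < √s := Real.sqrt_pos.2 (hs1.trans hs)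
        have hss : √s ^ 2 = s := Real.sq_sqrt (hs1.trans hs).le
        have e : ph s / s * Real.exp (k * √s) + h s * (Real.exp (k * √s) * (k * (1 / (2 * √s))))
            = q s * (Real.exp (k * √s) / (2 * √s)) := by
          have e0 : ph s / s = ph s / √s ^ 2 := by rw [hss]
          simp only [hq]; rw [e0]; field_simp
        rw [e]
        exact mul_nonpos_of_nonpos_of_nonneg (hq0 s hs) (by positivity)
    have := hanti self_mem_Ici hs hs
    simp only [hh1, one_mul] at this
    have e : Real.exp (-(k * (√s - √s1))) = Real.exp (k * √s1) * Real.exp (-(k * √s)) := by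
      rw [← Real.exp_add]; congr 1; ring
    rw [e]
    calc h s = h s * Real.exp (k * √s) * Real.exp (-(k * √s)) := by
          rw [mul_assoc, ← Real.exp_add]; simp
      _ ≤ _ := by gcongr
  · intro s t hs hst
    have ht := lt_of_lt_of_le hs hst
    rw [hRd s hs, hRd t ht, mul_div_cancel₀ _ (hs1.trans hs).ne', mul_div_cancel₀ _ (hs1.trans ht).ne']
    have : MonotoneOn ph (Ioi s1) := by
      apply monotoneOn_of_deriv_nonneg (convex_Ioi s1)
      · exact fun s hs => (hphd s hs).continuousAt.continuousWithinAt
      · rw [interior_Ioi]; exact fun s hs => (hphd s hs).differentiableAt.differentiableWithinAt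
      · rw [interior_Ioi]; intro s hs; rw [(hphd s hs).deriv]
        have h1 := hkP s (le_of_lt hs)
        have h2 := hhpos s (le_of_lt hs)
        have : 0 ≤ P s := by nlinarith
        positivity
    exact this hs ht hst

/-- Inner product of two covectors. -/
def dotp (L M : E2 →L[ℝ] ℝ) : ℝ := ∑ i : Fin 2, L (e2basis i) * M (e2basis i)

/-- Scalar Laplacian. -/
def lapS (u : E2 → ℝ) (x : E2) : ℝ :=
  ∑ i : Fin 2, fderiv ℝ (fun y => fderiv ℝ u y (e2basis i)) x (e2basis i)

/-- Weak solutions of `Δ w = F` (tested against compactly supported functions). -/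
structure WeakSol (w F : E2 → ℝ) : Prop where
  diff : Differentiable ℝ w
  l2 : MemLp (fderiv ℝ w) 2 (volume : Measure E2)
  cont : Continuous F
  weak : ∀ φ : E2 → ℝ, Differentiable ℝ φ → HasCompactSupport φ →
    MemLp (fderiv ℝ φ) 2 (volume : Measure E2) →
    ∫ x, (dotp (fderiv ℝ w x) (fderiv ℝ φ x) + F x * φ x) = 0

theorem norm_e2basis (i : Fin 2) : ‖e2basis i‖ = 1 := by simp [e2basis]

theorem inner_e2basis (x : E2) (i : Fin 2) : inner ℝ x (e2basis i) = x i := by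
  rw [e2basis, EuclideanSpace.inner_single_right]; simp

theorem dotp_sub_right (L M N : E2 →L[ℝ] ℝ) : dotp L (M - N) = dotp L M - dotp L N := by
  simp [dotp, mul_sub, Finset.sum_sub_distrib]

theorem dotp_sub_left (L M N : E2 →L[ℝ] ℝ) : dotp (L - M) N = dotp L N - dotp M N := by
  simp [dotp, sub_mul]

theorem dotp_smul_right (c : ℝ) (L M : E2 →L[ℝ] ℝ) : dotp L (c • M) = c * dotp L M := by
  simp [dotp]; ring

theorem dotp_smul_left (c : ℝ) (L M : E2 →L[ℝ] ℝ) : dotp (c • L) M = c * dotp L M := by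
  simp [dotp]; ring

theorem dotp_self_nonneg (L : E2 →L[ℝ] ℝ) : 0 ≤ dotp L L :=
  Finset.sum_nonneg fun _ _ => mul_self_nonneg _

theorem memLp_apply {L : E2 → E2 →L[ℝ] ℝ} (h : MemLp L 2 (volume : Measure E2)) (e : E2) :
    MemLp (fun x => L x e) 2 (volume : Measure E2) :=
  (ContinuousLinearMap.apply ℝ ℝ e).comp_memLp' h

theorem integrable_dotp {L M : E2 → E2 →L[ℝ] ℝ} (hL : MemLp L 2 (volume : Measure E2))
    (hM : MemLp M 2 (volume : Measure E2)) : Integrable (fun x => dotp (L x) (M x)) := by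
  unfold dotp
  exact integrable_finsetSum _ fun i _ => (memLp_apply hL _).integrable_mul (memLp_apply hM _)

theorem integrable_mul_cpt {F φ : E2 → ℝ} (hF : Continuous F) (hφ : Continuous φ)
    (hc : HasCompactSupport φ) : Integrable (fun x => F x * φ x) :=
  (hF.mul hφ).integrable_of_hasCompactSupport hc.mul_left

theorem WeakSol.sub {w1 w2 F1 F2 : E2 → ℝ} (h1 : WeakSol w1 F1) (h2 : WeakSol w2 F2) :
    WeakSol (fun x => w1 x - w2 x) (fun x => F1 x - F2 x) := by
  have hd : ∀ x, fderiv ℝ (fun x => w1 x - w2 x) x = fderiv ℝ w1 x - fderiv ℝ w2 x :=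
    fun x => fderiv_fun_sub (h1.diff x) (h2.diff x)
  refine ⟨h1.diff.sub h2.diff, ?_, h1.cont.sub h2.cont, ?_⟩
  · have : (fderiv ℝ fun x => w1 x - w2 x) = fderiv ℝ w1 - fderiv ℝ w2 := funext hd
    rw [this]; exact h1.l2.sub h2.l2
  · intro φ hφ hc hl
    have e1 := h1.weak φ hφ hc hl
    have e2 := h2.weak φ hφ hc hl
    have i1 := (integrable_dotp h1.l2 hl).add (integrable_mul_cpt h1.cont hφ.continuous hc)
    have i2 := (integrable_dotp h2.l2 hl).add (integrable_mul_cpt h2.cont hφ.continuous hc)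
    have := integral_sub i1 i2
    simp only [Pi.add_apply] at this
    rw [e1, e2] at this
    rw [sub_zero] at this
    rw [← this]
    congr 1; ext x
    rw [hd, dotp_sub_left]; ring

theorem WeakSol.neg {w F : E2 → ℝ} (h : WeakSol w F) :
    WeakSol (fun x => - w x) (fun x => - F x) := by
  have hd : ∀ x, fderiv ℝ (fun x => - w x) x = - fderiv ℝ w x := fun x => fderiv_fun_neg
  refine ⟨h.diff.neg, ?_, h.cont.neg, ?_⟩
  · have : (fderiv ℝ fun x => - w x) = - fderiv ℝ w := funext hd
    rw [this]; exact h.l2.neg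
  · intro φ hφ hc hl
    rw [← neg_eq_zero, ← integral_neg, ← h.weak φ hφ hc hl]
    congr 1; ext x
    rw [hd]; simp [dotp]; ring

theorem lapS_congr {u v : E2 → ℝ} {x : E2} (h : u =ᶠ[𝓝 x] v) : lapS u x = lapS v x := by
  unfold lapS
  refine Finset.sum_congr rfl fun i _ => ?_
  have : (fun y => fderiv ℝ u y (e2basis i)) =ᶠ[𝓝 x] fun y => fderiv ℝ v y (e2basis i) := by
    filter_upwards [h.fderiv (𝕜 := ℝ)] with y hy
    rw [hy]
  rw [this.fderiv_eq]

theorem fderiv_normSq (x0 y e : E2) :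
    fderiv ℝ (fun y : E2 => ‖y - x0‖ ^ 2) y e = 2 * inner ℝ (y - x0) e := by
  have h : HasFDerivAt (fun y : E2 => y - x0) (ContinuousLinearMap.id ℝ E2) y :=
    (hasFDerivAt_id y).sub_const x0
  rw [h.norm_sq.fderiv]; simp [inner_sub_left]

/-- global C² extension -/
theorem exists_global {ψ : E2 → ℝ} {x0 : E2} (h : ContDiffAt ℝ 2 ψ x0) :
    ∃ ψ' : E2 → ℝ, ContDiff ℝ 2 ψ' ∧ ψ' =ᶠ[𝓝 x0] ψ := by
  obtain ⟨u, hu, hψ⟩ := h.eventually (by simp) |>.exists_mem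
  obtain ⟨r, hr, hru⟩ := Metric.nhds_basis_closedBall.mem_iff.1 hu
  let β : ContDiffBump x0 := ⟨r / 2, r, by positivity, by linarith⟩
  refine ⟨fun x => β x * ψ x, ?_, ?_⟩
  · rw [contDiff_iff_contDiffAt]
    intro x
    by_cases hx : x ∈ Metric.closedBall x0 r
    · exact β.contDiff.contDiffAt.mul (hψ x (hru hx))
    · have : (fun x => β x * ψ x) =ᶠ[𝓝 x] fun _ => 0 := by
        filter_upwards [Metric.isClosed_closedBall.isOpen_compl.mem_nhds hx] with y hy
        rw [β.zero_of_le_dist, zero_mul]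
        have : ¬ dist y x0 ≤ r := hy
        show r ≤ _
        linarith
      exact contDiffAt_const.congr_of_eventuallyEq this
  · filter_upwards [β.eventuallyEq_one] with y hy
    simp [hy]

theorem dC1 {ψ : E2 → ℝ} (h : ContDiff ℝ 2 ψ) (e : E2) :
    ContDiff ℝ 1 (fun y => fderiv ℝ ψ y e) :=
  (h.fderiv_right (m := 1) (by norm_num)).clm_apply contDiff_const

theorem lapS_cont {ψ : E2 → ℝ} (h : ContDiff ℝ 2 ψ) : Continuous (lapS ψ) := by
  unfold lapS
  refine continuous_finsetSum _ fun i _ => ?_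
  exact ((dC1 h _).continuous_fderiv (by norm_num)).clm_apply continuous_const

theorem lapS_sub {ψ χ : E2 → ℝ} (h : ContDiff ℝ 2 ψ) (h' : ContDiff ℝ 2 χ) (x : E2) :
    lapS (fun y => ψ y - χ y) x = lapS ψ x - lapS χ x := by
  unfold lapS
  rw [← Finset.sum_sub_distrib]
  refine Finset.sum_congr rfl fun i _ => ?_
  have : (fun y => fderiv ℝ (fun y => ψ y - χ y) y (e2basis i)) =
      fun y => fderiv ℝ ψ y (e2basis i) - fderiv ℝ χ y (e2basis i) := by
    ext y
    rw [fderiv_fun_sub (h.differentiable (by norm_num) y) (h'.differentiable (by norm_num) y)]; rfl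
  rw [this, fderiv_fun_sub ((dC1 h _).differentiable (by norm_num) x)
    ((dC1 h' _).differentiable (by norm_num) x)]
  rfl

theorem lapS_normSq (c : ℝ) (x0 x : E2) : lapS (fun y => c * ‖y - x0‖ ^ 2) x = 4 * c := by
  unfold lapS
  have : ∀ i, (fun y => fderiv ℝ (fun y : E2 => c * ‖y - x0‖ ^ 2) y (e2basis i)) =
      fun y => c * (2 * inner ℝ (y - x0) (e2basis i)) := by
    intro i; ext y
    have hd : DifferentiableAt ℝ (fun y : E2 => ‖y - x0‖ ^ 2) y :=
      ((hasFDerivAt_id y).sub_const x0).norm_sq.differentiableAt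
    rw [fderiv_const_mul hd]
    simp only [smul_apply, fderiv_normSq, smul_eq_mul]
  simp only [this]
  have : ∀ i, fderiv ℝ (fun y : E2 => c * (2 * inner ℝ (y - x0) (e2basis i))) x (e2basis i) = 2 * c := by
    intro i
    have h : HasFDerivAt (fun y : E2 => c * (2 * inner ℝ (e2basis i) (y - x0)))
        (c • ((2:ℝ) • (innerSL ℝ (e2basis i)))) x :=
      ((((innerSL ℝ (e2basis i)).hasFDerivAt (x := x - x0)).comp x
        ((hasFDerivAt_id x).sub_const x0)).const_mul 2).const_mul c
    have e : (fun y : E2 => c * (2 * inner ℝ (y - x0) (e2basis i))) =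
      (fun y : E2 => c * (2 * inner ℝ (e2basis i) (y - x0))) := by
      ext y; rw [real_inner_comm]
    rw [e, h.fderiv]
    simp [norm_e2basis]
    ring
  simp only [this, Fin.sum_univ_two]; ring

theorem posSq_hasFDerivAt {g : E2 → ℝ} {x : E2} (hg : DifferentiableAt ℝ g x) :
    HasFDerivAt (fun y => (max (g y) 0) ^ 2) ((2 * max (g x) 0) • fderiv ℝ g x) x := by
  have h : HasDerivAt (fun t : ℝ => (max t 0) ^ 2) (2 * max (g x) 0) (g x) := by
    rcases lt_trichotomy (g x) 0 with h | h | h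
    · rw [max_eq_right h.le, mul_zero]
      refine (hasDerivAt_const (g x) (0:ℝ)).congr_of_eventuallyEq ?_
      filter_upwards [gt_mem_nhds h] with t ht
      simp [max_eq_right ht.le]
    · rw [h]
      simp only [max_self, mul_zero]
      rw [hasDerivAt_iff_isLittleO]
      simp only [max_self, ne_eq, OfNat.ofNat_ne_zero, not_false_eq_true, zero_pow, sub_zero, smul_zero]
      have : (fun t : ℝ => (max t 0) ^ 2) =O[𝓝 0] fun t => t ^ 2 := by
        refine Asymptotics.IsBigO.of_bound 1 (Eventually.of_forall fun t => ?_)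
        simp only [norm_pow, Real.norm_eq_abs, one_mul]
        have h1 : |max t 0| ≤ |t| := by
          rw [abs_of_nonneg (le_max_right _ _)]
          exact max_le (le_abs_self t) (abs_nonneg t)
        exact pow_le_pow_left₀ (abs_nonneg _) h1 2
      refine this.trans_isLittleO ?_
      simpa using (Asymptotics.isLittleO_pow_pow (𝕜 := ℝ) (m := 1) (n := 2) (by norm_num))
    · rw [max_eq_left h.le]
      have := hasDerivAt_pow 2 (g x)
      simp only [Nat.cast_ofNat, Nat.add_one_sub_one, pow_one] at this
      refine this.congr_of_eventuallyEq ?_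
      filter_upwards [lt_mem_nhds h] with t ht
      simp [max_eq_left ht.le]
  exact h.comp_hasFDerivAt x hg.hasFDerivAt

theorem WeakSol.touch_min {w F ψ : E2 → ℝ} (h : WeakSol w F) {x0 : E2} (hψ : ContDiffAt ℝ 2 ψ x0)
    (hmin : ∀ᶠ x in 𝓝 x0, w x0 - ψ x0 ≤ w x - ψ x) : lapS ψ x0 ≤ F x0 := by
  by_contra hcon
  push Not at hcon
  obtain ⟨ψ1, hψ1, heq⟩ := exists_global hψ
  rw [← lapS_congr heq] at hcon
  set c := (lapS ψ1 x0 - F x0) / 8 with hc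
  have hcpos : 0 < c := by rw [hc]; linarith
  have hq : ContDiff ℝ 2 (fun y : E2 => c * ‖y - x0‖ ^ 2) :=
    contDiff_const.mul ((contDiff_id.sub contDiff_const).norm_sq ℝ)
  set ψ2 : E2 → ℝ := fun y => ψ1 y - c * ‖y - x0‖ ^ 2 with hpsid
  have hψ2 : ContDiff ℝ 2 ψ2 := hψ1.sub hq
  have hlap : lapS ψ2 x0 = lapS ψ1 x0 - 4 * c := by
    rw [hpsid, lapS_sub hψ1 hq, lapS_normSq]
  have hlt : F x0 < lapS ψ2 x0 := by rw [hlap]; linarith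
  have hlc := lapS_cont hψ2
  -- choose the radius
  have hev : ∀ᶠ x in 𝓝 x0, F x < lapS ψ2 x ∧ w x0 - ψ1 x0 ≤ w x - ψ1 x := by
    filter_upwards [(h.cont.continuousAt.eventually_lt hlc.continuousAt hlt), hmin, heq] with x h1 h2 h3
    rw [h3, heq.eq_of_nhds]
    exact ⟨h1, h2⟩
  obtain ⟨r, hr, hball⟩ := Metric.nhds_basis_closedBall.mem_iff.1 hev
  let β : ContDiffBump x0 := ⟨r / 2, r, by positivity, by linarith⟩
  set δ := c * (r / 4) ^ 2 with hδ
  have hδpos : 0 < δ := by positivity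
  set g : E2 → ℝ := fun x => ψ2 x + (w x0 - ψ1 x0 + δ) - w x with hg
  have hpsid : Differentiable ℝ ψ2 := hψ2.differentiable (by norm_num)
  have hgd : Differentiable ℝ g := (hpsid.add_const _).sub h.diff
  have hgf : ∀ x, fderiv ℝ g x = fderiv ℝ ψ2 x - fderiv ℝ w x := by
    intro x
    rw [hg, fderiv_fun_sub ((hpsid.add_const _) x) (h.diff x), fderiv_add_const]
  have hgneg : ∀ x, dist x x0 ≤ r → r / 4 ≤ dist x x0 → g x ≤ 0 := by
    intro x hx hx'
    have := (hball hx).2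
    have h2 : (r / 4) ^ 2 ≤ ‖x - x0‖ ^ 2 := by
      rw [← dist_eq_norm]; gcongr
    have h3 := mul_le_mul_of_nonneg_left h2 hcpos.le
    simp only [hg, ψ2]
    linarith
  set G : E2 → ℝ := fun x => max (g x) 0 with hG
  have hGc : Continuous G := hgd.continuous.max continuous_const
  have hG0 : ∀ x, 0 ≤ G x := fun x => le_max_right _ _
  set φ : E2 → ℝ := fun x => β x * G x ^ 2 with hφ
  have hβd : Differentiable ℝ β := β.contDiff.differentiable (n := 1) (by norm_num)
  have hβc : Continuous β := hβd.continuous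
  have hzero : ∀ x, G x ^ 2 • fderiv ℝ β x = 0 := by
    intro x
    by_cases h1 : dist x x0 < r / 2
    · have : fderiv ℝ β x = 0 := by
        have : (β : E2 → ℝ) =ᶠ[𝓝 x] fun _ => 1 := β.eventuallyEq_one_of_mem_ball h1
        rw [this.fderiv_eq]; simp
      rw [this, smul_zero]
    · push Not at h1
      by_cases h2 : dist x x0 ≤ r
      · have : G x = 0 := max_eq_right (hgneg x h2 (by linarith))
        rw [this]; simp
      · have : fderiv ℝ β x = 0 := by
          have : (β : E2 → ℝ) =ᶠ[𝓝 x] fun _ => 0 := by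
            filter_upwards [Metric.isClosed_closedBall.isOpen_compl.mem_nhds h2] with y hy
            refine β.zero_of_le_dist ?_
            have : ¬ dist y x0 ≤ r := hy
            show r ≤ _
            linarith
          rw [this.fderiv_eq]; simp
        rw [this, smul_zero]
  have hφd : ∀ x, HasFDerivAt φ ((2 * (β x * G x)) • fderiv ℝ g x) x := by
    intro x
    have := (hβd x).hasFDerivAt.mul (posSq_hasFDerivAt (hgd x))
    refine this.congr_fderiv ?_
    have hz := hzero x
    simp only [hG] at hz
    simp only [hz, add_zero, smul_smul]
    congr 1; simp only [hG]; ring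
  have hφdiff : Differentiable ℝ φ := fun x => (hφd x).differentiableAt
  have hφs : HasCompactSupport φ := β.hasCompactSupport.mul_right
  set B : E2 → ℝ := fun x => 2 * (β x * G x) with hB
  have hBc : Continuous B := by fun_prop
  have hBs : HasCompactSupport B := by
    have : HasCompactSupport fun x => β x * G x := β.hasCompactSupport.mul_right
    exact this.mul_left (f := fun _ => (2:ℝ))
  have hB0 : ∀ x, 0 ≤ B x := fun x => mul_nonneg (by norm_num) (mul_nonneg β.nonneg (hG0 x))
  have hφf : fderiv ℝ φ = fun x => B x • fderiv ℝ ψ2 x - B x • fderiv ℝ w x := by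
    ext1 x; rw [(hφd x).fderiv, hgf, smul_sub]
  have hpsic : Continuous (fderiv ℝ ψ2) := hψ2.continuous_fderiv (by norm_num)
  have hL1 : MemLp (fun x => B x • fderiv ℝ ψ2 x) 2 (volume : Measure E2) :=
    (hBc.smul hpsic).memLp_of_hasCompactSupport hBs.smul_right
  have hL2 : MemLp (fun x => B x • fderiv ℝ w x) 2 (volume : Measure E2) := by
    have : MemLp B ⊤ (volume : Measure E2) := hBc.memLp_of_hasCompactSupport hBs
    exact h.l2.smul this
  have hφl : MemLp (fderiv ℝ φ) 2 (volume : Measure E2) := by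
    rw [hφf]; exact hL1.sub hL2
  have key := h.weak φ hφdiff hφs hφl
  -- integration by parts for ψ2
  have hDi : ∀ i, Integrable (fun x => fderiv ℝ ψ2 x (e2basis i) * fderiv ℝ φ x (e2basis i)) := by
    intro i
    have : (fun x => fderiv ℝ ψ2 x (e2basis i) * fderiv ℝ φ x (e2basis i)) =
      fun x => (fderiv ℝ ψ2 x (e2basis i)) * (B x * fderiv ℝ ψ2 x (e2basis i))
        - (B x • fderiv ℝ ψ2 x) (e2basis i) * fderiv ℝ w x (e2basis i) := by
      ext x; rw [hφf]; simp; ring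
    rw [this]
    refine Integrable.sub ?_ ((memLp_apply hL1 _).integrable_mul (memLp_apply h.l2 _))
    have hcc : Continuous fun x => fderiv ℝ ψ2 x (e2basis i) := hpsic.clm_apply continuous_const
    exact integrable_mul_cpt hcc (hBc.mul hcc) hBs.mul_right
  have hii : ∀ i, Continuous fun x =>
      fderiv ℝ (fun y => fderiv ℝ ψ2 y (e2basis i)) x (e2basis i) := fun i =>
    ((dC1 hψ2 _).continuous_fderiv (by norm_num)).clm_apply continuous_const
  have hibp : ∀ i, ∫ x, fderiv ℝ ψ2 x (e2basis i) * fderiv ℝ φ x (e2basis i) =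
      - ∫ x, fderiv ℝ (fun y => fderiv ℝ ψ2 y (e2basis i)) x (e2basis i) * φ x := by
    intro i
    have hcc : Continuous fun x => fderiv ℝ ψ2 x (e2basis i) := hpsic.clm_apply continuous_const
    exact integral_mul_fderiv_eq_neg_fderiv_mul_of_integrable
      (integrable_mul_cpt (hii i) hφdiff.continuous hφs) (hDi i)
      (integrable_mul_cpt hcc hφdiff.continuous hφs)
      (fun x _ => ((dC1 hψ2 _).differentiable (by norm_num) x)) (fun x _ => hφdiff x)
  have key2 : ∫ x, (dotp (fderiv ℝ ψ2 x) (fderiv ℝ φ x) + lapS ψ2 x * φ x) = 0 := by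
    have e : (fun x => dotp (fderiv ℝ ψ2 x) (fderiv ℝ φ x) + lapS ψ2 x * φ x) = fun x =>
        ∑ i, (fderiv ℝ ψ2 x (e2basis i) * fderiv ℝ φ x (e2basis i) +
          fderiv ℝ (fun y => fderiv ℝ ψ2 y (e2basis i)) x (e2basis i) * φ x) := by
      ext x; simp only [dotp, lapS, Finset.sum_add_distrib, Finset.sum_mul]
    rw [e, integral_finsetSum]
    · refine Finset.sum_eq_zero fun i _ => ?_
      rw [integral_add (hDi i) (integrable_mul_cpt (hii i) hφdiff.continuous hφs), hibp i]
      ring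
    · exact fun i _ => (hDi i).add (integrable_mul_cpt (hii i) hφdiff.continuous hφs)
  have i2 : Integrable (fun x => dotp (fderiv ℝ ψ2 x) (fderiv ℝ φ x) + lapS ψ2 x * φ x) := by
    refine Integrable.add ?_ (integrable_mul_cpt hlc hφdiff.continuous hφs)
    exact integrable_finsetSum _ fun i _ => hDi i
  have i1 : Integrable (fun x => dotp (fderiv ℝ w x) (fderiv ℝ φ x) + F x * φ x) :=
    (integrable_dotp h.l2 hφl).add (integrable_mul_cpt h.cont hφdiff.continuous hφs)
  have hsub := integral_sub i2 i1
  rw [key, key2, sub_zero] at hsub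
  have hmain : Continuous fun x => (lapS ψ2 x - F x) * φ x :=
    (hlc.sub h.cont).mul hφdiff.continuous
  have hnn : ∀ x, 0 ≤ (lapS ψ2 x - F x) * φ x := by
    intro x
    by_cases h2 : dist x x0 ≤ r
    · exact mul_nonneg (by linarith [(hball h2).1]) (mul_nonneg β.nonneg (sq_nonneg _))
    · have : φ x = 0 := by
        simp only [hφ]; rw [β.zero_of_le_dist (le_of_not_ge h2), zero_mul]
      rw [this, mul_zero]
  have hpos : 0 < ∫ x, (lapS ψ2 x - F x) * φ x := by
    refine hmain.integral_pos_of_hasCompactSupport_nonneg_nonzero hφs.mul_left hnn (x := x0) ?_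
    have h1 : g x0 = δ := by simp [hg, ψ2]; ring
    have h2 : G x0 = δ := by simp only [hG, h1]; exact max_eq_left hδpos.le
    have h3 : β x0 = 1 := β.eventuallyEq_one.eq_of_nhds
    simp only [hφ, h2, h3]
    have : lapS ψ2 x0 - F x0 > 0 := by linarith
    positivity
  have hle : ∫ x, (lapS ψ2 x - F x) * φ x ≤
      ∫ x, ((dotp (fderiv ℝ ψ2 x) (fderiv ℝ φ x) + lapS ψ2 x * φ x) -
        (dotp (fderiv ℝ w x) (fderiv ℝ φ x) + F x * φ x)) := by
    refine integral_mono (integrable_mul_cpt (hlc.sub h.cont) hφdiff.continuous hφs)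
      (i2.sub i1) fun x => ?_
    have e : dotp (fderiv ℝ ψ2 x) (fderiv ℝ φ x) - dotp (fderiv ℝ w x) (fderiv ℝ φ x) =
        B x * dotp (fderiv ℝ g x) (fderiv ℝ g x) := by
      rw [← dotp_sub_left, (hφd x).fderiv, dotp_smul_right, hgf]
    have := mul_nonneg (hB0 x) (dotp_self_nonneg (fderiv ℝ g x))
    simp only
    linarith
  linarith

theorem WeakSol.touch_max {w F ψ : E2 → ℝ} (h : WeakSol w F) {x0 : E2} (hψ : ContDiffAt ℝ 2 ψ x0)
    (hmax : ∀ᶠ x in 𝓝 x0, w x - ψ x ≤ w x0 - ψ x0) : F x0 ≤ lapS ψ x0 := by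
  have := h.neg.touch_min (ψ := fun x => - ψ x) hψ.neg (by
    filter_upwards [hmax] with x hx; linarith)
  have e : lapS (fun x => - ψ x) x0 = - lapS ψ x0 := by
    unfold lapS
    rw [← Finset.sum_neg_distrib]
    refine Finset.sum_congr rfl fun i _ => ?_
    have : (fun y => fderiv ℝ (fun x => - ψ x) y (e2basis i)) =
        fun y => - (fderiv ℝ ψ y (e2basis i)) := by
      ext y; rw [fderiv_fun_neg]; rfl
    rw [this, fderiv_fun_neg]; rfl
  rw [e] at this
  linarith

/-- The energy density. -/
def dens (ε a : ℝ) (μ : E2 → ℝ) (f : E2 → E2) (u : E2 → E2) (x : E2) : ℝ :=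
  (1/2) * gradSq u x - (1/(2*ε^2)) * μ x * ‖u x‖^2
    + (1/(4*ε^2)) * ‖u x‖^4 - (a/ε) * (inner ℝ (f x) (u x) : ℝ)

theorem int_add2 {A B : E2 → ℝ} (hA : Integrable A) (hB : Integrable B) (s t : ℝ) :
    Integrable (fun x => s * A x + t * B x) ∧
    ∫ x, (s * A x + t * B x) = s * (∫ x, A x) + t * ∫ x, B x := by
  have h1 : Integrable (fun x => s * A x) := hA.const_mul s
  have h2 : Integrable (fun x => t * B x) := hB.const_mul t
  refine ⟨h1.add h2, ?_⟩
  rw [integral_add h1 h2, integral_const_mul, integral_const_mul]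

theorem memLp_smulRight {L : E2 → E2 →L[ℝ] ℝ} (h : MemLp L 2 (volume : Measure E2)) (e : E2) (t : ℝ) :
    MemLp (fun x => t • (L x).smulRight e) 2 (volume : Measure E2) := by
  have h1 : MemLp (fun x => (L x).smulRight e) 2 (volume : Measure E2) :=
    (((ContinuousLinearMap.smulRightL ℝ E2 E2).flip e)).comp_memLp' h
  exact h1.const_smul t

theorem memLp_addG {G : Type*} [NormedAddCommGroup G] {K M : E2 → G}
    (hK : MemLp K 2 (volume : Measure E2)) (hM : MemLp M 2 (volume : Measure E2)) :
    MemLp (fun x => K x + M x) 2 (volume : Measure E2) := hK.add hM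

theorem memLp_add_smulRight {K : E2 → E2 →L[ℝ] E2} (hK : MemLp K 2 (volume : Measure E2))
    {L : E2 → E2 →L[ℝ] ℝ} (h : MemLp L 2 (volume : Measure E2)) (e : E2) (t : ℝ) :
    MemLp (fun x => K x + t • (L x).smulRight e) 2 (volume : Measure E2) := by
  have h1 := memLp_smulRight h e t
  exact memLp_addG hK h1

theorem exists_neg_energy {ε a : ℝ} {μ : E2 → ℝ} {f : E2 → E2} (hε : 0 < ε) (ha : 0 < a)
    (hμ : Continuous μ) (hf : ContDiff ℝ 1 f) (x1 : E2) (hx1 : f x1 ≠ 0) :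
    ∃ u, MemH1 u ∧ energy ε a μ f u < 0 := by
  let β : ContDiffBump x1 := ⟨1, 2, by norm_num, by norm_num⟩
  set g : E2 → E2 := fun x => β x • f x with hg
  have hg1 : ContDiff ℝ 1 g := β.contDiff.smul hf
  have hgs : HasCompactSupport g := β.hasCompactSupport.smul_right
  have hgc := hg1.continuous
  have hgd : Differentiable ℝ g := hg1.differentiable (by norm_num)
  have hfc : Continuous (fderiv ℝ g) := hg1.continuous_fderiv (by norm_num)
  have hH : ∀ t : ℝ, MemH1 (fun x => t • g x) := by
    intro t
    have e : (fun x => fderiv ℝ (fun x => t • g x) x) = fun x => t • fderiv ℝ g x := by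
      ext1 x; rw [fderiv_fun_const_smul (hgd x)]
    refine ⟨hgd.const_smul t, ?_, ?_⟩
    · exact (hgc.memLp_of_hasCompactSupport hgs).const_smul t
    · rw [e]; exact (hfc.memLp_of_hasCompactSupport (hgs.fderiv ℝ)).const_smul t
  -- pieces
  have iA : Integrable (fun x => (1/2) * gradSq g x - (1/(2*ε^2)) * μ x * ‖g x‖^2) := by
    refine Integrable.sub ?_ ?_
    · refine Integrable.const_mul ?_ _
      unfold gradSq
      refine integrable_finsetSum _ fun i _ => ?_
      have hc : Continuous fun x => fderiv ℝ g x (e2basis i) := hfc.clm_apply continuous_const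
      have hcs : HasCompactSupport fun x => fderiv ℝ g x (e2basis i) := hgs.fderiv_apply ℝ _
      have hcs2 : HasCompactSupport fun x => ‖fderiv ℝ g x (e2basis i)‖ * ‖fderiv ℝ g x (e2basis i)‖ :=
        hcs.norm.mul_left
      have hcc2 : Continuous fun x => ‖fderiv ℝ g x (e2basis i)‖ * ‖fderiv ℝ g x (e2basis i)‖ :=
        hc.norm.mul hc.norm
      simp only [pow_two]
      exact hcc2.integrable_of_hasCompactSupport hcs2
    · exact integrable_mul_cpt (continuous_const.mul hμ) (hgc.norm.pow 2)
        (hgs.comp_left (g := fun y : E2 => ‖y‖ ^ 2) (by simp))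
  have iC : Integrable (fun x => (1/(4*ε^2)) * ‖g x‖^4) :=
    integrable_mul_cpt continuous_const (hgc.norm.pow 4)
        (hgs.comp_left (g := fun y : E2 => ‖y‖ ^ 4) (by simp))
  have hBc : Continuous (fun x => β x * ‖f x‖ ^ 2) :=
    (β.contDiff (n := 0)).continuous.mul (hf.continuous.norm.pow 2)
  have hBs : HasCompactSupport (fun x => β x * ‖f x‖ ^ 2) := β.hasCompactSupport.mul_right
  have iB : Integrable (fun x => β x * ‖f x‖ ^ 2) := hBc.integrable_of_hasCompactSupport hBs
  have hBpos : 0 < ∫ x, β x * ‖f x‖ ^ 2 := by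
    refine hBc.integral_pos_of_hasCompactSupport_nonneg_nonzero hBs
      (fun x => mul_nonneg β.nonneg (sq_nonneg _)) (x := x1) ?_
    have h3 : β x1 = 1 := β.eventuallyEq_one.eq_of_nhds
    rw [h3]; simpa using hx1
  set A := ∫ x, ((1/2) * gradSq g x - (1/(2*ε^2)) * μ x * ‖g x‖^2)
  set C := ∫ x, (1/(4*ε^2)) * ‖g x‖^4
  set B := ∫ x, β x * ‖f x‖ ^ 2
  have hE : ∀ t : ℝ, energy ε a μ f (fun x => t • g x) = t ^ 2 * A + t ^ 4 * C - t * ((a / ε) * B) := by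
    intro t
    have e : ∀ x, ((1/2) * gradSq (fun x => t • g x) x - (1/(2*ε^2)) * μ x * ‖t • g x‖^2
      + (1/(4*ε^2)) * ‖t • g x‖^4 - (a/ε) * (inner ℝ (f x) (t • g x) : ℝ)) =
      t ^ 2 * ((1/2) * gradSq g x - (1/(2*ε^2)) * μ x * ‖g x‖^2) + t ^ 4 * ((1/(4*ε^2)) * ‖g x‖^4)
        - t * ((a / ε) * (β x * ‖f x‖ ^ 2)) := by
      intro x
      have e1 : gradSq (fun x => t • g x) x = t ^ 2 * gradSq g x := by
        unfold gradSq
        rw [Finset.mul_sum]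
        refine Finset.sum_congr rfl fun i _ => ?_
        rw [fderiv_fun_const_smul (hgd x)]
        simp only [smul_apply, norm_smul, mul_pow, Real.norm_eq_abs, sq_abs]
      have e2 : inner ℝ (f x) (t • g x) = t * (β x * ‖f x‖ ^ 2) := by
        simp only [hg]
        rw [inner_smul_right, inner_smul_right, real_inner_self_eq_norm_sq]
      have e4 : |t| ^ 4 = t ^ 4 := by
        rw [show |t| ^ 4 = (|t| ^ 2) ^ 2 by ring, sq_abs]; ring
      rw [e1, e2, norm_smul, mul_pow, mul_pow, Real.norm_eq_abs, sq_abs, e4]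
      ring
    unfold energy
    simp only [e]
    have j1 := int_add2 iA iC (t ^ 2) (t ^ 4)
    have j2 := int_add2 j1.1 iB 1 (-(t * (a / ε)))
    have e' := j2.2
    rw [j1.2] at e'
    rw [one_mul] at e'
    have e'' : t ^ 2 * A + t ^ 4 * C - t * ((a / ε) * B) =
      t ^ 2 * A + t ^ 4 * C + -(t * (a / ε)) * B := by ring
    rw [e'', ← e']
    congr 1; ext x; ring
  have hcont : Continuous fun t : ℝ => t * A + t ^ 3 * C - (a / ε) * B := by fun_prop
  have h0 : (fun t : ℝ => t * A + t ^ 3 * C - (a / ε) * B) 0 < 0 := by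
    have : 0 < a / ε * B := by positivity
    simp; linarith
  have hev := hcont.continuousAt.eventually (gt_mem_nhds h0)
  have hev2 : ∀ᶠ t : ℝ in 𝓝[>] 0, t * A + t ^ 3 * C - (a / ε) * B < 0 := hev.filter_mono nhdsWithin_le_nhds
  obtain ⟨t, ht, htp⟩ := (hev2.and self_mem_nhdsWithin).exists
  have htp : 0 < t := htp
  refine ⟨_, hH t, ?_⟩
  rw [hE t]
  have := mul_neg_of_pos_of_neg htp ht
  linarith

theorem dens_integrable {ε a : ℝ} {μ : E2 → ℝ} {f v : E2 → E2} (hε : 0 < ε) (ha : 0 < a)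
    (hμ : Continuous μ) (hf : ContDiff ℝ 1 f) (x1 : E2) (hx1 : f x1 ≠ 0)
    (hv : IsMinimizer ε a μ f v) : Integrable (dens ε a μ f v) := by
  obtain ⟨u, hu, hlt⟩ := exists_neg_energy hε ha hμ hf x1 hx1
  have := (hv.2 u hu).trans_lt hlt
  by_contra hni
  have e : energy ε a μ f v = 0 := integral_undef hni
  linarith

set_option maxHeartbeats 1000000 in
theorem weakSol_of_min {ε a : ℝ} {μ : E2 → ℝ} {f v : E2 → E2} (hε : 0 < ε) (ha : 0 < a)
    (hμ : Continuous μ) (hf : ContDiff ℝ 1 f) (x1 : E2) (hx1 : f x1 ≠ 0)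
    (hv : IsMinimizer ε a μ f v) (e : E2) :
    WeakSol (fun x => inner ℝ e (v x))
      (fun x => ((‖v x‖ ^ 2 - μ x) * inner ℝ e (v x) - ε * a * inner ℝ e (f x)) / ε ^ 2) := by
  have hI := dens_integrable hε ha hμ hf x1 hx1 hv
  obtain ⟨⟨hvd, hvl, hvf⟩, hmin⟩ := hv
  have hvc := hvd.continuous
  set w : E2 → ℝ := fun x => inner ℝ e (v x) with hw
  have hwd : Differentiable ℝ w := fun x => (innerSL ℝ e).differentiableAt.comp x (hvd x)
  have hwf : ∀ x, fderiv ℝ w x = (innerSL ℝ e).comp (fderiv ℝ v x) := fun x =>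
    ((innerSL ℝ e).hasFDerivAt.comp x (hvd x).hasFDerivAt).fderiv
  have hwl : MemLp (fderiv ℝ w) 2 (volume : Measure E2) := by
    rw [show fderiv ℝ w = fun x => (innerSL ℝ e).comp (fderiv ℝ v x) from funext hwf]
    exact (ContinuousLinearMap.compL ℝ E2 E2 ℝ (innerSL ℝ e)).comp_memLp' hvf
  have hwc := hwd.continuous
  have hfe : Continuous fun x => inner ℝ e (f x) := continuous_const.inner hf.continuous
  have hFc : Continuous fun x => ((‖v x‖ ^ 2 - μ x) * w x - ε * a * inner ℝ e (f x)) / ε ^ 2 := by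
    fun_prop
  refine ⟨hwd, hwl, hFc, ?_⟩
  intro φ hφ hφs hφl
  have hφc := hφ.continuous
  set N := ‖e‖ ^ 2 with hN
  set F := fun x => ((‖v x‖ ^ 2 - μ x) * w x - ε * a * inner ℝ e (f x)) / ε ^ 2 with hF
  set A := fun x => dotp (fderiv ℝ w x) (fderiv ℝ φ x) + F x * φ x with hA
  set B := fun x => (N / 2) * dotp (fderiv ℝ φ x) (fderiv ℝ φ x) +
    (-(1/(2*ε^2)) * μ x * N * φ x + (1/(4*ε^2)) * (4 * w x ^ 2 + 2 * ‖v x‖ ^ 2 * N) * φ x) * φ x with hB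
  set C := fun x => ((1/(4*ε^2)) * 4 * w x * N * φ x ^ 2) * φ x with hC
  set D := fun x => ((1/(4*ε^2)) * N ^ 2 * φ x ^ 3) * φ x with hD
  have iA : Integrable A := (integrable_dotp hwl hφl).add (integrable_mul_cpt hFc hφc hφs)
  have iB : Integrable B := ((integrable_dotp hφl hφl).const_mul _).add
    (integrable_mul_cpt (by fun_prop) hφc hφs)
  have iC : Integrable C := integrable_mul_cpt (by fun_prop) hφc hφs
  have iD : Integrable D := integrable_mul_cpt (by fun_prop) hφc hφs
  have hexp : ∀ (t : ℝ) (x : E2), dens ε a μ f (fun x => v x + t • (φ x • e)) x =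
      dens ε a μ f v x + (t * A x + t ^ 2 * B x + t ^ 3 * C x + t ^ 4 * D x) := by
    intro t x
    have hd : fderiv ℝ (fun x => v x + t • (φ x • e)) x =
        fderiv ℝ v x + t • (fderiv ℝ φ x).smulRight e :=
      ((hvd x).hasFDerivAt.add (((hφ x).hasFDerivAt.smul_const e).const_smul t)).fderiv
    have e1 : gradSq (fun x => v x + t • (φ x • e)) x = gradSq v x +
        2 * t * dotp (fderiv ℝ w x) (fderiv ℝ φ x) + t ^ 2 * N * dotp (fderiv ℝ φ x) (fderiv ℝ φ x) := by
      unfold gradSq dotp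
      rw [Finset.mul_sum, Finset.mul_sum, ← Finset.sum_add_distrib, ← Finset.sum_add_distrib]
      refine Finset.sum_congr rfl fun i _ => ?_
      rw [hd, hwf]
      simp only [add_apply, smul_apply, ContinuousLinearMap.smulRight_apply,
        ContinuousLinearMap.comp_apply, innerSL_apply_apply]
      rw [norm_add_sq_real, smul_smul, inner_smul_right, norm_smul, real_inner_comm, mul_pow,
        Real.norm_eq_abs, sq_abs]
      ring
    have e2 : ‖v x + t • (φ x • e)‖ ^ 2 = ‖v x‖ ^ 2 + 2 * t * φ x * w x + t ^ 2 * φ x ^ 2 * N := by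
      rw [norm_add_sq_real, smul_smul, inner_smul_right, norm_smul, real_inner_comm, mul_pow,
        Real.norm_eq_abs, sq_abs]
      ring
    have e3 : inner ℝ (f x) (v x + t • (φ x • e)) =
        inner ℝ (f x) (v x) + t * φ x * inner ℝ e (f x) := by
      rw [inner_add_right, smul_smul, inner_smul_right, real_inner_comm e (f x)]
    have e4 : ‖v x + t • (φ x • e)‖ ^ 4 = (‖v x + t • (φ x • e)‖ ^ 2) ^ 2 := by ring
    have e5 : ‖v x‖ ^ 4 = (‖v x‖ ^ 2) ^ 2 := by ring
    unfold dens
    rw [e4, e1, e2, e3, e5]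
    simp only [hA, hB, hC, hD, hF]
    field_simp
    ring
  have hmem : ∀ t : ℝ, MemH1 (fun x => v x + t • (φ x • e)) := by
    intro t
    have hd : (fun x => fderiv ℝ (fun x => v x + t • (φ x • e)) x) = fun x =>
        fderiv ℝ v x + t • (fderiv ℝ φ x).smulRight e := by
      ext1 x
      exact ((hvd x).hasFDerivAt.add (((hφ x).hasFDerivAt.smul_const e).const_smul t)).fderiv
    refine ⟨hvd.add ((hφ.smul_const e).const_smul t), ?_, ?_⟩
    · have h1 : MemLp (fun x => φ x • e) 2 (volume : Measure E2) :=
        (hφc.smul continuous_const).memLp_of_hasCompactSupport hφs.smul_right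
      exact hvl.add (h1.const_smul t)
    · rw [hd]
      exact memLp_add_smulRight hvf hφl e t
  have hpoly : ∀ t : ℝ, 0 ≤ t * (∫ x, A x) + t ^ 2 * (∫ x, B x) + t ^ 3 * (∫ x, C x) + t ^ 4 * (∫ x, D x) := by
    intro t
    have h1 := hmin _ (hmem t)
    have h2 : energy ε a μ f (fun x => v x + t • (φ x • e)) = energy ε a μ f v +
      (t * (∫ x, A x) + t ^ 2 * (∫ x, B x) + t ^ 3 * (∫ x, C x) + t ^ 4 * (∫ x, D x)) := by
      have : energy ε a μ f (fun x => v x + t • (φ x • e)) =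
        ∫ x, dens ε a μ f (fun x => v x + t • (φ x • e)) x := rfl
      rw [this]
      simp only [hexp]
      have j1 := int_add2 iA iB t (t ^ 2)
      have j2 := int_add2 iC iD (t ^ 3) (t ^ 4)
      have j3 := int_add2 j1.1 j2.1 1 1
      have j4 := int_add2 hI j3.1 1 1
      have e' := j4.2
      rw [j3.2, j1.2, j2.2] at e'
      have e'' : energy ε a μ f v = ∫ x, dens ε a μ f v x := rfl
      rw [e'']
      refine Eq.trans ?_ (e'.trans ?_)
      · congr 1; ext x; ring
      · ring
    linarith
  set IA := ∫ x, A x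
  set IB := ∫ x, B x
  set IC := ∫ x, C x
  set ID := ∫ x, D x
  have hder : HasDerivAt (fun t : ℝ => t * IA + t ^ 2 * IB + t ^ 3 * IC + t ^ 4 * ID) IA 0 := by
    have := ((((hasDerivAt_id (0:ℝ)).mul_const IA).add ((hasDerivAt_pow 2 (0:ℝ)).mul_const IB)).add
      ((hasDerivAt_pow 3 (0:ℝ)).mul_const IC)).add ((hasDerivAt_pow 4 (0:ℝ)).mul_const ID)
    refine HasDerivAt.congr_deriv this ?_
    simp
  have hlm : IsLocalMin (fun t : ℝ => t * IA + t ^ 2 * IB + t ^ 3 * IC + t ^ 4 * ID) 0 := by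
    refine Eventually.of_forall fun t => ?_
    simpa using hpoly t
  exact hlm.hasDerivAt_eq_zero hder

theorem dotp_eq_inner (l m : E2) :
    dotp (innerSL ℝ l) (innerSL ℝ m) = inner ℝ l m := by
  simp only [dotp, innerSL_apply_apply, inner_e2basis]
  rw [PiLp.inner_apply]
  refine Finset.sum_congr rfl fun i _ => ?_
  simp [mul_comm]

theorem exists_riesz (L : E2 →L[ℝ] ℝ) : ∃ l : E2, L = innerSL ℝ l := by
  obtain ⟨l, hl⟩ := (InnerProductSpace.toDual ℝ E2).surjective L
  refine ⟨l, ?_⟩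
  rw [← hl]; rfl

theorem dotp_comp (σ : E2 ≃ₗᵢ[ℝ] E2) (L M : E2 →L[ℝ] ℝ) :
    dotp (L.comp (σ.toContinuousLinearEquiv : E2 →L[ℝ] E2))
      (M.comp (σ.toContinuousLinearEquiv : E2 →L[ℝ] E2)) = dotp L M := by
  obtain ⟨l, rfl⟩ := exists_riesz L
  obtain ⟨m, rfl⟩ := exists_riesz M
  have h : ∀ l : E2, (innerSL ℝ l).comp (σ.toContinuousLinearEquiv : E2 →L[ℝ] E2) =
      innerSL ℝ (σ.symm l) := by
    intro l; ext x
    have := σ.inner_map_map (σ.symm l) x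
    simp at this ⊢
    exact this
  rw [h, h, dotp_eq_inner, dotp_eq_inner]
  exact σ.symm.inner_map_map l m

theorem fderiv_comp_isom (σ : E2 ≃ₗᵢ[ℝ] E2) {w : E2 → ℝ} (hw : Differentiable ℝ w) (x : E2) :
    fderiv ℝ (fun y => w (σ y)) x =
      (fderiv ℝ w (σ x)).comp (σ.toContinuousLinearEquiv : E2 →L[ℝ] E2) := by
  have h1 : HasFDerivAt (fun y => σ y) (σ.toContinuousLinearEquiv : E2 →L[ℝ] E2) x :=
    σ.toContinuousLinearEquiv.hasFDerivAt
  exact ((hw (σ x)).hasFDerivAt.comp x h1).fderiv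

theorem memLp_fderiv_comp_isom (σ : E2 ≃ₗᵢ[ℝ] E2) {w : E2 → ℝ} (hw : Differentiable ℝ w)
    (hl : MemLp (fderiv ℝ w) 2 (volume : Measure E2)) :
    MemLp (fderiv ℝ (fun y => w (σ y))) 2 (volume : Measure E2) := by
  have h1 : MemLp (fun x => fderiv ℝ w (σ x)) 2 (volume : Measure E2) :=
    hl.comp_measurePreserving σ.measurePreserving
  rw [show fderiv ℝ (fun y => w (σ y)) = fun x =>
      (fderiv ℝ w (σ x)).comp (σ.toContinuousLinearEquiv : E2 →L[ℝ] E2) from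
    funext (fderiv_comp_isom σ hw)]
  exact ((ContinuousLinearMap.compL ℝ E2 E2 ℝ).flip
    (σ.toContinuousLinearEquiv : E2 →L[ℝ] E2)).comp_memLp' h1

theorem WeakSol.comp_isom {w F : E2 → ℝ} (h : WeakSol w F) (σ : E2 ≃ₗᵢ[ℝ] E2) :
    WeakSol (fun x => w (σ x)) (fun x => F (σ x)) := by
  have hσd : Differentiable ℝ (fun y => σ y) := σ.toContinuousLinearEquiv.differentiable
  have hσd' : Differentiable ℝ (fun y => σ.symm y) := σ.symm.toContinuousLinearEquiv.differentiable
  refine ⟨h.diff.comp hσd, memLp_fderiv_comp_isom σ h.diff h.l2, h.cont.comp σ.continuous, ?_⟩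
  intro φ hφ hφs hφl
  have hk := h.weak (fun y => φ (σ.symm y)) (hφ.comp hσd')
    (hφs.comp_homeomorph σ.symm.toHomeomorph) (memLp_fderiv_comp_isom σ.symm hφ hφl)
  rw [← hk]
  rw [← σ.measurePreserving.integral_comp σ.toHomeomorph.measurableEmbedding
    (fun x => dotp (fderiv ℝ w x) (fderiv ℝ (fun y => φ (σ.symm y)) x) + F x * φ (σ.symm x))]
  congr 1; ext x
  have e1 := fderiv_comp_isom σ h.diff x
  have e2 := fderiv_comp_isom σ (w := fun y => φ (σ.symm y)) (hφ.comp hσd') x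
  simp only [LinearIsometryEquiv.symm_apply_apply] at e2 ⊢
  rw [e1]
  have : fderiv ℝ φ x = fderiv ℝ (fun y => φ y) x := rfl
  rw [this, e2, dotp_comp]

theorem hasFDerivAt_radial {η : ℝ → ℝ} {d : ℝ} {y : E2} (h : HasDerivAt η d (‖y‖ ^ 2)) :
    HasFDerivAt (fun z : E2 => η (‖z‖ ^ 2)) (d • ((2:ℝ) • innerSL ℝ y)) y := by
  have h1 : HasFDerivAt (fun z : E2 => ‖z‖ ^ 2) ((2:ℝ) • innerSL ℝ y) y :=
    (hasStrictFDerivAt_norm_sq y).hasFDerivAt.congr_fderiv (by ext z; simp)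
  exact h.comp_hasFDerivAt y h1

theorem sum_inner_sq (x y : E2) :
    ∑ i : Fin 2, inner ℝ x (e2basis i) * inner ℝ y (e2basis i) = inner ℝ x y := by
  have := dotp_eq_inner x y
  simpa [dotp] using this

theorem lapS_barrier {η : ℝ → ℝ} (c : ℝ) (e x : E2) (h : ContDiffAt ℝ 2 η (‖x‖ ^ 2)) :
    lapS (fun y => (c + inner ℝ e y) * η (‖y‖ ^ 2)) x =
      (c + inner ℝ e x) * (4 * ‖x‖ ^ 2 * deriv (deriv η) (‖x‖ ^ 2) + 4 * deriv η (‖x‖ ^ 2))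
      + 4 * inner ℝ e x * deriv η (‖x‖ ^ 2) := by
  have hcn : ContinuousAt (fun y : E2 => ‖y‖ ^ 2) x := by fun_prop
  have hev : ∀ᶠ y in 𝓝 x, ContDiffAt ℝ 2 η (‖y‖ ^ 2) := hcn.eventually (h.eventually (by simp))
  have hlin : ∀ y : E2, HasFDerivAt (fun y : E2 => c + inner ℝ e y) (innerSL ℝ e) y := fun y =>
    ((innerSL ℝ e).hasFDerivAt (x := y)).const_add c
  have hd2 : HasDerivAt (deriv η) (deriv (deriv η) (‖x‖ ^ 2)) (‖x‖ ^ 2) := by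
    have : ContDiffAt ℝ 1 (deriv η) (‖x‖ ^ 2) :=
      (h.fderiv_right (m := 1) (by norm_num)).clm_apply contDiffAt_const
    exact (this.differentiableAt (by norm_num)).hasDerivAt
  have hi : ∀ i : Fin 2, fderiv ℝ (fun y => fderiv ℝ (fun y => (c + inner ℝ e y) * η (‖y‖ ^ 2)) y (e2basis i)) x (e2basis i)
      = 4 * deriv η (‖x‖ ^ 2) * (inner ℝ e (e2basis i) * inner ℝ x (e2basis i)) +
        (c + inner ℝ e x) * (4 * deriv (deriv η) (‖x‖ ^ 2) * (inner ℝ x (e2basis i) * inner ℝ x (e2basis i))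
          + 2 * deriv η (‖x‖ ^ 2)) := by
    intro i
    set b := e2basis i with hb
    have hbb : ‖b‖ = 1 := by rw [hb, norm_e2basis]
    have e1 : (fun y => fderiv ℝ (fun y => (c + inner ℝ e y) * η (‖y‖ ^ 2)) y b) =ᶠ[𝓝 x]
        fun y => (c + inner ℝ e y) * (deriv η (‖y‖ ^ 2) * (2 * inner ℝ b y)) +
          η (‖y‖ ^ 2) * inner ℝ e b := by
      filter_upwards [hev] with y hy
      have := (hlin y).fun_mul (hasFDerivAt_radial (hy.differentiableAt (by norm_num)).hasDerivAt)
      rw [HasFDerivAt.fderiv this]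
      simp [real_inner_comm]
    rw [e1.fderiv_eq]
    have h2b : HasFDerivAt (fun y : E2 => 2 * inner ℝ b y) ((2:ℝ) • innerSL ℝ b) x :=
      ((innerSL ℝ b).hasFDerivAt (x := x)).const_mul 2
    have hA := (hlin x).fun_mul ((hasFDerivAt_radial hd2).fun_mul h2b)
    have hB := (hasFDerivAt_radial (h.differentiableAt (by norm_num)).hasDerivAt).mul_const (inner ℝ e b)
    rw [(HasFDerivAt.fun_add hA hB).fderiv]
    simp [hbb, real_inner_comm]
    ring
  unfold lapS
  simp only [hi]
  rw [Finset.sum_add_distrib, ← Finset.mul_sum, sum_inner_sq, ← Finset.mul_sum,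
    Finset.sum_add_distrib, ← Finset.mul_sum, sum_inner_sq, real_inner_self_eq_norm_sq]
  simp
  ring

theorem contDiffAt_barrier {η : ℝ → ℝ} (c : ℝ) (e x : E2) (h : ContDiffAt ℝ 2 η (‖x‖ ^ 2)) :
    ContDiffAt ℝ 2 (fun y => (c + inner ℝ e y) * η (‖y‖ ^ 2)) x := by
  refine (contDiffAt_const.add (contDiffAt_const.inner ℝ contDiffAt_id)).mul ?_
  exact h.comp x (contDiffAt_id.norm_sq ℝ)

theorem lapS_radial {η : ℝ → ℝ} (x : E2) (h : ContDiffAt ℝ 2 η (‖x‖ ^ 2)) :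
    lapS (fun y => η (‖y‖ ^ 2)) x =
      4 * ‖x‖ ^ 2 * deriv (deriv η) (‖x‖ ^ 2) + 4 * deriv η (‖x‖ ^ 2) := by
  have := lapS_barrier 1 0 x h
  simpa using this

theorem contDiffAt_radial {η : ℝ → ℝ} (x : E2) (h : ContDiffAt ℝ 2 η (‖x‖ ^ 2)) :
    ContDiffAt ℝ 2 (fun y : E2 => η (‖y‖ ^ 2)) x :=
  h.comp x (contDiffAt_id.norm_sq ℝ)

/-- The right-hand side in direction `e`. -/
def rhs (ε a : ℝ) (μ : E2 → ℝ) (f v : E2 → E2) (e : E2) (x : E2) : ℝ :=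
  ((‖v x‖ ^ 2 - μ x) * inner ℝ e (v x) - ε * a * inner ℝ e (f x)) / ε ^ 2

/-- Weak vector solution. -/
def VSol (ε a : ℝ) (μ : E2 → ℝ) (f v : E2 → E2) : Prop :=
  ∀ e : E2, WeakSol (fun x => inner ℝ e (v x)) (rhs ε a μ f v e)

set_option maxHeartbeats 1000000 in
theorem keller_osserman_aux {ε a Cμ Cf A M : ℝ} {μ : E2 → ℝ} {f v : E2 → E2} (hε : 0 < ε) (hε1 : ε ≤ 1)
    (hμ : ∀ x, |μ x| ≤ Cμ) (hf : ∀ x, ‖f x‖ ≤ Cf) (hA : |ε * a| ≤ A) (hM : 0 < M)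
    (hM2 : Cμ ≤ M ^ 2) (hM3 : Cμ * M + A * Cf ≤ M ^ 3) (hvc : Continuous v) (hv : VSol ε a μ f v)
    (x0 : E2) (R : ℝ) (hR : ‖x0‖ < R) (hx0 : M < ‖v x0‖) :
    ((R ^ 2 - ‖x0‖ ^ 2) * (‖v x0‖ - M)) ^ 2 ≤ 8 * R ^ 2 := by
  have hR0 : 0 < R := (norm_nonneg _).trans_lt hR
  obtain ⟨y, hy, hmax⟩ := (isCompact_closedBall (0:E2) R).exists_isMaxOn
    ⟨x0, by simpa using hR.le⟩
    (f := fun x => (R ^ 2 - ‖x‖ ^ 2) * (‖v x‖ - M)) (by fun_prop)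
  have hle : ∀ x : E2, ‖x‖ ≤ R → (R ^ 2 - ‖x‖ ^ 2) * (‖v x‖ - M) ≤ (R ^ 2 - ‖y‖ ^ 2) * (‖v y‖ - M) := by
    intro x hx
    exact hmax (show x ∈ Metric.closedBall (0:E2) R by simpa using hx)
  have hyR : ‖y‖ ≤ R := by simpa using hy
  set m := (R ^ 2 - ‖y‖ ^ 2) * (‖v y‖ - M) with hm
  have h0 : 0 < (R ^ 2 - ‖x0‖ ^ 2) * (‖v x0‖ - M) := by
    refine mul_pos ?_ (by linarith)
    have := norm_nonneg x0
    nlinarith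
  have hm0 := hle x0 hR.le
  have hmpos : 0 < m := h0.trans_le hm0
  have hyR' : ‖y‖ < R := by
    rcases hyR.lt_or_eq with h | h
    · exact h
    · rw [hm, h] at hmpos; simp at hmpos
  have hqpos : ∀ x : E2, ‖x‖ < R → 0 < R ^ 2 - ‖x‖ ^ 2 := by
    intro x hx; have := norm_nonneg x; nlinarith
  set q := R ^ 2 - ‖y‖ ^ 2 with hq
  have hq0 : 0 < q := hqpos y hyR'
  set d := ‖v y‖ - M with hd
  have hdq : d = m / q := by rw [hm]; field_simp
  have hd0 : 0 < d := by rw [hdq]; positivity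
  have hvy : ‖v y‖ = M + d := by rw [hd]; ring
  have hvy0 : 0 < ‖v y‖ := by rw [hvy]; positivity
  set e : E2 := (‖v y‖)⁻¹ • v y with he
  have hen : ‖e‖ = 1 := by rw [he, norm_smul, norm_inv, norm_norm, inv_mul_cancel₀ hvy0.ne']
  have hwy : inner ℝ e (v y) = ‖v y‖ := by
    rw [he, real_inner_smul_left, real_inner_self_eq_norm_sq]; field_simp
  have hwle : ∀ x, inner ℝ e (v x) ≤ ‖v x‖ := by
    intro x
    have := real_inner_le_norm e (v x)
    rwa [hen, one_mul] at this
  set η : ℝ → ℝ := fun s => M + m / (R ^ 2 - s) with hη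
  have hdη : ∀ s, s < R ^ 2 → HasDerivAt η (m / (R ^ 2 - s) ^ 2) s := by
    intro s hs
    have h1 : R ^ 2 - s ≠ 0 := by linarith
    have := (((hasDerivAt_const s m).fun_div ((hasDerivAt_id' s).const_sub (R ^ 2)) h1).const_add M)
    refine HasDerivAt.congr_deriv this ?_
    field_simp; ring
  have hs : ‖y‖ ^ 2 < R ^ 2 := by linarith
  have hdd : deriv (deriv η) (‖y‖ ^ 2) = 2 * m / q ^ 3 := by
    have : deriv η =ᶠ[𝓝 (‖y‖ ^ 2)] fun s => m / (R ^ 2 - s) ^ 2 := by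
      filter_upwards [gt_mem_nhds hs] with s hs using (hdη s hs).deriv
    rw [this.deriv_eq]
    have h1 : (R ^ 2 - ‖y‖ ^ 2) ^ 2 ≠ 0 := by positivity
    have := (hasDerivAt_const (‖y‖ ^ 2) m).fun_div (((hasDerivAt_id' (‖y‖ ^ 2)).const_sub (R ^ 2)).fun_pow 2) h1
    rw [this.deriv]
    rw [← hq]
    field_simp; norm_num; ring
  have hcη : ContDiffAt ℝ 2 η (‖y‖ ^ 2) := by
    refine contDiffAt_const.add (contDiffAt_const.div (contDiffAt_const.sub contDiffAt_id) ?_)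
    exact hq0.ne'
  have ht := (hv e).touch_max (contDiffAt_radial y hcη) (by
    have hopen : ∀ᶠ x in 𝓝 y, ‖x‖ < R := continuous_norm.continuousAt.eventually (gt_mem_nhds hyR')
    filter_upwards [hopen] with x hx
    have h1 : η (‖y‖ ^ 2) = ‖v y‖ := by simp only [hη]; rw [← hq, ← hdq, hvy]
    rw [h1, hwy, sub_self]
    have h2 := hle x hx.le
    have h3 := hqpos x hx
    have h4 : ‖v x‖ - M ≤ m / (R ^ 2 - ‖x‖ ^ 2) := by
      rw [le_div_iff₀ h3]; linarith
    have h5 := hwle x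
    simp only [hη]
    linarith)
  rw [lapS_radial y hcη, hdd, (hdη _ hs).deriv, ← hq] at ht
  unfold rhs at ht
  rw [hwy, hvy] at ht
  have hfe : ε * a * inner ℝ e (f y) ≤ A * Cf := by
    have h1 : |inner ℝ e (f y)| ≤ Cf := by
      have := abs_real_inner_le_norm e (f y)
      rw [hen, one_mul] at this
      exact this.trans (hf y)
    calc ε * a * inner ℝ e (f y) ≤ |ε * a * inner ℝ e (f y)| := le_abs_self _
      _ = |ε * a| * |inner ℝ e (f y)| := abs_mul _ _
      _ ≤ A * Cf := mul_le_mul hA h1 (abs_nonneg _) ((abs_nonneg _).trans hA)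
  have hμy : μ y ≤ Cμ := (le_abs_self _).trans (hμ y)
  have hlow : d ^ 3 ≤ ((M + d) ^ 2 - μ y) * (M + d) - ε * a * inner ℝ e (f y) := by
    have h1 : μ y * (M + d) ≤ Cμ * (M + d) := by gcongr
    have h2 : Cμ * d ≤ M ^ 2 * d := by gcongr
    have h3 : 0 < M ^ 2 * d := by positivity
    have h4 : 0 < M * d ^ 2 := by positivity
    nlinarith
  have h6 : d ^ 3 ≤ 8 * R ^ 2 * m / q ^ 3 := by
    rw [div_le_iff₀ (by positivity)] at ht
    have hX : 4 * ‖y‖ ^ 2 * (2 * m / q ^ 3) + 4 * (m / q ^ 2) = (8 * ‖y‖ ^ 2 + 4 * q) * m / q ^ 3 := by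
      field_simp; ring
    rw [hX] at ht
    have hX2 : (8 * ‖y‖ ^ 2 + 4 * q) * m / q ^ 3 ≤ 8 * R ^ 2 * m / q ^ 3 := by
      gcongr
      rw [hq]; nlinarith
    have hX0 : 0 ≤ (8 * ‖y‖ ^ 2 + 4 * q) * m / q ^ 3 := by positivity
    have hX3 : (8 * ‖y‖ ^ 2 + 4 * q) * m / q ^ 3 * ε ^ 2 ≤ (8 * ‖y‖ ^ 2 + 4 * q) * m / q ^ 3 * 1 := by
      have : ε ^ 2 ≤ 1 := pow_le_one₀ hε.le hε1
      exact mul_le_mul_of_nonneg_left this hX0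
    linarith
  have h7 : m ^ 3 ≤ 8 * R ^ 2 * m := by
    rw [hdq, div_pow] at h6
    exact (div_le_div_iff_of_pos_right (by positivity)).1 h6
  have h8 : m ^ 2 ≤ 8 * R ^ 2 := by
    have : m ^ 2 * m ≤ 8 * R ^ 2 * m := by linarith [h7, pow_succ m 2]
    exact le_of_mul_le_mul_right this hmpos
  calc _ ≤ m ^ 2 := by gcongr
    _ ≤ _ := h8

theorem bound_M {ε a Cμ Cf A M : ℝ} {μ : E2 → ℝ} {f v : E2 → E2} (hε : 0 < ε) (hε1 : ε ≤ 1)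
    (hμ : ∀ x, |μ x| ≤ Cμ) (hf : ∀ x, ‖f x‖ ≤ Cf) (hA : |ε * a| ≤ A) (hM : 0 < M)
    (hM2 : Cμ ≤ M ^ 2) (hM3 : Cμ * M + A * Cf ≤ M ^ 3) (hvc : Continuous v) (hv : VSol ε a μ f v)
    (x0 : E2) : ‖v x0‖ ≤ M := by
  by_contra hcon
  push Not at hcon
  set δ := ‖v x0‖ - M with hδ
  have hδ0 : 0 < δ := by rw [hδ]; linarith
  set T := 2 * ‖x0‖ ^ 2 + 32 / δ ^ 2 + 1 with hT
  have hT0 : 0 < T := by positivity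
  have hTs : √T ^ 2 = T := Real.sq_sqrt hT0.le
  have hlt : ‖x0‖ < √T := by
    apply Real.lt_sqrt_of_sq_lt
    have : 0 ≤ ‖x0‖ ^ 2 := by positivity
    have : 0 < 32 / δ ^ 2 := by positivity
    rw [hT]; linarith
  have h := keller_osserman_aux hε hε1 hμ hf hA hM hM2 hM3 hvc hv x0 (√T) hlt hcon
  rw [hTs, ← hδ] at h
  have h1 : T / 2 ≤ T - ‖x0‖ ^ 2 := by
    have : 0 < 32 / δ ^ 2 := by positivity
    rw [hT]; linarith
  have h2 : (T / 2 * δ) ^ 2 ≤ 8 * T := le_trans (by gcongr) h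
  have h3 : T * δ ^ 2 ≤ 32 := by
    have : T * δ ^ 2 * T ≤ 32 * T := by nlinarith
    exact le_of_mul_le_mul_right this hT0
  have h4 : 32 < T * δ ^ 2 := by
    have : 32 = 32 / δ ^ 2 * δ ^ 2 := by field_simp
    rw [this]
    gcongr
    have : 0 ≤ ‖x0‖ ^ 2 := by positivity
    rw [hT]; linarith
  linarith

theorem RadSol.contDiffAt {P y : ℝ → ℝ} {s1 s : ℝ} (h : RadSol P s1 y) (hs : s1 < s) :
    ContDiffAt ℝ 2 y s := h.c2.contDiffAt (Ioi_mem_nhds hs)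

theorem contDiffAt_deriv {y : ℝ → ℝ} {s : ℝ} (h : ContDiffAt ℝ 2 y s) : ContDiffAt ℝ 1 (deriv y) s :=
  (h.fderiv_right (m := 1) (by norm_num)).clm_apply contDiffAt_const

theorem RadSol.lin {P y z : ℝ → ℝ} {s1 : ℝ} (hy : RadSol P s1 y) (hz : RadSol P s1 z) (c d : ℝ) :
    RadSol P s1 (fun s => c * y s + d * z s) := by
  refine ⟨(continuousOn_const.mul hy.cont).add (continuousOn_const.mul hz.cont),
    (contDiffOn_const.mul hy.c2).add (contDiffOn_const.mul hz.c2), ?_⟩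
  intro s hs
  have h1 : ∀ s, s1 < s → deriv (fun s => c * y s + d * z s) s = c * deriv y s + d * deriv z s := by
    intro s hs
    have hy1 := ((hy.contDiffAt hs).differentiableAt (by norm_num)).hasDerivAt
    have hz1 := ((hz.contDiffAt hs).differentiableAt (by norm_num)).hasDerivAt
    exact ((hy1.const_mul c).add (hz1.const_mul d)).deriv
  have h2 : deriv (deriv (fun s => c * y s + d * z s)) s = c * deriv (deriv y) s + d * deriv (deriv z) s := by
    have : deriv (fun s => c * y s + d * z s) =ᶠ[𝓝 s] fun s => c * deriv y s + d * deriv z s := by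
      filter_upwards [Ioi_mem_nhds hs] with t ht using h1 t ht
    rw [this.deriv_eq]
    have hy1 := ((contDiffAt_deriv (hy.contDiffAt hs)).differentiableAt (by norm_num)).hasDerivAt
    have hz1 := ((contDiffAt_deriv (hz.contDiffAt hs)).differentiableAt (by norm_num)).hasDerivAt
    exact ((hy1.const_mul c).add (hz1.const_mul d)).deriv
  rw [h1 s hs, h2]
  have := hy.ode s hs
  have := hz.ode s hs
  linear_combination c * hy.ode s hs + d * hz.ode s hs

theorem RadSol.lapS_eq {P y : ℝ → ℝ} {s1 : ℝ} (hy : RadSol P s1 y) {x : E2} (hx : s1 < ‖x‖ ^ 2) :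
    lapS (fun x => y (‖x‖ ^ 2)) x = P (‖x‖ ^ 2) * y (‖x‖ ^ 2) := by
  rw [lapS_radial x (hy.contDiffAt hx), hy.ode _ hx]

theorem RadSol.contOn {P y : ℝ → ℝ} {s1 : ℝ} (hy : RadSol P s1 y) :
    ContinuousOn (fun x : E2 => y (‖x‖ ^ 2)) {x | s1 ≤ ‖x‖ ^ 2} :=
  hy.cont.comp (by fun_prop) fun _ hx => hx

theorem exists_max {S : Set E2} (hS : IsClosed S) {g : E2 → ℝ} (hg : ContinuousOn g S) {K δ : ℝ}
    {G : ℝ → ℝ} (hδ : 0 < δ) (hG : Tendsto G atTop atTop)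
    (hb : ∀ x ∈ S, g x ≤ K - δ * G (‖x‖ ^ 2)) {x0 : E2} (hx0 : x0 ∈ S) (hpos : 0 < g x0) :
    ∃ y ∈ S, 0 < g y ∧ ∀ x ∈ S, g x ≤ g y := by
  have hev : ∀ᶠ x in cocompact E2 ⊓ 𝓟 S, g x ≤ g x0 := by
    rw [eventually_inf_principal]
    have h1 : Tendsto (fun x : E2 => ‖x‖ ^ 2) (cocompact E2) atTop :=
      (tendsto_pow_atTop (by norm_num)).comp (tendsto_norm_cocompact_atTop)
    filter_upwards [(hG.comp h1).eventually_ge_atTop (K / δ)] with x hx hxS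
    have := hb x hxS
    have h2 : K ≤ δ * G (‖x‖ ^ 2) := by
      have := (div_le_iff₀ hδ).1 hx
      simp only [Function.comp] at this
      linarith
    linarith
  obtain ⟨y, hy, hmax⟩ := hg.exists_isMaxOn' hS hx0 hev
  exact ⟨y, hy, hpos.trans_le (hmax hx0), fun x hx => hmax hx⟩

/-- The context of the comparison arguments. -/
structure Ctx (ε a M s1 : ℝ) (P fr : ℝ → ℝ) (μ : E2 → ℝ) (f v : E2 → E2) (G h : ℝ → ℝ) : Prop where
  hε : 0 < ε
  ha : 0 < a
  hM : 0 < M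
  hs1 : 0 < s1
  vs : VSol ε a μ f v
  vc : Continuous v
  vb : ∀ x, ‖v x‖ ≤ M
  hμ : ∀ x : E2, s1 ≤ ‖x‖ ^ 2 → μ x = - (ε ^ 2 * P (‖x‖ ^ 2))
  hf : ∀ x : E2, s1 ≤ ‖x‖ ^ 2 → f x = fr (‖x‖ ^ 2) • x
  fr0 : ∀ s, s1 ≤ s → 0 ≤ fr s
  Ppos : ∀ s, s1 ≤ s → 0 < P s
  RG : RadSol P s1 G
  Rh : RadSol P s1 h
  G1 : ∀ s, s1 ≤ s → 1 ≤ G s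
  Gtop : Tendsto G atTop atTop
  h1 : h s1 = 1
  hpos : ∀ s, s1 ≤ s → 0 < h s

theorem Ctx.rhs_eq {ε a M s1 : ℝ} {P fr : ℝ → ℝ} {μ : E2 → ℝ} {f v : E2 → E2} {G h : ℝ → ℝ}
    (C : Ctx ε a M s1 P fr μ f v G h) (e x : E2) (hx : s1 ≤ ‖x‖ ^ 2) :
    rhs ε a μ f v e x = (‖v x‖ ^ 2 / ε ^ 2 + P (‖x‖ ^ 2)) * inner ℝ e (v x) -
      a / ε * (fr (‖x‖ ^ 2) * inner ℝ e x) := by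
  have := C.hε
  rw [rhs, C.hμ x hx, C.hf x hx, inner_smul_right]
  field_simp
  ring

theorem cubic_mono (A B : E2) :
    0 ≤ ‖A‖ ^ 2 * inner ℝ (A - B) A - ‖B‖ ^ 2 * inner ℝ (A - B) B := by
  rw [inner_sub_left, inner_sub_left, real_inner_self_eq_norm_sq, real_inner_self_eq_norm_sq,
    real_inner_comm A B]
  have h := real_inner_le_norm A B
  have ha := norm_nonneg A
  have hb := norm_nonneg B
  have h2 : (‖A‖ ^ 2 + ‖B‖ ^ 2) * inner ℝ A B ≤ (‖A‖ ^ 2 + ‖B‖ ^ 2) * (‖A‖ * ‖B‖) := by gcongr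
  have h3 : 0 ≤ (‖A‖ ^ 3 - ‖B‖ ^ 3) * (‖A‖ - ‖B‖) := by
    rcases le_total ‖A‖ ‖B‖ with h | h
    · exact mul_nonneg_of_nonpos_of_nonpos (by linarith [pow_le_pow_left₀ ha h 3]) (by linarith)
    · exact mul_nonneg (by linarith [pow_le_pow_left₀ hb h 3]) (by linarith)
  nlinarith

/-- Step 2. -/
theorem Ctx.step2 {ε a M s1 : ℝ} {P fr : ℝ → ℝ} {μ : E2 → ℝ} {f v : E2 → E2} {G h : ℝ → ℝ}
    (C : Ctx ε a M s1 P fr μ f v G h) (σ : E2 ≃ₗᵢ[ℝ] E2) {x : E2} (hx : s1 ≤ ‖x‖ ^ 2) :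
    ‖v x - σ.symm (v (σ x))‖ ≤ 2 * M * h (‖x‖ ^ 2) := by
  have hM := C.hM
  set z : E2 → E2 := fun x => v x - σ.symm (v (σ x)) with hz
  have hzc : Continuous z := C.vc.sub (σ.symm.continuous.comp (C.vc.comp σ.continuous))
  have hzb : ∀ x, ‖z x‖ ≤ 2 * M := by
    intro x
    have := norm_sub_le (v x) (σ.symm (v (σ x)))
    rw [LinearIsometryEquiv.norm_map] at this
    linarith [C.vb x, C.vb (σ x)]
  have hweak : ∀ e, WeakSol (fun x => inner ℝ e (z x))
      (fun x => rhs ε a μ f v e x - rhs ε a μ f v (σ e) (σ x)) := by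
    intro e
    have h1 := (C.vs e).sub ((C.vs (σ e)).comp_isom σ)
    have e1 : (fun x => inner ℝ e (z x)) = fun x => inner ℝ e (v x) - inner ℝ (σ e) (v (σ x)) := by
      ext x
      simp only [hz, inner_sub_right]
      have := σ.inner_map_map e (σ.symm (v (σ x)))
      rw [LinearIsometryEquiv.apply_symm_apply] at this
      rw [this]
    rw [e1]; exact h1
  suffices H : ∀ δ > 0, ‖z x‖ ≤ 2 * M * h (‖x‖ ^ 2) + δ * G (‖x‖ ^ 2) by
    have hg := C.G1 _ hx
    refine le_of_forall_pos_le_add fun t ht => ?_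
    have := H (t / G (‖x‖ ^ 2)) (by positivity)
    rwa [div_mul_cancel₀ _ (by positivity)] at this
  intro δ hδ
  by_contra hcon
  push Not at hcon
  have hR := C.Rh.lin C.RG (2 * M) δ
  set η : ℝ → ℝ := fun s => 2 * M * h s + δ * G s with hη
  have hcl : IsClosed {x : E2 | s1 ≤ ‖x‖ ^ 2} := isClosed_le continuous_const (by fun_prop)
  obtain ⟨y, hy, hypos, hmax⟩ := exists_max (g := fun x => ‖z x‖ - η (‖x‖ ^ 2)) (K := 2 * M) hcl
    (hzc.norm.continuousOn.sub hR.contOn) hδ C.Gtop (by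
      intro x hx
      have h1 := hzb x
      have h2 : 0 ≤ 2 * M * h (‖x‖ ^ 2) := mul_nonneg (by positivity) (C.hpos _ hx).le
      simp only [hη]; linarith) hx (by simp only [hη]; linarith)
  have hy' : s1 < ‖y‖ ^ 2 := by
    rcases (show s1 ≤ ‖y‖ ^ 2 from hy).lt_or_eq with h | h
    · exact h
    · exfalso
      have h1 := hzb y
      have h2 := C.G1 s1 le_rfl
      have h3 : 0 < δ * G s1 := by positivity
      simp only [hη, ← h, C.h1] at hypos
      linarith
  have hηpos : 0 < η (‖y‖ ^ 2) := by
    have := C.hpos _ hy'.le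
    have := C.G1 _ hy'.le
    simp only [hη]; positivity
  have hzy : 0 < ‖z y‖ := by linarith
  set e : E2 := (‖z y‖)⁻¹ • z y with he
  have hen : ‖e‖ = 1 := by rw [he, norm_smul, norm_inv, norm_norm, inv_mul_cancel₀ hzy.ne']
  have hwy : inner ℝ e (z y) = ‖z y‖ := by
    rw [he, real_inner_smul_left, real_inner_self_eq_norm_sq]; field_simp
  have ht := (hweak e).touch_max (contDiffAt_radial y (hR.contDiffAt hy')) (by
    have hopen : ∀ᶠ x : E2 in 𝓝 y, s1 < ‖x‖ ^ 2 :=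
      (show ContinuousAt (fun x : E2 => ‖x‖ ^ 2) y by fun_prop).eventually (lt_mem_nhds hy')
    filter_upwards [hopen] with x hx
    have h1 := hmax x hx.le
    have h2 : inner ℝ e (z x) ≤ ‖z x‖ := by
      have := real_inner_le_norm e (z x)
      rwa [hen, one_mul] at this
    rw [hwy]
    linarith)
  rw [hR.lapS_eq hy'] at ht
  have hσy : s1 ≤ ‖σ y‖ ^ 2 := by rw [σ.norm_map]; exact hy'.le
  rw [C.rhs_eq e y hy'.le, C.rhs_eq (σ e) (σ y) hσy, σ.norm_map, σ.inner_map_map] at ht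
  set B := σ.symm (v (σ y)) with hB
  have hBv : inner ℝ (σ e) (v (σ y)) = inner ℝ e B := by
    have := σ.inner_map_map e (σ.symm (v (σ y)))
    rw [LinearIsometryEquiv.apply_symm_apply] at this
    rw [this]
  have hBn : ‖v (σ y)‖ = ‖B‖ := by rw [hB, LinearIsometryEquiv.norm_map]
  rw [hBv, hBn] at ht
  have hcub : 0 ≤ ‖v y‖ ^ 2 * inner ℝ e (v y) - ‖B‖ ^ 2 * inner ℝ e B := by
    have := cubic_mono (v y) B
    have e1 : v y - B = z y := rfl
    rw [e1] at this
    rw [he, real_inner_smul_left, real_inner_smul_left]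
    have h3 := mul_nonneg (inv_nonneg.2 hzy.le) this
    linarith
  have hε := C.hε
  have hcub2 : 0 ≤ ‖v y‖ ^ 2 / ε ^ 2 * inner ℝ e (v y) - ‖B‖ ^ 2 / ε ^ 2 * inner ℝ e B := by
    have := div_nonneg hcub (sq_nonneg ε)
    have e2 : ‖v y‖ ^ 2 / ε ^ 2 * inner ℝ e (v y) - ‖B‖ ^ 2 / ε ^ 2 * inner ℝ e B =
      (‖v y‖ ^ 2 * inner ℝ e (v y) - ‖B‖ ^ 2 * inner ℝ e B) / ε ^ 2 := by ring
    rwa [e2]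
  have hdiff : inner ℝ e (v y) - inner ℝ e B = ‖z y‖ := by
    rw [← inner_sub_right]; exact hwy
  have hP := C.Ppos _ hy'.le
  have hlt : P (‖y‖ ^ 2) * η (‖y‖ ^ 2) < P (‖y‖ ^ 2) * ‖z y‖ := by
    gcongr; linarith
  rw [← hdiff] at hlt
  simp only [hη] at ht hlt
  linarith

/-- Tangential bound. -/
theorem Ctx.tang {ε a M s1 : ℝ} {P fr : ℝ → ℝ} {μ : E2 → ℝ} {f v : E2 → E2} {G h : ℝ → ℝ}
    (C : Ctx ε a M s1 P fr μ f v G h) {x τ : E2} (hx : s1 ≤ ‖x‖ ^ 2) (hτ : ‖τ‖ = 1)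
    (hxτ : inner ℝ x τ = 0) : |inner ℝ τ (v x)| ≤ M * h (‖x‖ ^ 2) := by
  set σ : E2 ≃ₗᵢ[ℝ] E2 := (ℝ ∙ x).reflection with hσ
  have h1 : σ x = x := Submodule.reflection_mem_subspace_eq_self (Submodule.mem_span_singleton_self x)
  have h2 : σ τ = - τ := Submodule.reflection_mem_subspace_orthogonalComplement_eq_neg
    (Submodule.mem_orthogonal_singleton_iff_inner_right.2 hxτ)
  have h3 := C.step2 σ hx
  have h4 : inner ℝ τ (v x - σ.symm (v (σ x))) = 2 * inner ℝ τ (v x) := by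
    rw [inner_sub_right, h1]
    have := σ.inner_map_map τ (σ.symm (v x))
    rw [LinearIsometryEquiv.apply_symm_apply, h2, inner_neg_left] at this
    rw [← this]; ring
  have h5 := abs_real_inner_le_norm τ (v x - σ.symm (v (σ x)))
  rw [h4, hτ, one_mul, abs_mul, abs_two] at h5
  linarith

theorem lapS_sub_at {ψ χ : E2 → ℝ} {x : E2} (h : ContDiffAt ℝ 2 ψ x) (h' : ContDiffAt ℝ 2 χ x) :
    lapS (fun y => ψ y - χ y) x = lapS ψ x - lapS χ x := by
  obtain ⟨ψ', h1, h2⟩ := exists_global h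
  obtain ⟨χ', h3, h4⟩ := exists_global h'
  rw [← lapS_congr h2, ← lapS_congr h4, ← lapS_sub h1 h3]
  exact lapS_congr (by filter_upwards [h2, h4] with y hy hy'; rw [hy, hy'])

theorem inner_coord (x y : E2) : inner ℝ x y = x 0 * y 0 + x 1 * y 1 := by
  simp [PiLp.inner_apply, Fin.sum_univ_two]; ring

theorem perp_decomp (u : E2) (hu : ‖u‖ = 1) :
    ‖perp u‖ = 1 ∧ inner ℝ u (perp u) = 0 ∧
    ∀ e v : E2, inner ℝ e v = inner ℝ e u * inner ℝ u v + inner ℝ e (perp u) * inner ℝ (perp u) v := by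
  have h1 : u 0 * u 0 + u 1 * u 1 = 1 := by
    rw [← inner_coord, real_inner_self_eq_norm_sq, hu]; norm_num
  have p0 : perp u 0 = - u 1 := by simp [perp]
  have p1 : perp u 1 = u 0 := by simp [perp]
  refine ⟨?_, ?_, ?_⟩
  · have : ‖perp u‖ ^ 2 = 1 := by
      rw [← real_inner_self_eq_norm_sq, inner_coord, p0, p1]; linarith
    nlinarith [norm_nonneg (perp u)]
  · rw [inner_coord, p0, p1]; ring
  · intro e v
    simp only [inner_coord, p0, p1]
    linear_combination (- (e 0 * v 0 + e 1 * v 1)) * h1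

theorem half_closed (s1 : ℝ) (e : E2) : IsClosed {x : E2 | s1 ≤ ‖x‖ ^ 2 ∧ 0 ≤ inner ℝ e x} :=
  IsClosed.inter (s₁ := {x : E2 | s1 ≤ ‖x‖ ^ 2}) (s₂ := {x : E2 | 0 ≤ inner ℝ e x})
    (isClosed_le continuous_const (by fun_prop)) (isClosed_le continuous_const (by fun_prop))

theorem half_nhds {s1 : ℝ} {e y : E2} (h1 : s1 < ‖y‖ ^ 2) (h2 : 0 < inner ℝ e y) :
    ∀ᶠ x : E2 in 𝓝 y, s1 < ‖x‖ ^ 2 ∧ 0 < inner ℝ e x :=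
  ((show ContinuousAt (fun x : E2 => ‖x‖ ^ 2) y by fun_prop).eventually (lt_mem_nhds h1)).and
    ((show ContinuousAt (fun x : E2 => inner ℝ e x) y by fun_prop).eventually (lt_mem_nhds h2))

set_option maxHeartbeats 1000000 in
/-- Step 3. -/
theorem Ctx.step3 {ε a M s1 : ℝ} {P fr : ℝ → ℝ} {μ : E2 → ℝ} {f v : E2 → E2} {G h : ℝ → ℝ}
    (C : Ctx ε a M s1 P fr μ f v G h) {e : E2} (he : ‖e‖ = 1) {x : E2} (hx : s1 ≤ ‖x‖ ^ 2)
    (hxe : 0 ≤ inner ℝ e x) : - (M * h (‖x‖ ^ 2)) ≤ inner ℝ e (v x) := by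
  have hM := C.hM
  have hε := C.hε
  have ha := C.ha
  have hwb : ∀ x, |inner ℝ e (v x)| ≤ M := by
    intro x
    have := abs_real_inner_le_norm e (v x)
    rw [he, one_mul] at this
    exact this.trans (C.vb x)
  suffices H : ∀ δ > 0, - inner ℝ e (v x) ≤ M * h (‖x‖ ^ 2) + δ * G (‖x‖ ^ 2) by
    have hg := C.G1 _ hx
    suffices - inner ℝ e (v x) ≤ M * h (‖x‖ ^ 2) by linarith
    refine le_of_forall_pos_le_add fun t ht => ?_
    have := H (t / G (‖x‖ ^ 2)) (by positivity)
    rwa [div_mul_cancel₀ _ (by positivity)] at this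
  intro δ hδ
  by_contra hcon
  push Not at hcon
  have hR := C.Rh.lin C.RG M δ
  set η : ℝ → ℝ := fun s => M * h s + δ * G s with hη
  obtain ⟨y, hy, hypos, hmax⟩ := exists_max (g := fun x => - inner ℝ e (v x) - η (‖x‖ ^ 2)) (K := M)
    (half_closed s1 e)
    (((continuous_const.inner C.vc).neg).continuousOn.sub (hR.contOn.mono fun x hx => hx.1)) hδ C.Gtop (by
      intro x hx
      have h1 := abs_le.1 (hwb x)
      have h2 : 0 ≤ M * h (‖x‖ ^ 2) := mul_nonneg (by positivity) (C.hpos _ hx.1).le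
      simp only [hη]; linarith [h1.1]) (x0 := x) ⟨hx, hxe⟩ (by simp only [hη]; linarith)
  have hypos : 0 < - inner ℝ e (v y) - η (‖y‖ ^ 2) := hypos
  have hδG : 0 < δ * G (‖y‖ ^ 2) := by
    have := C.G1 _ hy.1; positivity
  have hy1 : s1 < ‖y‖ ^ 2 := by
    rcases hy.1.lt_or_eq with h | h
    · exact h
    · exfalso
      have h1 := abs_le.1 (hwb y)
      rw [← h] at hδG
      simp only [hη, ← h, C.h1] at hypos
      linarith [h1.1]
  have hy2 : 0 < inner ℝ e y := by
    rcases hy.2.lt_or_eq with h | h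
    · exact h
    · exfalso
      have h1 := abs_le.1 (C.tang hy.1 he (by rw [real_inner_comm]; exact h.symm))
      simp only [hη] at hypos
      linarith [h1.1]
  have ht := (C.vs e).neg.touch_max (contDiffAt_radial y (hR.contDiffAt hy1)) (by
    filter_upwards [half_nhds hy1 hy2] with x hx
    exact hmax x ⟨hx.1.le, hx.2.le⟩)
  rw [hR.lapS_eq hy1, C.rhs_eq e y hy1.le] at ht
  have hP := C.Ppos _ hy1.le
  have hlt : P (‖y‖ ^ 2) * η (‖y‖ ^ 2) < P (‖y‖ ^ 2) * (- inner ℝ e (v y)) := by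
    gcongr; linarith
  have hηp : 0 < η (‖y‖ ^ 2) := by
    have := C.hpos _ hy1.le
    simp only [hη]; positivity
  have h1 : 0 ≤ ‖v y‖ ^ 2 / ε ^ 2 * (- inner ℝ e (v y)) :=
    mul_nonneg (by positivity) (by linarith)
  have h2 : 0 ≤ a / ε * (fr (‖y‖ ^ 2) * inner ℝ e y) :=
    mul_nonneg (by positivity) (mul_nonneg (C.fr0 _ hy1.le) hy2.le)
  simp only [hη] at ht hlt
  linarith

set_option maxHeartbeats 1000000 in
/-- Step 4. -/
theorem Ctx.step4 {ε a M s1 : ℝ} {P fr : ℝ → ℝ} {μ : E2 → ℝ} {f v : E2 → E2} {G h : ℝ → ℝ}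
    (C : Ctx ε a M s1 P fr μ f v G h) (hle : ∀ s, s1 ≤ s → h s ≤ 1) {ζ : ℝ → ℝ}
    (ζc : ContinuousOn ζ (Ici s1)) (ζd : ∀ s, s1 < s → ContDiffAt ℝ 2 ζ s)
    (ζ0 : ∀ s, s1 ≤ s → 0 ≤ ζ s) (ζb : ∀ s, s1 ≤ s → √s * ζ s ≤ 4 * M * h s) (ζ1 : ζ s1 = 0)
    (Z : ∀ s, s1 < s → 0 < ζ s → (ε ^ 2 * P s + 18 * M ^ 2 * h s ^ 2) * ζ s - ε * a * fr s ≤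
      ε ^ 2 * (4 * s * deriv (deriv ζ) s + 8 * deriv ζ s))
    {e : E2} (he : ‖e‖ = 1) {x : E2} (hx : s1 ≤ ‖x‖ ^ 2)
    (hxe : 0 ≤ inner ℝ e x) :
    inner ℝ e x * ζ (‖x‖ ^ 2) - (M * h (‖x‖ ^ 2)) ≤ inner ℝ e (v x) := by
  have hM := C.hM
  have hε := C.hε
  have ha := C.ha
  have hwb : ∀ x, |inner ℝ e (v x)| ≤ M := by
    intro x
    have := abs_real_inner_le_norm e (v x)
    rw [he, one_mul] at this
    exact this.trans (C.vb x)
  have hpb : ∀ x : E2, s1 ≤ ‖x‖ ^ 2 → inner ℝ e x * ζ (‖x‖ ^ 2) ≤ 4 * M * h (‖x‖ ^ 2) := by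
    intro x hx
    have h1 := real_inner_le_norm e x
    rw [he, one_mul] at h1
    have h2 := ζb _ hx
    rw [Real.sqrt_sq (norm_nonneg x)] at h2
    exact (mul_le_mul_of_nonneg_right h1 (ζ0 _ hx)).trans h2
  suffices H : ∀ δ > 0, inner ℝ e x * ζ (‖x‖ ^ 2) - inner ℝ e (v x) ≤ M * h (‖x‖ ^ 2) + δ * G (‖x‖ ^ 2) by
    have hg := C.G1 _ hx
    suffices inner ℝ e x * ζ (‖x‖ ^ 2) - inner ℝ e (v x) ≤ M * h (‖x‖ ^ 2) by linarith
    refine le_of_forall_pos_le_add fun t ht => ?_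
    have := H (t / G (‖x‖ ^ 2)) (by positivity)
    rwa [div_mul_cancel₀ _ (by positivity)] at this
  intro δ hδ
  by_contra hcon
  push Not at hcon
  have hR := C.Rh.lin C.RG M δ
  set η : ℝ → ℝ := fun s => M * h s + δ * G s with hη
  obtain ⟨y, hy, hypos, hmax⟩ := exists_max
    (g := fun x => - inner ℝ e (v x) - (η (‖x‖ ^ 2) - (0 + inner ℝ e x) * ζ (‖x‖ ^ 2))) (K := 5 * M)
    (half_closed s1 e)
    (((continuous_const.inner C.vc).neg).continuousOn.sub ((hR.contOn.mono fun x hx => hx.1).sub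
      ((by fun_prop : Continuous fun x : E2 => 0 + inner ℝ e x).continuousOn.mul
        (ζc.comp (by fun_prop) fun x hx => hx.1)))) hδ C.Gtop (by
      intro x hx
      have h1 := abs_le.1 (hwb x)
      have h2 : 0 ≤ M * h (‖x‖ ^ 2) := mul_nonneg (by positivity) (C.hpos _ hx.1).le
      have h3 := hpb x hx.1
      have h4 : M * h (‖x‖ ^ 2) ≤ M * 1 := by gcongr; exact hle _ hx.1
      simp only [hη]; linarith [h1.1]) (x0 := x) ⟨hx, hxe⟩ (by simp only [hη]; linarith)
  have hypos : 0 < - inner ℝ e (v y) - (η (‖y‖ ^ 2) - (0 + inner ℝ e y) * ζ (‖y‖ ^ 2)) := hypos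
  have hδG : 0 < δ * G (‖y‖ ^ 2) := by
    have := C.G1 _ hy.1; positivity
  have hy1 : s1 < ‖y‖ ^ 2 := by
    rcases hy.1.lt_or_eq with h | h
    · exact h
    · exfalso
      have h1 := abs_le.1 (hwb y)
      rw [← h] at hδG
      simp only [hη, ← h, C.h1, ζ1] at hypos
      linarith [h1.1]
  have hy2 : 0 < inner ℝ e y := by
    rcases hy.2.lt_or_eq with h | h
    · exact h
    · exfalso
      have h1 := abs_le.1 (C.tang hy.1 he (by rw [real_inner_comm]; exact h.symm))
      simp only [hη, ← h] at hypos
      linarith [h1.1]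
  have hζ : 0 < ζ (‖y‖ ^ 2) := by
    rcases (ζ0 _ hy1.le).lt_or_eq with h | h
    · exact h
    · exfalso
      have h1 := C.step3 he hy.1 hy.2
      simp only [hη, ← h] at hypos
      linarith
  have ht := (C.vs e).neg.touch_max
    ((contDiffAt_radial y (hR.contDiffAt hy1)).sub (contDiffAt_barrier 0 e y (ζd _ hy1))) (by
    filter_upwards [half_nhds hy1 hy2] with x hx
    exact hmax x ⟨hx.1.le, hx.2.le⟩)
  rw [lapS_sub_at (contDiffAt_radial y (hR.contDiffAt hy1)) (contDiffAt_barrier 0 e y (ζd _ hy1)),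
    hR.lapS_eq hy1, lapS_barrier 0 e y (ζd _ hy1), C.rhs_eq e y hy1.le] at ht
  have hP := C.Ppos _ hy1.le
  have hlt : P (‖y‖ ^ 2) * η (‖y‖ ^ 2) <
      P (‖y‖ ^ 2) * (inner ℝ e y * ζ (‖y‖ ^ 2) - inner ℝ e (v y)) := by
    gcongr; linarith
  have hZ := mul_le_mul_of_nonneg_left (Z _ hy1 hζ) hy2.le
  -- decomposition
  have hny : 0 < ‖y‖ := by
    have h1 := C.hs1.trans hy1
    by_contra hc
    have : ‖y‖ = 0 := le_antisymm (not_lt.1 hc) (norm_nonneg y)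
    rw [this] at h1; norm_num at h1
  set p := inner ℝ e y with hp
  set w := inner ℝ e (v y) with hw
  set N := ‖v y‖ ^ 2 with hN
  have hhp := C.hpos _ hy1.le
  have hζb := ζb _ hy1.le
  have hup := C.step3 (e := (‖y‖)⁻¹ • y) (x := y) (by rw [norm_smul, norm_inv, norm_norm, inv_mul_cancel₀ hny.ne'])
    hy1.le (by rw [real_inner_smul_left, real_inner_self_eq_norm_sq]; positivity)
  rw [Real.sqrt_sq (norm_nonneg y)] at hζb
  set u : E2 := (‖y‖)⁻¹ • y with hu
  have hun : ‖u‖ = 1 := by rw [hu, norm_smul, norm_inv, norm_norm, inv_mul_cancel₀ hny.ne']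
  have hyu : y = ‖y‖ • u := by rw [hu, smul_smul, mul_inv_cancel₀ hny.ne', one_smul]
  obtain ⟨d1, d2, d3⟩ := perp_decomp u hun
  have htan := C.tang (x := y) hy1.le d1 (by rw [hyu, real_inner_smul_left, d2, mul_zero])
  have hw2 : w = inner ℝ e u * inner ℝ u (v y) + inner ℝ e (perp u) * inner ℝ (perp u) (v y) := d3 _ _
  have hN2 : N = inner ℝ u (v y) ^ 2 + inner ℝ (perp u) (v y) ^ 2 := by
    rw [hN, ← real_inner_self_eq_norm_sq, d3 (v y) (v y), real_inner_comm u, real_inner_comm (perp u)]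
    ring
  have hp2 : p = ‖y‖ * inner ℝ e u := by
    rw [hp]; nth_rewrite 1 [hyu]; rw [real_inner_smul_right]
  have hec : |inner ℝ e (perp u)| ≤ 1 := by
    have := abs_real_inner_le_norm e (perp u); rwa [he, d1, one_mul] at this
  have heu : 0 < inner ℝ e u := by
    rw [hp2] at hy2; exact pos_of_mul_pos_right hy2 hny.le
  have hβ : - (M * h (‖y‖ ^ 2)) ≤ inner ℝ e (perp u) * inner ℝ (perp u) (v y) := by
    have h1 : |inner ℝ e (perp u) * inner ℝ (perp u) (v y)| ≤ 1 * (M * h (‖y‖ ^ 2)) := by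
      rw [abs_mul]; gcongr
    linarith [(abs_le.1 h1).1]
  have hwlt : w < p * ζ (‖y‖ ^ 2) - M * h (‖y‖ ^ 2) := by
    simp only [hη] at hypos; linarith
  have hα : inner ℝ u (v y) < ‖y‖ * ζ (‖y‖ ^ 2) := by
    have h1 : inner ℝ e u * inner ℝ u (v y) < inner ℝ e u * (‖y‖ * ζ (‖y‖ ^ 2)) := by
      rw [hw2, hp2] at hwlt; linarith
    exact lt_of_mul_lt_mul_left h1 heu.le
  have hN17 : N ≤ 17 * (M ^ 2 * h (‖y‖ ^ 2) ^ 2) := by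
    have h1 : inner ℝ u (v y) ^ 2 ≤ (4 * (M * h (‖y‖ ^ 2))) ^ 2 := by
      apply sq_le_sq'
      · have : 0 < M * h (‖y‖ ^ 2) := by positivity
        linarith
      · linarith
    have h2 : inner ℝ (perp u) (v y) ^ 2 ≤ (M * h (‖y‖ ^ 2)) ^ 2 := by
      rw [← sq_abs (inner ℝ (perp u) (v y))]
      gcongr
    rw [hN2]; linarith
  have hkey : 18 * M ^ 2 * h (‖y‖ ^ 2) ^ 2 * (p * ζ (‖y‖ ^ 2)) < N * w := by
    have e1 := mul_lt_mul_of_pos_left (add_lt_add_of_le_of_lt ht hlt) (pow_pos hε 2)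
    have e2 : ε ^ 2 * (-((N / ε ^ 2 + P (‖y‖ ^ 2)) * w - a / ε * (fr (‖y‖ ^ 2) * p))) =
      - (N * w) - ε ^ 2 * P (‖y‖ ^ 2) * w + ε * a * fr (‖y‖ ^ 2) * p := by
      field_simp; ring
    rw [mul_add, mul_add, e2] at e1
    linarith
  have hpz : 0 < p * ζ (‖y‖ ^ 2) := by positivity
  have hM0 : 0 < M ^ 2 * h (‖y‖ ^ 2) ^ 2 := by positivity
  have hwp : w < p * ζ (‖y‖ ^ 2) := by
    have : 0 < M * h (‖y‖ ^ 2) := by positivity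
    linarith
  have hN0 : 0 ≤ N := by positivity
  have h5 : N * w ≤ N * (p * ζ (‖y‖ ^ 2)) := mul_le_mul_of_nonneg_left hwp.le hN0
  have h6 : N * (p * ζ (‖y‖ ^ 2)) ≤ 17 * (M ^ 2 * h (‖y‖ ^ 2) ^ 2) * (p * ζ (‖y‖ ^ 2)) := by gcongr
  have h7 : 0 < M ^ 2 * h (‖y‖ ^ 2) ^ 2 * (p * ζ (‖y‖ ^ 2)) := by positivity
  linarith

theorem topo_complex {g : ℂ → ℂ} (hg : Continuous g) {R : ℝ} (hR : 0 < R)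
    (hb : ∀ z : ℂ, ‖z‖ = R → 0 < (g z / z).re) : ∃ z, ‖z‖ ≤ R ∧ g z = 0 := by
  by_contra hcon
  push Not at hcon
  let r : ℂ → ℂ := fun z => ((R / max R ‖z‖ : ℝ) : ℂ) * z
  have hmax : ∀ z : ℂ, 0 < max R ‖z‖ := fun z => lt_max_of_lt_left hR
  have hr : Continuous r := by
    refine (Complex.continuous_ofReal.comp ?_).mul continuous_id
    exact continuous_const.div (by fun_prop) fun z => (hmax z).ne'
  have hrn : ∀ z, ‖r z‖ ≤ R := by
    intro z
    simp only [r, norm_mul, Complex.norm_real, norm_div, Real.norm_eq_abs, abs_of_pos hR, abs_of_pos (hmax z)]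
    rw [div_mul_eq_mul_div, div_le_iff₀ (hmax z)]
    gcongr; exact le_max_right _ _
  have hr1 : ∀ z : ℂ, ‖z‖ = R → r z = z := by
    intro z hz; simp [r, hz, hR.ne']
  obtain ⟨L, hLc, hL⟩ := Complex.exists_continuousOn_eqOn_exp_comp (U := (univ : Set ℂ)) (g := fun z => g (r z))
    (by
      have : ContractibleSpace (univ : Set ℂ) := (convex_univ (𝕜 := ℝ)).contractibleSpace univ_nonempty
      exact (inferInstance : SimplyConnectedSpace (univ : Set ℂ))) isOpen_univ (hg.comp hr).continuousOn (by
      rintro ⟨z, -, hz⟩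
      exact hcon _ (hrn z) hz)
  rw [continuousOn_univ] at hLc
  let c : ℝ → ℂ := fun t => (R : ℂ) * Complex.exp (t * Complex.I)
  have hc : Continuous c := by fun_prop
  have hcn : ∀ t, ‖c t‖ = R := by
    intro t; simp [c, Complex.norm_exp_ofReal_mul_I, abs_of_pos hR]
  have hc0 : ∀ t, c t ≠ 0 := fun t h => by
    have := hcn t; rw [h, norm_zero] at this; exact hR.ne this
  have hpc : Continuous fun t => Complex.log (g (c t) / c t) :=
    Continuous.clog ((hg.comp hc).div hc hc0) fun t => Or.inl (hb _ (hcn t))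
  have hp0 : ∀ t, g (c t) / c t ≠ 0 := fun t h => by
    have := hb _ (hcn t); rw [h] at this; simp at this
  let D : ℝ → ℝ := fun t => ((L (c t) - Complex.log (g (c t) / c t) - Complex.log R).im - t) / (2 * π)
  have hD : Continuous D := by
    refine Continuous.div_const ((Complex.continuous_im.comp (((hLc.comp hc).sub hpc).sub continuous_const)).sub continuous_id) _
  have hDint : ∀ t, ∃ n : ℤ, D t = n := by
    intro t
    have h1 : Complex.exp (L (c t) - Complex.log (g (c t) / c t) - Complex.log R - t * Complex.I) = 1 := by
      have h2 := hL (mem_univ (c t))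
      simp only [Function.comp, hr1 _ (hcn t)] at h2
      rw [Complex.exp_sub, Complex.exp_sub, Complex.exp_sub, h2, Complex.exp_log (hp0 t),
        Complex.exp_log (by exact_mod_cast hR.ne'), div_div, div_div]
      have h3 : g (c t) ≠ 0 := hcon _ (hcn t).le
      have h4 : (R : ℂ) * Complex.exp (t * Complex.I) = c t := rfl
      rw [h4, div_mul_cancel₀ _ (hc0 t), div_self h3]
    obtain ⟨n, hn⟩ := Complex.exp_eq_one_iff.1 h1
    refine ⟨n, ?_⟩
    have h5 := congrArg Complex.im hn
    simp only [Complex.sub_im] at h5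
    simp at h5
    simp only [D, Complex.sub_im]
    rw [div_eq_iff (by positivity)]
    linarith
  have hper : c (2 * π) = c 0 := by simp [c]
  have h2π : D (2 * π) = D 0 - 1 := by
    simp only [D, hper]; field_simp; ring
  obtain ⟨t, ht⟩ := mem_range_of_exists_le_of_exists_ge hD (c := D 0 - 1 / 2)
    ⟨2 * π, by rw [h2π]; linarith⟩ ⟨0, by linarith⟩
  obtain ⟨n, hn⟩ := hDint t
  obtain ⟨m, hm⟩ := hDint 0
  rw [hn, hm] at ht
  have : (2 * n : ℝ) = 2 * m - 1 := by linarith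
  have : 2 * n = 2 * m - 1 := by exact_mod_cast this
  omega

theorem topo {v : E2 → E2} (hv : Continuous v) {R : ℝ} (hR : 0 < R)
    (hb : ∀ x : E2, ‖x‖ = R → 0 < inner ℝ x (v x)) : ∃ x, v x = 0 := by
  let Φ := Complex.orthonormalBasisOneI.repr
  obtain ⟨z, -, hz⟩ := topo_complex (g := fun z => Φ.symm (v (Φ z)))
    (Φ.symm.continuous.comp (hv.comp Φ.continuous)) hR (by
      intro z hz
      have h1 := hb (Φ z) (by rw [Φ.norm_map]; exact hz)
      have h2 := Φ.inner_map_map z (Φ.symm (v (Φ z)))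
      rw [LinearIsometryEquiv.apply_symm_apply] at h2
      rw [h2, Complex.inner] at h1
      have h3 : 0 < Complex.normSq z := by
        rw [Complex.normSq_eq_norm_sq, hz]; positivity
      rw [div_eq_mul_inv, Complex.inv_def, ← mul_assoc, Complex.re_mul_ofReal]
      exact mul_pos h1 (inv_pos.2 h3))
  exact ⟨Φ z, by simpa using hz⟩

theorem deriv_mul_at {A B : ℝ → ℝ} {s : ℝ} (hA : ContDiffAt ℝ 2 A s) (hB : ContDiffAt ℝ 2 B s) :
    deriv (fun s => A s * B s) s = deriv A s * B s + A s * deriv B s ∧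
    deriv (deriv (fun s => A s * B s)) s =
      deriv (deriv A) s * B s + 2 * (deriv A s * deriv B s) + A s * deriv (deriv B) s := by
  have key : ∀ t, ContDiffAt ℝ 2 A t → ContDiffAt ℝ 2 B t →
      deriv (fun s => A s * B s) t = deriv A t * B t + A t * deriv B t := by
    intro t h1 h2
    exact ((h1.differentiableAt (by norm_num)).hasDerivAt.mul
      (h2.differentiableAt (by norm_num)).hasDerivAt).deriv
  refine ⟨key s hA hB, ?_⟩
  have hev : deriv (fun s => A s * B s) =ᶠ[𝓝 s] fun t => deriv A t * B t + A t * deriv B t := by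
    filter_upwards [hA.eventually (by simp), hB.eventually (by simp)] with t h1 h2 using key t h1 h2
  rw [hev.deriv_eq]
  have a0 := (hA.differentiableAt (by norm_num)).hasDerivAt
  have b0 := (hB.differentiableAt (by norm_num)).hasDerivAt
  have a1 := ((contDiffAt_deriv hA).differentiableAt (by norm_num)).hasDerivAt
  have b1 := ((contDiffAt_deriv hB).differentiableAt (by norm_num)).hasDerivAt
  rw [((a1.fun_mul b0).fun_add (a0.fun_mul b1)).deriv]
  ring

def om (ρ s : ℝ) : ℝ := (√s)⁻¹ + ρ * s⁻¹

theorem om_contDiffAt (ρ : ℝ) {s : ℝ} (hs : 0 < s) : ContDiffAt ℝ 2 (om ρ) s := by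
  unfold om
  exact ((Real.contDiffAt_sqrt hs.ne').inv (Real.sqrt_pos.2 hs).ne').add
    (contDiffAt_const.mul (contDiffAt_id.inv hs.ne'))

theorem om_deriv (ρ : ℝ) {s : ℝ} (hs : 0 < s) :
    deriv (om ρ) s = - (1/2) * (√s ^ 3)⁻¹ - ρ * (s ^ 2)⁻¹ := by
  have hr := Real.sqrt_pos.2 hs
  have h1 : HasDerivAt (fun s => (√s)⁻¹) (- (1 / (2 * √s)) / (√s) ^ 2) s :=
    (Real.hasDerivAt_sqrt hs.ne').fun_inv hr.ne'
  have h2 : HasDerivAt (fun s : ℝ => ρ * s⁻¹) (ρ * (- (s ^ 2)⁻¹)) s := (hasDerivAt_inv hs.ne').const_mul ρ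
  have h3 : HasDerivAt (om ρ) _ s := h1.fun_add h2
  rw [h3.deriv]
  field_simp
  ring

theorem om_deriv2 (ρ : ℝ) {s : ℝ} (hs : 0 < s) :
    deriv (deriv (om ρ)) s = 3/4 * (√s ^ 5)⁻¹ + 2 * ρ * (s ^ 3)⁻¹ := by
  have hr := Real.sqrt_pos.2 hs
  have hev : deriv (om ρ) =ᶠ[𝓝 s] fun s => - (1/2) * (√s ^ 3)⁻¹ - ρ * (s ^ 2)⁻¹ := by
    filter_upwards [Ioi_mem_nhds hs] with t ht using om_deriv ρ ht
  rw [hev.deriv_eq]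
  have h1 := ((((Real.hasDerivAt_sqrt hs.ne').fun_pow 3).fun_inv (pow_pos hr 3).ne').const_mul (-(1/2)))
  have h2 := (((hasDerivAt_id s).fun_pow 2).fun_inv (pow_pos hs 2).ne').const_mul ρ
  have h3 := h1.fun_sub h2
  simp only [id] at h3
  rw [h3.deriv]
  field_simp
  norm_num
  ring

theorem smoothTransition_bounds : ∃ K : ℝ, 0 < K ∧ ∀ x, |deriv Real.smoothTransition x| ≤ K ∧
    |deriv (deriv Real.smoothTransition) x| ≤ K := by
  have hc : ContDiff ℝ 2 Real.smoothTransition := Real.smoothTransition.contDiff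
  have c1 : Continuous (deriv Real.smoothTransition) := hc.continuous_deriv (by norm_num)
  have c2 : Continuous (deriv (deriv Real.smoothTransition)) := by
    have : ContDiff ℝ 1 (deriv Real.smoothTransition) := by
      rw [contDiff_iff_contDiffAt]; exact fun x => contDiffAt_deriv hc.contDiffAt
    exact this.continuous_deriv (by norm_num)
  obtain ⟨K1, hK1⟩ := isCompact_Icc.exists_bound_of_continuousOn (s := Icc (0:ℝ) 1) c1.continuousOn
  obtain ⟨K2, hK2⟩ := isCompact_Icc.exists_bound_of_continuousOn (s := Icc (0:ℝ) 1) c2.continuousOn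
  refine ⟨max K1 K2 ⊔ 1, lt_of_lt_of_le one_pos (le_max_right _ _), fun x => ?_⟩
  by_cases hx : x ∈ Icc (0:ℝ) 1
  · exact ⟨(hK1 x hx).trans ((le_max_left _ _).trans (le_max_left _ _)),
      (hK2 x hx).trans ((le_max_right _ _).trans (le_max_left _ _))⟩
  · have hloc : ∃ c : ℝ, Real.smoothTransition =ᶠ[𝓝 x] fun _ => c := by
      rcases lt_or_ge x 0 with h | h
      · exact ⟨0, by filter_upwards [Iio_mem_nhds h] with t ht using Real.smoothTransition.zero_of_nonpos (le_of_lt ht)⟩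
      · have h2 : 1 < x := by
          by_contra hc; exact hx ⟨h, not_lt.1 hc⟩
        exact ⟨1, by filter_upwards [Ioi_mem_nhds h2] with t ht using Real.smoothTransition.one_of_one_le (le_of_lt ht)⟩
    obtain ⟨c, hc⟩ := hloc
    have d1 : deriv Real.smoothTransition =ᶠ[𝓝 x] fun _ => 0 := by
      filter_upwards [hc.deriv] with t ht; rw [ht]; simp
    have d2 : deriv (deriv Real.smoothTransition) x = 0 := by rw [d1.deriv_eq]; simp
    rw [d1.eq_of_nhds, d2]
    simp

/-- the cutoff -/
def chi (s2 θ s : ℝ) : ℝ := Real.smoothTransition ((s - s2) / θ)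

theorem chi_contDiff (s2 θ : ℝ) : ContDiff ℝ 2 (chi s2 θ) :=
  Real.smoothTransition.contDiff.comp (by fun_prop)

theorem chi_deriv (s2 θ s : ℝ) : deriv (chi s2 θ) s = deriv Real.smoothTransition ((s - s2) / θ) / θ := by
  have hc : ContDiff ℝ 2 Real.smoothTransition := Real.smoothTransition.contDiff
  have h1 := (hc.differentiable (by norm_num) ((s - s2) / θ)).hasDerivAt
  have h2 : HasDerivAt (fun s : ℝ => (s - s2) / θ) (1 / θ) s := ((hasDerivAt_id s).sub_const s2).div_const θ
  have := (h1.comp s h2).deriv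
  rw [show chi s2 θ = Real.smoothTransition ∘ fun s => (s - s2) / θ from rfl, this]; ring

theorem chi_deriv2 (s2 θ s : ℝ) : deriv (deriv (chi s2 θ)) s =
    deriv (deriv Real.smoothTransition) ((s - s2) / θ) / θ ^ 2 := by
  have hc : ContDiff ℝ 2 Real.smoothTransition := Real.smoothTransition.contDiff
  have h1 := ((contDiffAt_deriv (hc.contDiffAt (x := (s - s2) / θ))).differentiableAt (by norm_num)).hasDerivAt
  have h2 : HasDerivAt (fun s : ℝ => (s - s2) / θ) (1 / θ) s := ((hasDerivAt_id s).sub_const s2).div_const θ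
  have h3 : deriv (chi s2 θ) = fun s => (deriv Real.smoothTransition ∘ fun s => (s - s2) / θ) s / θ := by
    ext s; rw [chi_deriv]; rfl
  rw [h3, ((h1.comp s h2).div_const θ).deriv]
  ring

theorem chi_one {s2 θ s : ℝ} (hθ : 0 < θ) (h : s2 + θ ≤ s) : chi s2 θ s = 1 :=
  Real.smoothTransition.one_of_one_le (by rw [le_div_iff₀ hθ]; linarith)

theorem chi_zero {s2 θ s : ℝ} (hθ : 0 < θ) (h : s ≤ s2) : chi s2 θ s = 0 :=
  Real.smoothTransition.zero_of_nonpos (div_nonpos_of_nonpos_of_nonneg (by linarith) hθ.le)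

theorem chi_deriv_zero {s2 θ s : ℝ} (hθ : 0 < θ) (h : s2 + θ < s) :
    deriv (chi s2 θ) s = 0 ∧ deriv (deriv (chi s2 θ)) s = 0 := by
  have h1 : chi s2 θ =ᶠ[𝓝 s] fun _ => 1 := by
    filter_upwards [Ioi_mem_nhds h] with t ht using chi_one hθ (le_of_lt ht)
  have d1 : deriv (chi s2 θ) =ᶠ[𝓝 s] fun _ => 0 := by
    filter_upwards [h1.deriv] with t ht; rw [ht]; simp
  exact ⟨d1.eq_of_nhds, by rw [d1.deriv_eq]; simp⟩

theorem sqrt_gap {ρ θ s1 s : ℝ} (hρ : 0 < ρ) (hθ : 0 < θ) (hθρ : θ ≤ ρ / 2) (hs1 : s1 = ρ ^ 2 + θ)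
    (hs : s1 + θ ≤ s) : θ / (2 * (ρ + 1)) ≤ √s - √s1 := by
  have h0 : √(s1 + θ) ≤ √s := Real.sqrt_le_sqrt hs
  have h1 : √s1 ≤ √(s1 + θ) := Real.sqrt_le_sqrt (by linarith)
  have h2 : √(s1 + θ) ≤ ρ + 1 := by
    rw [Real.sqrt_le_left (by linarith)]; nlinarith
  have h3 : √s1 ^ 2 = s1 := Real.sq_sqrt (by rw [hs1]; positivity)
  have h4 : √(s1 + θ) ^ 2 = s1 + θ := Real.sq_sqrt (by rw [hs1]; positivity)
  suffices θ / (2 * (ρ + 1)) ≤ √(s1 + θ) - √s1 by linarith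
  rw [div_le_iff₀ (by positivity)]
  have h5 : (√(s1 + θ) - √s1) * (√(s1 + θ) + √s1) ≤ (√(s1 + θ) - √s1) * (2 * (ρ + 1)) :=
    mul_le_mul_of_nonneg_left (by linarith) (by linarith)
  nlinarith

theorem sh_sq {ρ θ s1 k s : ℝ} {h : ℝ → ℝ} (hρ : 0 < ρ) (hθ : 0 < θ) (hθρ : θ ≤ ρ / 2)
    (hs1 : s1 = ρ ^ 2 + θ) (hs : s1 + θ ≤ s) (hk : 2 / ρ ≤ k) (h0 : 0 < h s)
    (hexp : h s ≤ exp (-(k * (√s - √s1)))) :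
    s * h s ^ 2 ≤ (ρ + 1) ^ 2 * exp (-(k * θ / (2 * (ρ + 1)))) := by
  have hgap := sqrt_gap hρ hθ hθρ hs1 hs
  have hs1p : 0 < s1 := by rw [hs1]; positivity
  have hr1 : 0 < √s1 := Real.sqrt_pos.2 hs1p
  have hr1ρ : ρ ≤ √s1 := Real.le_sqrt_of_sq_le (by linarith)
  have hr12 : √s1 ≤ ρ + 1 := by
    rw [Real.sqrt_le_left (by linarith)]; nlinarith
  have hkp : 0 < k := lt_of_lt_of_le (by positivity) hk
  set r := √s
  set r1 := √s1
  have hrr : 0 < r - r1 := lt_of_lt_of_le (by positivity) hgap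
  have hsq : s = r ^ 2 := (Real.sq_sqrt (by linarith)).symm
  have e1 : r ≤ r1 * exp ((r - r1) / r1) := by
    have := Real.add_one_le_exp ((r - r1) / r1)
    calc r = r1 * ((r - r1) / r1 + 1) := by field_simp; ring
      _ ≤ _ := by gcongr
  have e2 : r * h s ≤ r1 * exp (-(k / 2 * (r - r1))) := by
    calc r * h s ≤ (r1 * exp ((r - r1) / r1)) * exp (-(k * (r - r1))) := by gcongr
      _ = r1 * exp ((r - r1) / r1 - k * (r - r1)) := by rw [mul_assoc, ← Real.exp_add]; rfl
      _ ≤ _ := by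
        gcongr
        have h1 : 1 / r1 ≤ k / 2 := by
          calc 1 / r1 ≤ 1 / ρ := by gcongr
            _ = 2 / ρ / 2 := by ring
            _ ≤ k / 2 := by gcongr
        have h2 := mul_le_mul_of_nonneg_right h1 hrr.le
        have h3 : (r - r1) / r1 = 1 / r1 * (r - r1) := by ring
        rw [h3]; linarith
  have hr0 : 0 < r := by linarith
  calc s * h s ^ 2 = (r * h s) ^ 2 := by rw [hsq]; ring
    _ ≤ (r1 * exp (-(k / 2 * (r - r1)))) ^ 2 := by gcongr
    _ = r1 ^ 2 * exp (-(k * (r - r1))) := by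
      rw [mul_pow, ← Real.exp_nat_mul]; congr 2; push_cast; ring
    _ ≤ (ρ + 1) ^ 2 * exp (-(k * θ / (2 * (ρ + 1)))) := by
      gcongr
      rw [mul_div_assoc]
      gcongr

theorem h_le_q {ρ θ s1 k s : ℝ} {h : ℝ → ℝ} (hρ : 0 < ρ) (hθ : 0 < θ) (hθρ : θ ≤ ρ / 2)
    (hs1 : s1 = ρ ^ 2 + θ) (hs : s1 + θ ≤ s) (hk : 0 < k)
    (hexp : h s ≤ exp (-(k * (√s - √s1)))) : h s ≤ exp (-(k * θ / (2 * (ρ + 1)))) := by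
  refine hexp.trans ?_
  gcongr
  rw [mul_div_assoc]
  gcongr
  exact sqrt_gap hρ hθ hθρ hs1 hs

theorem h_deriv_le {θ s1 s : ℝ} {P h : ℝ → ℝ} (hs1 : 0 < s1) (hθ : 0 < θ) (Rh : RadSol P s1 h)
    (hs : s1 < s - θ) (hpos : ∀ s, s1 ≤ s → 0 < h s) (hneg : deriv h s ≤ 0)
    (hmono : ∀ s t, s1 < s → s ≤ t → s * deriv h s ≤ t * deriv h t) :
    - deriv h s ≤ h (s - θ) / θ := by
  have hd : ∀ t, s1 < t → HasDerivAt h (deriv h t) t := fun t ht =>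
    ((Rh.contDiffAt ht).differentiableAt (by norm_num)).hasDerivAt
  obtain ⟨t, ht, hte⟩ := exists_hasDerivAt_eq_slope h (deriv h) (show s - θ < s by linarith)
    (Rh.cont.mono fun t ht => hs.le.trans ht.1) fun t ht => hd t (hs.trans ht.1)
  have h1 := hmono t s (hs.trans ht.1) ht.2.le
  have htp : 0 < t := hs1.trans (hs.trans ht.1)
  have h2 : deriv h t ≤ deriv h s := by
    have : s * deriv h s ≤ t * deriv h s := mul_le_mul_of_nonpos_right ht.2.le hneg
    exact le_of_mul_le_mul_left (h1.trans this) htp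
  rw [hte] at h2
  have h3 := hpos s (by linarith)
  have h4 : (h s - h (s - θ)) / (s - (s - θ)) = h s / θ - h (s - θ) / θ := by
    rw [show s - (s - θ) = θ by ring]; ring
  rw [h4] at h2
  have : 0 < h s / θ := by positivity
  linarith

/-- the constant in the cutoff estimate -/
def C0 (ρ M K : ℝ) : ℝ :=
  2 * M * (K * (8 * (ρ + 1) ^ 2 * (2 / ρ ^ 3 * ρ + 2 / ρ) + (4 * (ρ + 1) ^ 2 + 8 * ρ) * (2 / ρ)))

theorem om_bounds {ρ s : ℝ} (hρ : 0 < ρ) (hs : ρ ^ 2 ≤ s) :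
    0 < om ρ s ∧ om ρ s ≤ 2 * (√s)⁻¹ ∧ om ρ s ≤ 2 / ρ ∧ |deriv (om ρ) s| ≤ 2 / ρ ^ 3 := by
  have hs0 : 0 < s := lt_of_lt_of_le (by positivity) hs
  have hr : 0 < √s := Real.sqrt_pos.2 hs0
  have hρr : ρ ≤ √s := Real.le_sqrt_of_sq_le hs
  have hsq : s = √s ^ 2 := (Real.sq_sqrt hs0.le).symm
  have h1 : om ρ s ≤ 2 * (√s)⁻¹ := by
    have : ρ * s⁻¹ ≤ (√s)⁻¹ := by
      rw [← div_eq_mul_inv, ← one_div, div_le_div_iff₀ hs0 hr]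
      calc ρ * √s ≤ √s * √s := by gcongr
        _ = 1 * s := by rw [Real.mul_self_sqrt hs0.le, one_mul]
    unfold om; linarith
  refine ⟨by unfold om; positivity, h1, ?_, ?_⟩
  · refine h1.trans ?_
    rw [← div_eq_mul_inv]; gcongr
  · rw [om_deriv ρ hs0]
    have a1 : (√s ^ 3)⁻¹ ≤ (ρ ^ 3)⁻¹ := by gcongr
    have a2 : ρ * (s ^ 2)⁻¹ ≤ (ρ ^ 3)⁻¹ := by
      calc ρ * (s ^ 2)⁻¹ ≤ ρ * ((ρ ^ 2) ^ 2)⁻¹ := by gcongr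
        _ = (ρ ^ 3)⁻¹ := by field_simp
    have a3 : 0 < (√s ^ 3)⁻¹ := by positivity
    have a4 : 0 < ρ * (s ^ 2)⁻¹ := by positivity
    have a5 : 0 < (ρ ^ 3)⁻¹ := by positivity
    rw [abs_le, div_eq_mul_inv]
    constructor <;> linarith

/-- The equation for `ω h`. -/
theorem kappa_eq {ρ s1 s : ℝ} {P h : ℝ → ℝ} (hs1 : 0 < s1) (Rh : RadSol P s1 h) (hs : s1 < s) :
    4 * s * deriv (deriv (fun s => om ρ s * h s)) s + 8 * deriv (fun s => om ρ s * h s) s =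
      P s * (om ρ s * h s) - 4 * ρ * s⁻¹ * deriv h s - (√s ^ 3)⁻¹ * h s := by
  have hs0 : 0 < s := hs1.trans hs
  have hr : 0 < √s := Real.sqrt_pos.2 hs0
  have hsq : s = √s ^ 2 := (Real.sq_sqrt hs0.le).symm
  obtain ⟨e1, e2⟩ := deriv_mul_at (om_contDiffAt ρ hs0) (Rh.contDiffAt hs)
  have e3 := Rh.ode s hs
  have i1 : 8 * s * deriv (om ρ) s + 4 * om ρ s = - (4 * ρ * s⁻¹) := by
    rw [om_deriv ρ hs0]; unfold om
    generalize √s = r at hr hsq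
    subst hsq
    field_simp; ring
  have i2 : 4 * s * deriv (deriv (om ρ)) s + 8 * deriv (om ρ) s = - (√s ^ 3)⁻¹ := by
    rw [om_deriv ρ hs0, om_deriv2 ρ hs0]
    generalize √s = r at hr hsq
    subst hsq
    field_simp; ring
  rw [e1, e2]
  linear_combination (om ρ s) * e3 + h s * i2 + deriv h s * i1

/-- The cutoff terms. -/
theorem cut_bound {ρ θ s K q χ1 χ2 κ κ1 : ℝ} (hρ : 0 < ρ) (hθ : 0 < θ) (hθρ : θ ≤ ρ)
    (hs0 : 0 < s) (hs : s ≤ (ρ + 1) ^ 2) (hK : 0 < K) (hq : 0 < q) (h1 : |χ1| ≤ K / θ)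
    (h2 : |χ2| ≤ K / θ ^ 2) (hκ : |κ| ≤ 2 / ρ * q) (hκ1 : |κ1| ≤ 2 / ρ ^ 3 * q + 2 / ρ * (q / θ)) :
    |4 * s * χ2 * κ + 8 * s * χ1 * κ1 + 8 * χ1 * κ| ≤
      K * (8 * (ρ + 1) ^ 2 * (2 / ρ ^ 3 * ρ + 2 / ρ) + (4 * (ρ + 1) ^ 2 + 8 * ρ) * (2 / ρ)) * q / θ ^ 2 := by
  have b1 : |4 * s * χ2 * κ| ≤ 4 * (ρ + 1) ^ 2 * (K / θ ^ 2) * (2 / ρ * q) := by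
    rw [abs_mul, abs_mul, abs_of_pos (by positivity : 0 < 4 * s)]; gcongr
  have b2 : |8 * s * χ1 * κ1| ≤ 8 * (ρ + 1) ^ 2 * (K / θ) * (2 / ρ ^ 3 * q + 2 / ρ * (q / θ)) := by
    rw [abs_mul, abs_mul, abs_of_pos (by positivity : 0 < 8 * s)]; gcongr
  have b3 : |8 * χ1 * κ| ≤ 8 * (K / θ) * (2 / ρ * q) := by
    rw [abs_mul, abs_mul, abs_of_pos (by norm_num : (0:ℝ) < 8)]; gcongr
  have c1 : q ≤ ρ * q / θ := by rw [le_div_iff₀ hθ, mul_comm]; gcongr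
  have b2' : 8 * (ρ + 1) ^ 2 * (K / θ) * (2 / ρ ^ 3 * q + 2 / ρ * (q / θ)) ≤
     8 * (ρ + 1) ^ 2 * (K / θ) * (2 / ρ ^ 3 * (ρ * q / θ) + 2 / ρ * (q / θ)) := by gcongr
  have b3' : 8 * (K / θ) * (2 / ρ * q) ≤ 8 * (K / θ) * (2 / ρ * (ρ * q / θ)) := by gcongr
  have e : K * (8 * (ρ + 1) ^ 2 * (2 / ρ ^ 3 * ρ + 2 / ρ) + (4 * (ρ + 1) ^ 2 + 8 * ρ) * (2 / ρ)) * q / θ ^ 2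
     = 4 * (ρ + 1) ^ 2 * (K / θ ^ 2) * (2 / ρ * q) +
      8 * (ρ + 1) ^ 2 * (K / θ) * (2 / ρ ^ 3 * (ρ * q / θ) + 2 / ρ * (q / θ)) +
      8 * (K / θ) * (2 / ρ * (ρ * q / θ)) := by
    field_simp; ring
  rw [e]
  have t1 := abs_add_le (4 * s * χ2 * κ + 8 * s * χ1 * κ1) (8 * χ1 * κ)
  have t2 := abs_add_le (4 * s * χ2 * κ) (8 * s * χ1 * κ1)
  linarith

set_option maxHeartbeats 1000000 in
theorem zeta_exists {ρ θ ε a M k K s1 : ℝ} {P fr h : ℝ → ℝ} (hρ : 0 < ρ) (hθ : 0 < θ) (hθρ : θ ≤ ρ / 2)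
    (hs1 : s1 = ρ ^ 2 + θ) (hε : 0 < ε) (ha : 0 < a) (hM : 0 < M) (Rh : RadSol P s1 h)
    (hpos : ∀ s, s1 ≤ s → 0 < h s)
    (hd : ∀ s, s1 < s → 2 * √s * deriv h s ≤ -(k * h s))
    (hexp : ∀ s, s1 ≤ s → h s ≤ exp (-(k * (√s - √s1))))
    (hmono : ∀ s t, s1 < s → s ≤ t → s * deriv h s ≤ t * deriv h t)
    (hk : 2 / ρ ≤ k) (hK0 : 0 < K)
    (hK : ∀ x, |deriv Real.smoothTransition x| ≤ K ∧ |deriv (deriv Real.smoothTransition) x| ≤ K)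
    (fr0 : ∀ s, s1 ≤ s → 0 ≤ fr s)
    (N1 : 36 * M ^ 2 * ((ρ + 1) ^ 2 * exp (-(k * θ / (2 * (ρ + 1))))) ≤ ε ^ 2)
    (N2 : ∀ s, s1 ≤ s → s ≤ s1 + 3 * θ →
      C0 ρ M K * ε * exp (-(k * θ / (2 * (ρ + 1)))) / θ ^ 2 ≤ a * fr s) :
    ∃ ζ : ℝ → ℝ, ContinuousOn ζ (Ici s1) ∧ (∀ s, s1 < s → ContDiffAt ℝ 2 ζ s) ∧
      (∀ s, s1 ≤ s → 0 ≤ ζ s) ∧ (∀ s, s1 ≤ s → √s * ζ s ≤ 4 * M * h s) ∧ ζ s1 = 0 ∧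
      (∀ s, s1 < s → 0 < ζ s → (ε ^ 2 * P s + 18 * M ^ 2 * h s ^ 2) * ζ s - ε * a * fr s ≤
        ε ^ 2 * (4 * s * deriv (deriv ζ) s + 8 * deriv ζ s)) ∧
      ∀ s, s1 + 3 * θ ≤ s → ζ s = 2 * M * (om ρ s * h s) := by
  have hs1p : 0 < s1 := by rw [hs1]; positivity
  have hkp : 0 < k := lt_of_lt_of_le (by positivity) hk
  set q := exp (-(k * θ / (2 * (ρ + 1)))) with hq
  have hqp : 0 < q := Real.exp_pos _
  set s2 := s1 + 2 * θ with hs2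
  set κ : ℝ → ℝ := fun s => om ρ s * h s with hκ
  have hκd : ∀ s, s1 < s → ContDiffAt ℝ 2 κ s := fun s hs =>
    (om_contDiffAt ρ (hs1p.trans hs)).mul (Rh.contDiffAt hs)
  have hχ0 : ∀ s, 0 ≤ chi s2 θ s := fun s => Real.smoothTransition.nonneg _
  have hχ1 : ∀ s, chi s2 θ s ≤ 1 := fun s => Real.smoothTransition.le_one _
  have hκp : ∀ s, s1 ≤ s → 0 < κ s := fun s hs =>
    mul_pos (om_bounds hρ (by linarith)).1 (hpos s hs)
  refine ⟨fun s => 2 * M * (chi s2 θ s * κ s), ?_, ?_, ?_, ?_, ?_, ?_, ?_⟩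
  · refine continuousOn_const.mul ((chi_contDiff s2 θ).continuous.continuousOn.mul (ContinuousOn.mul ?_ Rh.cont))
    exact fun s hs => (om_contDiffAt ρ (hs1p.trans_le hs)).continuousAt.continuousWithinAt
  · intro s hs
    exact contDiffAt_const.mul ((chi_contDiff s2 θ).contDiffAt.mul (hκd s hs))
  · intro s hs
    exact mul_nonneg (by positivity) (mul_nonneg (hχ0 s) (hκp s hs).le)
  · intro s hs
    have hr : 0 < √s := Real.sqrt_pos.2 (hs1p.trans_le hs)
    have h1 := hpos s hs
    have h2 := (om_bounds hρ (by linarith : ρ ^ 2 ≤ s)).2.1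
    have h3 := hκp s hs
    calc √s * (2 * M * (chi s2 θ s * κ s)) ≤ √s * (2 * M * (1 * κ s)) := by gcongr; exact hχ1 s
      _ = √s * (2 * M * (om ρ s * h s)) := by simp only [hκ]; ring
      _ ≤ √s * (2 * M * (2 * (√s)⁻¹ * h s)) := by gcongr
      _ = 4 * M * h s := by field_simp; ring
  · simp only []
    rw [chi_zero hθ (by linarith)]; ring
  · intro s hs hζ
    have hs2' : s2 < s := by
      by_contra hc
      have hζ : 0 < 2 * M * (chi s2 θ s * κ s) := hζ
      rw [chi_zero hθ (not_lt.1 hc)] at hζ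
      simp at hζ
    have hs0 : 0 < s := hs1p.trans hs
    have hr : 0 < √s := Real.sqrt_pos.2 hs0
    have hsq : √s ^ 2 = s := Real.sq_sqrt hs0.le
    have hρs : ρ ^ 2 ≤ s := by linarith
    have hh := hpos s hs.le
    obtain ⟨o0, o1, o2, o3⟩ := om_bounds hρ hρs
    obtain ⟨d1, d2⟩ := deriv_mul_at ((chi_contDiff s2 θ).contDiffAt (x := s)) (hκd s hs)
    have D1 : deriv (fun s => 2 * M * (chi s2 θ s * κ s)) = fun s => 2 * M * deriv (fun s => chi s2 θ s * κ s) s := by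
      ext t; exact deriv_const_mul_field _
    have D2 : deriv (fun s => 2 * M * deriv (fun s => chi s2 θ s * κ s) s) s
      = 2 * M * deriv (deriv (fun s => chi s2 θ s * κ s)) s := deriv_const_mul_field _
    rw [D1, D2]
    simp only []
    rw [d1, d2]
    have hke := kappa_eq (ρ := ρ) hs1p Rh hs
    have hdh := hd s hs
    have hneg : deriv h s ≤ 0 := by
      have : 0 < k * h s := by positivity
      by_contra hc
      push Not at hc
      have : 0 < 2 * √s * deriv h s := by positivity
      linarith
    -- E2
    have E2' : P s * κ s + (2 * ρ * k - 1) * ((√s ^ 3)⁻¹ * h s) ≤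
        4 * s * deriv (deriv κ) s + 8 * deriv κ s := by
      rw [hke]
      have h1 : 2 * ρ * k * ((√s ^ 3)⁻¹ * h s) ≤ - (4 * ρ * s⁻¹ * deriv h s) := by
        have h2 := mul_le_mul_of_nonneg_left hdh (by positivity : 0 ≤ 2 * ρ * (√s ^ 3)⁻¹)
        have h3 : 2 * ρ * (√s ^ 3)⁻¹ * (2 * √s * deriv h s) = 4 * ρ * s⁻¹ * deriv h s := by
          rw [← hsq]; simp only [Real.sqrt_sq hr.le]; field_simp; ring
        rw [h3] at h2
        linarith
      simp only [hκ]
      linarith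
    have hkρ : 2 ≤ k * ρ := (div_le_iff₀ hρ).1 hk
    -- E3
    have E3 : 18 * M ^ 2 * h s ^ 2 * κ s ≤ ε ^ 2 * ((2 * ρ * k - 1) * ((√s ^ 3)⁻¹ * h s)) := by
      have g1 := sh_sq hρ hθ hθρ hs1 (by linarith : s1 + θ ≤ s) hk hh (hexp s hs.le)
      have g2 : κ s ≤ 2 * (√s)⁻¹ * h s := by simp only [hκ]; gcongr
      have g3 : 0 < (√s ^ 3)⁻¹ * h s := by positivity
      calc 18 * M ^ 2 * h s ^ 2 * κ s ≤ 18 * M ^ 2 * h s ^ 2 * (2 * (√s)⁻¹ * h s) := by gcongr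
        _ = 36 * M ^ 2 * (√s ^ 2 * h s ^ 2) * ((√s ^ 3)⁻¹ * h s) := by field_simp; ring
        _ ≤ 36 * M ^ 2 * ((ρ + 1) ^ 2 * q) * ((√s ^ 3)⁻¹ * h s) := by rw [hsq]; gcongr
        _ ≤ ε ^ 2 * ((√s ^ 3)⁻¹ * h s) := by gcongr
        _ ≤ ε ^ 2 * ((2 * ρ * k - 1) * ((√s ^ 3)⁻¹ * h s)) := by
          have : 1 ≤ 2 * ρ * k - 1 := by linarith
          have := mul_le_mul_of_nonneg_right this g3.le
          rw [one_mul] at this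
          exact mul_le_mul_of_nonneg_left this (sq_nonneg ε)
    -- E4
    have E4 : - (ε * a * fr s) ≤ ε ^ 2 * (2 * M * (4 * s * deriv (deriv (chi s2 θ)) s * κ s
        + 8 * s * deriv (chi s2 θ) s * deriv κ s + 8 * deriv (chi s2 θ) s * κ s)) := by
      rcases lt_or_ge (s2 + θ) s with hs3 | hs3
      · obtain ⟨z1, z2⟩ := chi_deriv_zero hθ hs3
        rw [z1, z2]
        have := fr0 s hs.le
        have : 0 ≤ ε * a * fr s := by positivity
        simpa using this
      · have hsS : s ≤ (ρ + 1) ^ 2 := by nlinarith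
        have hhq := h_le_q hρ hθ hθρ hs1 (by linarith : s1 + θ ≤ s) hkp (hexp s hs.le)
        have hhq2 := h_le_q hρ hθ hθρ hs1 (by linarith : s1 + θ ≤ s - θ) hkp (hexp (s - θ) (by linarith))
        have hh' := h_deriv_le hs1p hθ Rh (by linarith : s1 < s - θ) hpos hneg hmono
        have b1 : |deriv (chi s2 θ) s| ≤ K / θ := by
          rw [chi_deriv, abs_div, abs_of_pos hθ]; gcongr; exact (hK _).1
        have b2 : |deriv (deriv (chi s2 θ)) s| ≤ K / θ ^ 2 := by
          rw [chi_deriv2, abs_div, abs_of_pos (pow_pos hθ 2)]; gcongr; exact (hK _).2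
        have b3 : |κ s| ≤ 2 / ρ * q := by
          rw [abs_of_pos (hκp s hs.le)]; simp only [hκ]; gcongr
        have b4 : |deriv κ s| ≤ 2 / ρ ^ 3 * q + 2 / ρ * (q / θ) := by
          rw [show deriv κ s = deriv (om ρ) s * h s + om ρ s * deriv h s from
            (deriv_mul_at (om_contDiffAt ρ hs0) (Rh.contDiffAt hs)).1]
          refine (abs_add_le _ _).trans ?_
          have u1 : |deriv (om ρ) s * h s| ≤ 2 / ρ ^ 3 * q := by
            rw [abs_mul, abs_of_pos hh]; gcongr
          have u2 : |om ρ s * deriv h s| ≤ 2 / ρ * (q / θ) := by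
            rw [abs_mul, abs_of_pos o0, abs_of_nonpos hneg]
            have : h (s - θ) / θ ≤ q / θ := by gcongr
            have h3 : - deriv h s ≤ q / θ := hh'.trans this
            have h4 : 0 ≤ - deriv h s := by linarith
            gcongr
          linarith
        have cb := (abs_le.1 (cut_bound hρ hθ (by linarith) hs0 hsS hK0 hqp b1 b2 b3 b4)).1
        have n2 := N2 s hs.le (by linarith)
        have c1 := mul_le_mul_of_nonneg_left cb (by positivity : 0 ≤ ε ^ 2 * (2 * M))
        have c2 := mul_le_mul_of_nonneg_left n2 hε.le
        unfold C0 at c2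
        have c3 : ε * (2 * M * (K * (8 * (ρ + 1) ^ 2 * (2 / ρ ^ 3 * ρ + 2 / ρ) + (4 * (ρ + 1) ^ 2 + 8 * ρ) * (2 / ρ))) * ε * q / θ ^ 2)
          = ε ^ 2 * (2 * M) * (K * (8 * (ρ + 1) ^ 2 * (2 / ρ ^ 3 * ρ + 2 / ρ) + (4 * (ρ + 1) ^ 2 + 8 * ρ) * (2 / ρ)) * q / θ ^ 2) := by
          ring
        rw [c3] at c2
        linarith
    have F1 := mul_le_mul_of_nonneg_left E2' (by positivity : 0 ≤ ε ^ 2 * (2 * M))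
    have hF : ε ^ 2 * (P s * κ s) + 18 * M ^ 2 * h s ^ 2 * κ s ≤
        ε ^ 2 * (4 * s * deriv (deriv κ) s + 8 * deriv κ s) := by
      have := mul_le_mul_of_nonneg_left E2' (sq_nonneg ε)
      linarith
    have F2 := mul_le_mul_of_nonneg_left hF (mul_nonneg (by positivity : 0 ≤ 2 * M) (hχ0 s))
    linarith
  · intro s hs
    simp only []
    rw [chi_one hθ (by linarith), one_mul]

set_option maxHeartbeats 1000000 in
theorem pos_outside {μ : E2 → ℝ} {μrad : ℝ → ℝ} {ρ : ℝ} {f : E2 → E2} {frad : ℝ → ℝ}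
    (hμ : MuHyp μ μrad ρ) (hf : FHyp f frad) {ε a Cμ Cf A M c1 f0 K θ : ℝ} {v : E2 → E2}
    (hv : IsMinimizer ε a μ f v) (hε : 0 < ε) (hε1 : ε ≤ 1) (ha : 0 < a)
    (hCμ : ∀ x, |μ x| ≤ Cμ) (hCf : ∀ x, ‖f x‖ ≤ Cf) (hA : |ε * a| ≤ A) (hM : 0 < M) (hM2 : Cμ ≤ M ^ 2)
    (hM3 : Cμ * M + A * Cf ≤ M ^ 3) (hθ : 0 < θ) (hθρ : θ ≤ ρ / 2) (hc1 : 0 < c1)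
    (hc : ∀ s, ρ ^ 2 + θ ≤ s → c1 * θ ≤ - μrad √s)
    (hf0 : ∀ s, ρ ^ 2 ≤ s → s ≤ (ρ + 1) ^ 2 → f0 ≤ frad √s / √s)
    (hK0 : 0 < K)
    (hK : ∀ x, |deriv Real.smoothTransition x| ≤ K ∧ |deriv (deriv Real.smoothTransition) x| ≤ K)
    (hk : 2 / ρ ≤ √(c1 * θ) / ε)
    (N1 : 36 * M ^ 2 * ((ρ + 1) ^ 2 * exp (-(√(c1 * θ) / ε * θ / (2 * (ρ + 1))))) ≤ ε ^ 2)
    (N2 : C0 ρ M K * ε * exp (-(√(c1 * θ) / ε * θ / (2 * (ρ + 1)))) / θ ^ 2 ≤ a * f0)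
    {x : E2} (hx : ρ ^ 2 + 4 * θ ≤ ‖x‖ ^ 2) : 0 < inner ℝ x (v x) := by
  have hρ := hμ.rho_pos
  set s1 := ρ ^ 2 + θ with hs1
  have hs1p : 0 < s1 := by positivity
  set k := √(c1 * θ) / ε with hkdef
  have hkp : 0 < k := lt_of_lt_of_le (by positivity) hk
  let P : ℝ → ℝ := fun s => - μrad √s / ε ^ 2
  let fr : ℝ → ℝ := fun s => frad √s / √s
  have hk2 : k ^ 2 = c1 * θ / ε ^ 2 := by
    rw [hkdef, div_pow, Real.sq_sqrt (by positivity)]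
  have hkP : ∀ s, s1 ≤ s → k ^ 2 ≤ P s := by
    intro s hs; rw [hk2]; simp only [P]; gcongr; exact hc s hs
  have hPC : ∀ s, s1 ≤ s → P s ≤ Cμ / ε ^ 2 := by
    intro s hs
    have h1 := hCμ (√s • e2basis 0)
    rw [hμ.radial, norm_smul, norm_e2basis, mul_one, Real.norm_eq_abs, abs_of_nonneg (Real.sqrt_nonneg s)] at h1
    simp only [P]; gcongr; linarith [(abs_le.1 h1).1]
  have hPc : ContinuousOn P (Ici s1) := by
    have : Continuous P := ((hμ.smooth_rad.continuous.comp Real.continuous_sqrt).neg).div_const _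
    exact this.continuousOn
  obtain ⟨G, h, RG, Rh, G1, Gtop, h1, hpos, hd, hexp, hmono⟩ :=
    decaying_exists s1 hs1p P hPc k hkp (Cμ / ε ^ 2) hkP hPC
  have hvs : VSol ε a μ f v := by
    intro e
    refine weakSol_of_min hε ha hμ.smooth.continuous (hf.smooth.of_le (by exact_mod_cast le_top)) (e2basis 0) ?_ hv e
    have hne : e2basis 0 ≠ 0 := by
      intro h0; have := norm_e2basis 0; rw [h0, norm_zero] at this; norm_num at this
    rw [hf.radial _ hne, norm_e2basis]
    have := hf.pos_rad 1 one_pos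
    exact smul_ne_zero (by positivity) hne
  have hvc : Continuous v := hv.1.1.continuous
  have frp : ∀ s, s1 ≤ s → 0 ≤ fr s := by
    intro s hs
    have hr : 0 < √s := Real.sqrt_pos.2 (hs1p.trans_le hs)
    have := hf.pos_rad _ hr
    simp only [fr]; positivity
  have C : Ctx ε a M s1 P fr μ f v G h := {
    hε := hε
    ha := ha
    hM := hM
    hs1 := hs1p
    vs := hvs
    vc := hvc
    vb := fun x => bound_M hε hε1 hCμ hCf hA hM hM2 hM3 hvc hvs x
    hμ := by
      intro x hx
      simp only [P]
      rw [hμ.radial, Real.sqrt_sq (norm_nonneg x)]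
      field_simp
    hf := by
      intro x hx
      have hne : x ≠ 0 := by
        rintro rfl; rw [norm_zero] at hx; norm_num at hx; linarith
      simp only [fr]
      rw [hf.radial x hne, Real.sqrt_sq (norm_nonneg x)]
    fr0 := frp
    Ppos := fun s hs => lt_of_lt_of_le (by positivity) (hkP s hs)
    RG := RG
    Rh := Rh
    G1 := G1
    Gtop := Gtop
    h1 := h1
    hpos := hpos }
  obtain ⟨ζ, ζc, ζd, ζ0, ζb, ζ1, Z, ζ3⟩ := zeta_exists (fr := fr) hρ hθ hθρ hs1 hε ha hM Rh hpos hd hexp hmono hk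
    hK0 hK frp N1 (by
      intro s h1 h2
      refine N2.trans ?_
      have := hf0 s (by linarith) (by nlinarith)
      gcongr)
  have hle : ∀ s, s1 ≤ s → h s ≤ 1 := by
    intro s hs
    refine (hexp s hs).trans (Real.exp_le_one_iff.2 ?_)
    have : √s1 ≤ √s := Real.sqrt_le_sqrt hs
    have := mul_nonneg hkp.le (sub_nonneg.2 this)
    linarith
  have hxs : s1 ≤ ‖x‖ ^ 2 := by linarith
  have hny : 0 < ‖x‖ := by
    rcases (norm_nonneg x).lt_or_eq with h | h
    · exact h
    · rw [← h] at hxs; norm_num at hxs; linarith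
  set u : E2 := (‖x‖)⁻¹ • x with hu
  have hun : ‖u‖ = 1 := by rw [hu, norm_smul, norm_inv, norm_norm, inv_mul_cancel₀ hny.ne']
  have hux : inner ℝ u x = ‖x‖ := by
    rw [hu, real_inner_smul_left, real_inner_self_eq_norm_sq]; field_simp
  have key := C.step4 hle ζc ζd ζ0 ζb ζ1 Z hun hxs (by rw [hux]; exact hny.le)
  rw [ζ3 _ (by linarith), hux] at key
  have hh := hpos _ hxs
  have h5 : M * h (‖x‖ ^ 2) ≤ ‖x‖ * (2 * M * (om ρ (‖x‖ ^ 2) * h (‖x‖ ^ 2))) - M * h (‖x‖ ^ 2) := by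
    unfold om
    rw [Real.sqrt_sq hny.le]
    have : ‖x‖ * (2 * M * ((‖x‖⁻¹ + ρ * (‖x‖ ^ 2)⁻¹) * h (‖x‖ ^ 2))) = 2 * M * h (‖x‖ ^ 2) +
      2 * M * h (‖x‖ ^ 2) * (ρ * (‖x‖)⁻¹) := by field_simp
    rw [this]
    have : 0 < 2 * M * h (‖x‖ ^ 2) * (ρ * (‖x‖)⁻¹) := by positivity
    linarith
  have h6 : 0 < M * h (‖x‖ ^ 2) := by positivity
  have h7 : 0 < inner ℝ u (v x) := by linarith
  rw [hu, real_inner_smul_left] at h7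
  exact pos_of_mul_pos_right h7 (by positivity)

theorem mu_lower {μ : E2 → ℝ} {μrad : ℝ → ℝ} {ρ : ℝ} (hμ : MuHyp μ μrad ρ) :
    ∃ c1 : ℝ, 0 < c1 ∧ ∀ θ, 0 < θ → θ ≤ ρ / 2 → ∀ s, ρ ^ 2 + θ ≤ s → c1 * θ ≤ - μrad √s := by
  have hρ := hμ.rho_pos
  have hdiff : Differentiable ℝ μrad := hμ.smooth_rad.differentiable (by simp)
  have hcd : Continuous (deriv μrad) := hμ.smooth_rad.continuous_deriv (by exact_mod_cast le_top)
  obtain ⟨r0, hr0, hmax⟩ := isCompact_Icc.exists_isMaxOn (s := Icc ρ (ρ + 1)) ⟨ρ, by simp⟩ hcd.continuousOn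
  have hc0 : deriv μrad r0 < 0 := hμ.deriv_neg r0 (by linarith [hr0.1])
  set c0 := - deriv μrad r0 with hc0d
  have hc0p : 0 < c0 := by rw [hc0d]; linarith
  refine ⟨c0 / (2 * ρ + 1), by positivity, ?_⟩
  intro θ hθ hθρ s hs
  have hanti : StrictAntiOn μrad (Ioi 0) := by
    refine strictAntiOn_of_deriv_neg (convex_Ioi 0) hμ.smooth_rad.continuous.continuousOn ?_
    intro x hx; rw [interior_Ioi] at hx; exact hμ.deriv_neg x hx
  set r := √(ρ ^ 2 + θ) with hr
  have hrs : r ≤ √s := Real.sqrt_le_sqrt hs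
  have hr2 : r ^ 2 = ρ ^ 2 + θ := Real.sq_sqrt (by positivity)
  have hρr : ρ < r := by
    rw [hr]; exact Real.lt_sqrt_of_sq_lt (by linarith)
  have hr1 : r ≤ ρ + 1 := by
    rw [hr, Real.sqrt_le_left (by linarith)]; nlinarith
  have h1 : μrad √s ≤ μrad r := hanti.antitoneOn (show 0 < r by linarith) (show 0 < √s by linarith) hrs
  obtain ⟨t, ht, hte⟩ := exists_deriv_eq_slope μrad hρr hdiff.continuous.continuousOn hdiff.differentiableOn
  have h2 : deriv μrad t ≤ - c0 := by
    have := hmax (show t ∈ Icc ρ (ρ + 1) from ⟨ht.1.le, by linarith [ht.2]⟩)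
    simp only [Set.mem_ofPred_eq] at this
    rw [hc0d]; linarith
  rw [hte, hμ.rho_root, div_le_iff₀ (by linarith)] at h2
  have h3 : θ / (2 * ρ + 1) ≤ r - ρ := by
    rw [div_le_iff₀ (by positivity)]; nlinarith
  have h4 := mul_le_mul_of_nonneg_left h3 hc0p.le
  calc c0 / (2 * ρ + 1) * θ = c0 * (θ / (2 * ρ + 1)) := by ring
    _ ≤ c0 * (r - ρ) := h4
    _ ≤ - μrad √s := by linarith

theorem f_lower {f : E2 → E2} {frad : ℝ → ℝ} (hf : FHyp f frad) {ρ : ℝ} (hρ : 0 < ρ) :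
    ∃ f0 : ℝ, 0 < f0 ∧ ∀ s, ρ ^ 2 ≤ s → s ≤ (ρ + 1) ^ 2 → f0 ≤ frad √s / √s := by
  have hcont : ContinuousOn (fun r => frad r / r) (Icc ρ (ρ + 1)) :=
    hf.smooth_rad.continuous.continuousOn.div continuousOn_id fun r hr =>
      (lt_of_lt_of_le hρ hr.1).ne'
  obtain ⟨r0, hr0, hmin⟩ := isCompact_Icc.exists_isMinOn (s := Icc ρ (ρ + 1)) ⟨ρ, by simp⟩ hcont
  have hr0p : 0 < r0 := by linarith [hr0.1]
  refine ⟨frad r0 / r0, div_pos (hf.pos_rad r0 hr0p) hr0p, fun s h1 h2 => ?_⟩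
  exact hmin ⟨Real.le_sqrt_of_sq_le h1, by rw [Real.sqrt_le_left (by linarith)]; exact h2⟩

theorem rpow_exp_zero {q D : ℝ} (hq : 0 < q) (hD : 0 < D) (p : ℝ) :
    Tendsto (fun ε : ℝ => ε ^ p * exp (-(D * ε ^ (-q)))) (𝓝[>] 0) (𝓝 0) := by
  have h1 : Tendsto (fun ε : ℝ => ε ^ (-q)) (𝓝[>] 0) atTop := tendsto_rpow_neg_nhdsGT_zero (by linarith)
  have h2 := (tendsto_rpow_mul_exp_neg_mul_atTop_nhds_zero (-p / q) D hD).comp h1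
  refine h2.congr' ?_
  filter_upwards [self_mem_nhdsWithin] with ε hε
  have hε : 0 < ε := hε
  simp only [Function.comp]
  rw [← Real.rpow_mul hε.le]
  congr 2
  · field_simp
  · ring

set_option maxHeartbeats 1000000 in
theorem claim_C {μ : E2 → ℝ} {μrad : ℝ → ℝ} {ρ : ℝ} {f : E2 → E2} {frad : ℝ → ℝ}
    (hμ : MuHyp μ μrad ρ) (hf : FHyp f frad)
    (a : ℝ → ℝ) (hapos : ∀ ε : ℝ, 0 < ε → 0 < a ε)
    (haB : ∃ C : ℝ, ∀ ε : ℝ, 0 < ε → a ε ≤ C)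
    (γ : ℝ) (hγ0 : 0 ≤ γ) (hγ1 : γ < 2/3)
    (hloga : Tendsto (fun ε : ℝ => ε^(1 - 3*γ/2) * Real.log (a ε)) (𝓝[>] (0:ℝ)) (𝓝 0))
    (v : ℝ → E2 → E2) (hv : ∀ ε : ℝ, 0 < ε → IsMinimizer ε (a ε) μ f (v ε))
    (κ : ℝ) (hκ : 0 < κ) (hκ1 : κ ≤ 1) :
    ∀ᶠ ε in 𝓝[>] (0:ℝ), ∀ x : E2, ρ + κ * ε ^ γ ≤ ‖x‖ → 0 < inner ℝ x (v ε x) := by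
  have hρ := hμ.rho_pos
  obtain ⟨c1, hc1, hc⟩ := mu_lower hμ
  obtain ⟨f0, hf0p, hf0⟩ := f_lower hf hρ
  obtain ⟨K, hK0, hK⟩ := smoothTransition_bounds
  obtain ⟨Cμ, hCμ⟩ := hμ.bdd
  obtain ⟨Cf, hCf⟩ := hf.bdd
  obtain ⟨A, hA⟩ := haB
  have hCμ0 : 0 ≤ Cμ := (abs_nonneg _).trans (hCμ 0)
  have hCf0 : 0 ≤ Cf := (norm_nonneg _).trans (hCf 0)
  have hA0 : 0 < A := (hapos 1 one_pos).trans_le (hA 1 one_pos)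
  set M := 1 + Cμ + A * Cf with hMd
  have hACf : 0 ≤ A * Cf := by positivity
  have hM1 : 1 ≤ M := by rw [hMd]; linarith
  have hM : 0 < M := by linarith
  have hM2 : Cμ ≤ M ^ 2 := by nlinarith
  have hM3 : Cμ * M + A * Cf ≤ M ^ 3 := by
    have h1 : A * Cf ≤ A * Cf * M := le_mul_of_one_le_right hACf hM1
    have h2 : (Cμ + A * Cf) * M ≤ M * M := mul_le_mul_of_nonneg_right (by rw [hMd]; linarith) hM.le
    have h3 : M * M * 1 ≤ M * M * M := mul_le_mul_of_nonneg_left hM1 (by positivity)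
    nlinarith
  set q := 1 - 3 * γ / 2 with hq
  have hqp : 0 < q := by rw [hq]; linarith
  set b := ρ * κ / 2 with hb
  have hbp : 0 < b := by positivity
  set d := √(c1 * b) with hd
  have hdp : 0 < d := Real.sqrt_pos.2 (by positivity)
  set D := d * b / (2 * (ρ + 1)) with hD
  have hDp : 0 < D := by positivity
  have hC0 : 0 < C0 ρ M K := by unfold C0; positivity
  -- eventual conditions
  have ev1 : ∀ᶠ ε in 𝓝[>] (0:ℝ), 2 / ρ ≤ d * ε ^ (γ / 2 - 1) := by
    have h1 : Tendsto (fun ε : ℝ => d * ε ^ (γ / 2 - 1)) (𝓝[>] 0) atTop :=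
      (tendsto_rpow_neg_nhdsGT_zero (by linarith)).const_mul_atTop hdp
    exact h1.eventually_ge_atTop _
  have ev2 : ∀ᶠ ε in 𝓝[>] (0:ℝ), 36 * M ^ 2 * (ρ + 1) ^ 2 * (ε ^ (-2:ℝ) * exp (-(D * ε ^ (-q)))) < 1 := by
    have := (rpow_exp_zero hqp hDp (-2)).const_mul (36 * M ^ 2 * (ρ + 1) ^ 2)
    rw [mul_zero] at this
    exact this.eventually (gt_mem_nhds one_pos)
  have ev3 : ∀ᶠ ε in 𝓝[>] (0:ℝ), C0 ρ M K / b ^ 2 * (ε ^ (1 - 2 * γ) * exp (-(D / 2 * ε ^ (-q)))) < f0 := by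
    have := (rpow_exp_zero hqp (half_pos hDp) (1 - 2 * γ)).const_mul (C0 ρ M K / b ^ 2)
    rw [mul_zero] at this
    exact this.eventually (gt_mem_nhds hf0p)
  have ev4 : ∀ᶠ ε in 𝓝[>] (0:ℝ), - (D / 2) < ε ^ q * Real.log (a ε) :=
    hloga.eventually (lt_mem_nhds (by linarith))
  have ev5 : ∀ᶠ ε in 𝓝[>] (0:ℝ), ε < 1 := nhdsWithin_le_nhds (gt_mem_nhds one_pos)
  filter_upwards [ev1, ev2, ev3, ev4, ev5, self_mem_nhdsWithin] with ε h1 h2 h3 h4 h5 hε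
  have hε : 0 < ε := hε
  intro x hx
  have hτ0 : 0 < ε ^ γ := Real.rpow_pos_of_pos hε γ
  have hτ1 : ε ^ γ ≤ 1 := Real.rpow_le_one hε.le h5.le hγ0
  set θ := b * ε ^ γ with hθ
  have hθp : 0 < θ := by positivity
  have hκτ : κ * ε ^ γ ≤ 1 := by nlinarith
  have hθρ : θ ≤ ρ / 2 := by
    have : θ = ρ / 2 * (κ * ε ^ γ) := by rw [hθ, hb]; ring
    rw [this]; nlinarith
  have hk : √(c1 * θ) / ε = d * ε ^ (γ / 2 - 1) := by
    rw [hθ, ← mul_assoc, Real.sqrt_mul (by positivity), Real.sqrt_eq_rpow (ε ^ γ), ← Real.rpow_mul hε.le,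
      Real.rpow_sub_one hε.ne', hd]
    rw [show γ * (1 / 2) = γ / 2 by ring]
    ring
  have hkθ : √(c1 * θ) / ε * θ / (2 * (ρ + 1)) = D * ε ^ (-q) := by
    rw [hk, hθ, hD]
    have : ε ^ (-q) = ε ^ (γ / 2 - 1) * ε ^ γ := by
      rw [← Real.rpow_add hε]; congr 1; rw [hq]; ring
    rw [this]; ring
  have hae := hapos ε hε
  refine pos_outside hμ hf (hv ε hε) hε h5.le hae hCμ hCf (A := A) ?_ hM hM2 hM3 hθp hθρ hc1
    (hc θ hθp hθρ) hf0 hK0 hK (by rw [hk]; exact h1) ?_ ?_ ?_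
  · rw [abs_of_pos (by positivity)]
    have := hA ε hε
    nlinarith
  · rw [hkθ]
    have e1 : ε ^ (-2:ℝ) = (ε ^ 2)⁻¹ := by
      rw [Real.rpow_neg hε.le]; norm_cast
    rw [e1] at h2
    have h6 := mul_le_mul_of_nonneg_left h2.le (sq_nonneg ε)
    calc 36 * M ^ 2 * ((ρ + 1) ^ 2 * exp (-(D * ε ^ (-q))))
        = ε ^ 2 * (36 * M ^ 2 * (ρ + 1) ^ 2 * ((ε ^ 2)⁻¹ * exp (-(D * ε ^ (-q))))) := by field_simp
      _ ≤ ε ^ 2 * 1 := h6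
      _ = ε ^ 2 := mul_one _
  · rw [hkθ]
    have ha2 : exp (-(D / 2 * ε ^ (-q))) ≤ a ε := by
      rw [← Real.le_log_iff_exp_le hae]
      have hεq : 0 < ε ^ q := Real.rpow_pos_of_pos hε q
      rw [Real.rpow_neg hε.le]
      have : - (D / 2 * (ε ^ q)⁻¹) = (ε ^ q)⁻¹ * (- (D / 2)) := by ring
      rw [this, inv_mul_le_iff₀ hεq]
      exact h4.le
    have e2 : ε ^ (1 - 2 * γ) = ε / (ε ^ γ) ^ 2 := by
      rw [Real.rpow_sub hε, Real.rpow_one, mul_comm, Real.rpow_mul hε.le]; norm_cast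
    have e3 : exp (-(D * ε ^ (-q))) = exp (-(D / 2 * ε ^ (-q))) * exp (-(D / 2 * ε ^ (-q))) := by
      rw [← Real.exp_add]; congr 1; ring
    rw [e2] at h3
    set X := exp (-(D / 2 * ε ^ (-q))) with hX
    have hX0 : 0 < X := Real.exp_pos _
    rw [e3]
    calc C0 ρ M K * ε * (X * X) / θ ^ 2 = X * (C0 ρ M K / b ^ 2 * (ε / (ε ^ γ) ^ 2 * X)) := by
          rw [hθ]; field_simp
      _ ≤ X * f0 := by gcongr
      _ ≤ a ε * f0 := by gcongr
  · have hτ : 4 * θ = 2 * ρ * (κ * ε ^ γ) := by rw [hθ, hb]; ring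
    have hp : 0 < κ * ε ^ γ := by positivity
    rw [hτ]
    calc ρ ^ 2 + 2 * ρ * (κ * ε ^ γ) ≤ (ρ + κ * ε ^ γ) ^ 2 := by nlinarith
      _ ≤ ‖x‖ ^ 2 := by gcongr

/-- existence of a zero `x̄_ε` of the global minimizer with
`|x̄_ε| ≤ ρ + o(ε^γ)`; any sequence of zeros either satisfies this estimate
or diverges to `∞`. -/
theorem statement4
    (μ : E2 → ℝ) (μrad : ℝ → ℝ) (ρ : ℝ) (f : E2 → E2) (frad : ℝ → ℝ)
    (hμ : MuHyp μ μrad ρ) (hf : FHyp f frad)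
    (a : ℝ → ℝ) (hapos : ∀ ε : ℝ, 0 < ε → 0 < a ε)
    (haB : ∃ C : ℝ, ∀ ε : ℝ, 0 < ε → a ε ≤ C)
    (γ : ℝ) (hγ0 : 0 ≤ γ) (hγ1 : γ < 2/3)
    (hloga : Tendsto (fun ε : ℝ => ε^(1 - 3*γ/2) * Real.log (a ε)) (𝓝[>] (0:ℝ)) (𝓝 0))
    (v : ℝ → E2 → E2) (hv : ∀ ε : ℝ, 0 < ε → IsMinimizer ε (a ε) μ f (v ε)) :
    (∃ xb : ℝ → E2, (∀ᶠ ε in 𝓝[>] (0:ℝ), v ε (xb ε) = 0) ∧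
      Tendsto (fun ε : ℝ => max (‖xb ε‖ - ρ) 0 / ε^γ) (𝓝[>] (0:ℝ)) (𝓝 0)) ∧
    (∀ (εs : ℕ → ℝ) (xs : ℕ → E2), (∀ n, 0 < εs n) → Tendsto εs atTop (𝓝 (0:ℝ)) →
      (∀ n, v (εs n) (xs n) = 0) →
      (Tendsto (fun n => max (‖xs n‖ - ρ) 0 / (εs n)^γ) atTop (𝓝 0)) ∨
      Tendsto (fun n => ‖xs n‖) atTop atTop) := by
  have hzero : ∀ κ : ℝ, 0 < κ → ∀ᶠ ε in 𝓝[>] (0:ℝ), ∀ x : E2, v ε x = 0 →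
      max (‖x‖ - ρ) 0 / ε ^ γ < κ := by
    intro κ hκ
    have hm : 0 < min (κ / 2) 1 := lt_min (by linarith) one_pos
    filter_upwards [claim_C hμ hf a hapos haB γ hγ0 hγ1 hloga v hv _ hm (min_le_right _ _),
      self_mem_nhdsWithin] with ε hε hε0 x hx
    have hp : 0 < ε ^ γ := Real.rpow_pos_of_pos hε0 γ
    have h1 : ‖x‖ < ρ + min (κ / 2) 1 * ε ^ γ := by
      by_contra hcon
      have h2 := hε x (not_lt.mp hcon)
      rw [hx, inner_zero_right] at h2
      exact lt_irrefl _ h2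
    have h3 : min (κ / 2) 1 * ε ^ γ ≤ κ / 2 * ε ^ γ :=
      mul_le_mul_of_nonneg_right (min_le_left _ _) hp.le
    have h4 : κ / 2 * ε ^ γ < κ * ε ^ γ := mul_lt_mul_of_pos_right (by linarith) hp
    rw [div_lt_iff₀ hp]
    exact max_lt (by linarith) (mul_pos hκ hp)
  have hnn : ∀ ε : ℝ, 0 < ε → ∀ x : E2, 0 ≤ max (‖x‖ - ρ) 0 / ε ^ γ := fun ε hε x =>
    div_nonneg (le_max_right _ _) (Real.rpow_pos_of_pos hε γ).le
  constructor
  · classical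
    have hex : ∀ᶠ ε in 𝓝[>] (0:ℝ), ∃ x, v ε x = 0 := by
      filter_upwards [claim_C hμ hf a hapos haB γ hγ0 hγ1 hloga v hv 1 one_pos le_rfl,
        self_mem_nhdsWithin] with ε hε hε0
      have hp : 0 < ε ^ γ := Real.rpow_pos_of_pos hε0 γ
      have hρ := hμ.rho_pos
      exact topo (hv ε hε0).1.1.continuous (R := ρ + 1 * ε ^ γ) (by linarith)
        fun x hx => hε x hx.ge
    have hxb : ∀ᶠ ε in 𝓝[>] (0:ℝ),
        v ε ((fun ε => if h : ∃ x, v ε x = 0 then h.choose else 0) ε) = 0 := by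
      filter_upwards [hex] with ε hε
      simp only [dif_pos hε]
      exact hε.choose_spec
    refine ⟨fun ε => if h : ∃ x, v ε x = 0 then h.choose else 0, hxb, ?_⟩
    rw [Metric.tendsto_nhds]
    intro κ hκ
    filter_upwards [hxb, hzero κ hκ, self_mem_nhdsWithin] with ε h1 h2 h3
    rw [Real.dist_0_eq_abs, abs_of_nonneg (hnn ε h3 _)]
    exact h2 _ h1
  · intro εs xs hpos hlim hz
    left
    have hw : Tendsto εs atTop (𝓝[>] (0:ℝ)) :=
      tendsto_nhdsWithin_iff.mpr ⟨hlim, Eventually.of_forall hpos⟩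
    rw [Metric.tendsto_nhds]
    intro κ hκ
    filter_upwards [hw.eventually (hzero κ hκ)] with n h2
    rw [Real.dist_0_eq_abs, abs_of_nonneg (hnn _ (hpos n) _)]
    exact h2 _ (hz n)
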